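/- Let (R, m) be a Cohen–Macaulay Noetherian local ring with dualizing complex and M a nonzero finitely generated R-module. The following are equivalent: (i) M is G–Gorenstein; (ii) depth_R M = dim_R M = Gid_R M = depth R; (iii) M is a balanced big Cohen–Macaulay module with Gid_R M < ∞; (iv) for every sequence x maximal with respect to being both M-regular and R-regular, M/xM is Gorenstein injective over R/xR; (v) for some such maximal sequence x, M/xM is Gorenstein injective over R/xR. -/

import Mathlib

universe u

namespace GG

open RingTheory.Sequence

variable (R : Type u) [CommRing R]

/-- A module `N` is Gorenstein injective if it is a kernel in a `Hom(Inj,−)`-exact exact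
doubly infinite complex of injective modules. -/
def IsGorensteinInjective (N : Type u) [AddCommGroup N] [Module R N] : Prop :=
  ∃ (X : ℤ → ModuleCat.{u} R) (d : ∀ n : ℤ, X n →ₗ[R] X (n + 1)),
    (∀ n, Module.Injective R (X n)) ∧
    (∀ n, LinearMap.range (d n) = LinearMap.ker (d (n + 1))) ∧
    (∀ (I : ModuleCat.{u} R), Module.Injective R I →
      ∀ (n : ℤ) (φ : I →ₗ[R] X (n + 1)), (d (n + 1)).comp φ = 0 →
        ∃ ψ : I →ₗ[R] X n, (d n).comp ψ = φ) ∧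
    Nonempty (N ≃ₗ[R] LinearMap.ker (d 0))

/-- A module `N` is Gorenstein projective if it is a kernel in a `Hom(−,Proj)`-exact exact
doubly infinite complex of projective modules. -/
def IsGorensteinProjective (N : Type u) [AddCommGroup N] [Module R N] : Prop :=
  ∃ (X : ℤ → ModuleCat.{u} R) (d : ∀ n : ℤ, X n →ₗ[R] X (n + 1)),
    (∀ n, Module.Projective R (X n)) ∧
    (∀ n, LinearMap.range (d n) = LinearMap.ker (d (n + 1))) ∧
    (∀ (P : ModuleCat.{u} R), Module.Projective R P →
      ∀ (n : ℤ) (φ : X (n + 1) →ₗ[R] P), φ.comp (d n) = 0 →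
        ∃ ψ : X (n + 1 + 1) →ₗ[R] P, ψ.comp (d (n + 1)) = φ) ∧
    Nonempty (N ≃ₗ[R] LinearMap.ker (d 0))

/-- A module `N` is Gorenstein flat if it is a kernel in an `(Inj ⊗ −)`-exact exact
doubly infinite complex of flat modules. -/
def IsGorensteinFlat (N : Type u) [AddCommGroup N] [Module R N] : Prop :=
  ∃ (X : ℤ → ModuleCat.{u} R) (d : ∀ n : ℤ, X n →ₗ[R] X (n + 1)),
    (∀ n, Module.Flat R (X n)) ∧
    (∀ n, LinearMap.range (d n) = LinearMap.ker (d (n + 1))) ∧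
    (∀ (I : ModuleCat.{u} R), Module.Injective R I →
      ∀ n : ℤ, LinearMap.range (LinearMap.lTensor (R := R) I (d n)) =
        LinearMap.ker (LinearMap.lTensor (R := R) I (d (n + 1)))) ∧
    Nonempty (N ≃ₗ[R] LinearMap.ker (d 0))

/-- Existence of a right resolution of length `≤ n` by modules satisfying `P`. -/
def CoresolutionLE (P : ModuleCat.{u} R → Prop) (M : Type u) [AddCommGroup M] [Module R M]
    (n : ℕ) : Prop :=
  ∃ (G : ℕ → ModuleCat.{u} R) (d : ∀ i : ℕ, G i →ₗ[R] G (i + 1)) (ε : M →ₗ[R] G 0),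
    (∀ i, P (G i)) ∧ Function.Injective ε ∧
    LinearMap.range ε = LinearMap.ker (d 0) ∧
    (∀ i, LinearMap.range (d i) = LinearMap.ker (d (i + 1))) ∧
    (∀ i, n < i → ∀ x : G i, x = 0)

/-- Existence of a left resolution of length `≤ n` by modules satisfying `P`. -/
def ResolutionLE (P : ModuleCat.{u} R → Prop) (M : Type u) [AddCommGroup M] [Module R M]
    (n : ℕ) : Prop :=
  ∃ (G : ℕ → ModuleCat.{u} R) (d : ∀ i : ℕ, G (i + 1) →ₗ[R] G i) (ε : G 0 →ₗ[R] M),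
    (∀ i, P (G i)) ∧ Function.Surjective ε ∧
    LinearMap.ker ε = LinearMap.range (d 0) ∧
    (∀ i, LinearMap.ker (d i) = LinearMap.range (d (i + 1))) ∧
    (∀ i, n < i → ∀ x : G i, x = 0)

/-- `Gid_R M ≤ n`. -/
def gidLE (M : Type u) [AddCommGroup M] [Module R M] (n : ℕ) : Prop :=
  CoresolutionLE R (fun N => IsGorensteinInjective R N) M n

/-- `id_R M ≤ n`. -/
def idLE (M : Type u) [AddCommGroup M] [Module R M] (n : ℕ) : Prop :=
  CoresolutionLE R (fun N => Module.Injective R N) M n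

/-- `pd_R M ≤ n`. -/
def pdLE (M : Type u) [AddCommGroup M] [Module R M] (n : ℕ) : Prop :=
  ResolutionLE R (fun N => Module.Projective R N) M n

/-- `fd_R M ≤ n`. -/
def fdLE (M : Type u) [AddCommGroup M] [Module R M] (n : ℕ) : Prop :=
  ResolutionLE R (fun N => Module.Flat R N) M n

/-- `Gfd_R M ≤ n`. -/
def gfdLE (M : Type u) [AddCommGroup M] [Module R M] (n : ℕ) : Prop :=
  ResolutionLE R (fun N => IsGorensteinFlat R N) M n

/-- Gorenstein injective dimension, as an extended natural number. -/
noncomputable def gid (M : Type u) [AddCommGroup M] [Module R M] : ℕ∞ :=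
  sInf {c : ℕ∞ | ∃ n : ℕ, c = n ∧ gidLE R M n}

/-- The depth of a module over a local ring: the supremum of the lengths of regular
sequences contained in the maximal ideal. -/
noncomputable def mdepth [IsLocalRing R] (M : Type u) [AddCommGroup M] [Module R M] : ℕ∞ :=
  sSup {c : ℕ∞ | ∃ rs : List R, c = rs.length ∧
    (∀ r ∈ rs, r ∈ IsLocalRing.maximalIdeal R) ∧ RingTheory.Sequence.IsRegular M rs}

/-- The Krull dimension of a module: the Krull dimension of its support. -/
noncomputable def mdim (M : Type u) [AddCommGroup M] [Module R M] : WithBot ℕ∞ :=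
  Order.krullDim ↥(Module.support R M)

/-- The height of a prime in the support of `M`. -/
noncomputable def htM (M : Type u) [AddCommGroup M] [Module R M] (p : PrimeSpectrum R) : ℕ∞ :=
  ⨆ h : p ∈ Module.support R M, Order.height (⟨p, h⟩ : ↥(Module.support R M))

/-- A Cohen–Macaulay module over a local ring: depth equals Krull dimension. -/
def IsCMModule [IsLocalRing R] (M : Type u) [AddCommGroup M] [Module R M] : Prop :=
  (mdepth R M : WithBot ℕ∞) = mdim R M

/-- A maximal Cohen–Macaulay module over a local ring. -/
def IsMaximalCM [IsLocalRing R] (M : Type u) [AddCommGroup M] [Module R M] : Prop :=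
  IsCMModule R M ∧ mdim R M = ringKrullDim R

/-- A Cohen–Macaulay local ring. -/
def IsCMLocalRing [IsLocalRing R] : Prop :=
  (mdepth R R : WithBot ℕ∞) = ringKrullDim R

/-- A Gorenstein local ring: a Noetherian local ring of finite self-injective dimension. -/
def IsGorensteinLocalRing [IsLocalRing R] : Prop :=
  IsNoetherianRing R ∧ ∃ n : ℕ, idLE R R n

/-- A regular local ring: Noetherian, and the maximal ideal is generated by `dim R` elements. -/
def IsRegularLocal [IsLocalRing R] : Prop :=
  IsNoetherianRing R ∧ ∃ s : Finset R, Ideal.span (s : Set R) = IsLocalRing.maximalIdeal R ∧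
    (s.card : WithBot ℕ∞) = ringKrullDim R

/-- A (not necessarily local) Gorenstein ring: all localizations at primes are Gorenstein. -/
def IsGorensteinRing : Prop :=
  ∀ p : PrimeSpectrum R, ∃ n : ℕ,
    idLE (Localization.AtPrime p.asIdeal) (Localization.AtPrime p.asIdeal) n

/-- `R` admits a dualizing complex; by Kawasaki's theorem this is equivalent to being a
homomorphic image of a finite-dimensional Gorenstein ring. -/
def HasDualizingComplex : Prop :=
  ∃ Q : CommRingCat.{u}, IsNoetherianRing Q ∧ ringKrullDim Q < ⊤ ∧ IsGorensteinRing Q ∧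
    ∃ f : Q →+* R, Function.Surjective f

section Cousin

/-- The product of the localizations of `N` at the primes in `S`. -/
noncomputable abbrev locProd (S : Set (PrimeSpectrum R)) (N : Type u) [AddCommGroup N]
    [Module R N] : Type u :=
  Π p : S, LocalizedModule p.1.asIdeal.primeCompl N

/-- The submodule of the product of localizations consisting of finitely supported families;
this is the direct sum `⊕_{p ∈ S} N_p`. -/
noncomputable def finSupp (S : Set (PrimeSpectrum R)) (N : Type u) [AddCommGroup N]
    [Module R N] : Submodule R (locProd R S N) where
  carrier := {f | {p : S | f p ≠ 0}.Finite}
  add_mem' := by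
    intro f g hf hg
    refine (hf.union hg).subset ?_
    intro p hp
    by_contra h
    simp only [Set.mem_union, Set.mem_setOf_eq, not_or, not_not] at h
    exact hp (by simp [Pi.add_apply, h.1, h.2])
  zero_mem' := by simp
  smul_mem' := by
    intro c f hf
    refine hf.subset ?_
    intro p hp
    by_contra h
    simp only [Set.mem_setOf_eq, not_not] at h
    exact hp (by simp [Pi.smul_apply, h])

/-- The canonical map `N → ∏_{p ∈ S} N_p`. -/
noncomputable def thetaFull (S : Set (PrimeSpectrum R)) (N : Type u) [AddCommGroup N]
    [Module R N] : N →ₗ[R] locProd R S N :=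
  LinearMap.pi fun p => LocalizedModule.mkLinearMap p.1.asIdeal.primeCompl N

/-- The cokernel of `N → ⊕_{p ∈ S} N_p` (computed inside the direct sum). -/
noncomputable abbrev nextKType (S : Set (PrimeSpectrum R)) (N : Type u) [AddCommGroup N]
    [Module R N] : Type u :=
  ↥(finSupp R S N) ⧸
    (Submodule.comap (finSupp R S N).subtype (LinearMap.range (thetaFull R S N)))

/-- The sequence of "kernel/cokernel" modules in the inductive construction
of the Cousin complex of `M` with respect to the filtration `F`. -/
noncomputable def cousinK (F : ℕ → Set (PrimeSpectrum R)) (M : ModuleCat.{u} R) :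
    ℕ → ModuleCat.{u} R
  | 0 => M
  | n + 1 => ModuleCat.of R (nextKType R (F n \ F (n + 1)) (cousinK F M n))

/-- The `n`-th term `M^n = ⊕_{p ∈ ∂F_n} (coker d^{n-2})_p` of the Cousin complex. -/
noncomputable abbrev cousinC (F : ℕ → Set (PrimeSpectrum R)) (M : ModuleCat.{u} R) (n : ℕ) :
    Type u :=
  ↥(finSupp R (F n \ F (n + 1)) (cousinK R F M n))

/-- The canonical map from the `n`-th cokernel into the product of its localizations. -/
noncomputable def cousinTheta (F : ℕ → Set (PrimeSpectrum R)) (M : ModuleCat.{u} R) (n : ℕ) :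
    (cousinK R F M n) →ₗ[R] locProd R (F n \ F (n + 1)) (cousinK R F M n) :=
  thetaFull R _ _

/-- The (full) `n`-th differential of the Cousin complex, from `M^n` to the product at
level `n+1` (it lands inside the direct sum `M^{n+1}`). -/
noncomputable def cousinD (F : ℕ → Set (PrimeSpectrum R)) (M : ModuleCat.{u} R) (n : ℕ) :
    (cousinC R F M n) →ₗ[R] locProd R (F (n + 1) \ F (n + 2)) (cousinK R F M (n + 1)) :=
  (cousinTheta R F M (n + 1)).comp
    (Submodule.mkQ (Submodule.comap (finSupp R (F n \ F (n + 1)) (cousinK R F M n)).subtype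
      (LinearMap.range (thetaFull R (F n \ F (n + 1)) (cousinK R F M n)))))

/-- `F` is a filtration of `Spec R`: descending, and every element of `∂F_n = F_n \ F_{n+1}`
is a minimal member of `F_n`. -/
def IsFiltration (F : ℕ → Set (PrimeSpectrum R)) : Prop :=
  (∀ n, F (n + 1) ⊆ F n) ∧
    ∀ n, ∀ p ∈ F n \ F (n + 1), ∀ q ∈ F n, q ≤ p → q = p

/-- The filtration `F` admits `M`. -/
def Admits (F : ℕ → Set (PrimeSpectrum R)) (M : Type u) [AddCommGroup M] [Module R M] : Prop :=
  Module.support R M ⊆ F 0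

/-- The `M`-height filtration `K_i = {p ∈ Supp M | ht_M p ≥ i}`. -/
noncomputable def heightFiltration (M : Type u) [AddCommGroup M] [Module R M] :
    ℕ → Set (PrimeSpectrum R) :=
  fun i => {p | p ∈ Module.support R M ∧ (i : ℕ∞) ≤ htM R M p}

/-- The Cousin complex `C(F, M)` is exact at `M, M⁰, …, M^t`
(together with the well-definedness of the differentials into the direct sums). -/
def CousinPartiallyExact (F : ℕ → Set (PrimeSpectrum R)) (M : ModuleCat.{u} R) (t : ℕ) : Prop :=
  (∀ n, LinearMap.range (cousinTheta R F M n) ≤ finSupp R (F n \ F (n + 1)) (cousinK R F M n)) ∧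
  Function.Injective (cousinTheta R F M 0) ∧
  (∀ n ≤ t, LinearMap.ker (cousinD R F M n) =
    Submodule.comap (finSupp R (F n \ F (n + 1)) (cousinK R F M n)).subtype
      (LinearMap.range (cousinTheta R F M n)))

/-- The Cousin complex `C(F, M)` is exact and all of its terms satisfy `P`, i.e. it provides
a `P`-resolution of `M`. -/
def CousinResolves (F : ℕ → Set (PrimeSpectrum R)) (M : ModuleCat.{u} R)
    (P : ModuleCat.{u} R → Prop) : Prop :=
  (∀ n, LinearMap.range (cousinTheta R F M n) ≤ finSupp R (F n \ F (n + 1)) (cousinK R F M n)) ∧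
  Function.Injective (cousinTheta R F M 0) ∧
  (∀ n, LinearMap.ker (cousinD R F M n) =
    Submodule.comap (finSupp R (F n \ F (n + 1)) (cousinK R F M n)).subtype
      (LinearMap.range (cousinTheta R F M n))) ∧
  (∀ n, P (ModuleCat.of R (cousinC R F M n)))

/-- A G–Gorenstein module: a nonzero finitely generated module whose Cousin complex with
respect to the `M`-height filtration is a Gorenstein injective resolution. -/
def IsGGorenstein (M : ModuleCat.{u} R) : Prop :=
  (∃ x : M, x ≠ 0) ∧ Module.Finite R M ∧
    CousinResolves R (heightFiltration R M) M (fun N => IsGorensteinInjective R N)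

/-- A Gorenstein module: a nonzero finitely generated module whose Cousin complex with
respect to the `M`-height filtration is an injective resolution. -/
def IsGorensteinModule (M : ModuleCat.{u} R) : Prop :=
  (∃ x : M, x ≠ 0) ∧ Module.Finite R M ∧
    CousinResolves R (heightFiltration R M) M (fun N => Module.Injective R N)

end Cousin

/-- A system of parameters of a local ring. -/
def IsSOP [IsLocalRing R] (rs : List R) : Prop :=
  (rs.length : WithBot ℕ∞) = ringKrullDim R ∧
    (∀ r ∈ rs, r ∈ IsLocalRing.maximalIdeal R) ∧
    IsLocalRing.maximalIdeal R ≤ (Ideal.span {r | r ∈ rs}).radical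

/-- A balanced big Cohen–Macaulay module: every system of parameters of `R` is a regular
sequence on `M`. -/
def IsBalancedBigCM [IsLocalRing R] (M : Type u) [AddCommGroup M] [Module R M] : Prop :=
  ∀ rs : List R, IsSOP R rs → RingTheory.Sequence.IsRegular M rs

end GG



namespace GGX

open CategoryTheory CategoryTheory.Abelian

variable (R : Type u) [CommRing R]

/-- vanishing of Ext -/
def EV (A B : Type u) [AddCommGroup A] [Module R A] [AddCommGroup B] [Module R B] (i : ℕ) : Prop :=
  Subsingleton (Ext (ModuleCat.of R A) (ModuleCat.of R B) i)

variable {R}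
variable {A B A₁ A₂ A₃ B₁ B₂ B₃ : Type u}
  [AddCommGroup A] [Module R A] [AddCommGroup B] [Module R B]
  [AddCommGroup A₁] [Module R A₁] [AddCommGroup A₂] [Module R A₂] [AddCommGroup A₃] [Module R A₃]
  [AddCommGroup B₁] [Module R B₁] [AddCommGroup B₂] [Module R B₂] [AddCommGroup B₃] [Module R B₃]

/-- short complex from exact linear maps -/
noncomputable abbrev SC (f : A₁ →ₗ[R] A₂) (g : A₂ →ₗ[R] A₃) (h : Function.Exact f g) :
    ShortComplex (ModuleCat.{u} R) :=
  ShortComplex.mk (ModuleCat.ofHom f) (ModuleCat.ofHom g) (by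
    ext x; exact h.apply_apply_eq_zero x)

theorem SC_se {f : A₁ →ₗ[R] A₂} {g : A₂ →ₗ[R] A₃} (hf : Function.Injective f)
    (h : Function.Exact f g) (hg : Function.Surjective g) : (SC f g h).ShortExact where
  exact := by
    rw [ShortComplex.moduleCat_exact_iff]
    intro x hx
    obtain ⟨y, hy⟩ := (h x).1 hx
    exact ⟨y, hy⟩
  mono_f := (ModuleCat.mono_iff_injective _).2 hf
  epi_g := (ModuleCat.epi_iff_surjective _).2 hg

theorem EV.of_forall {i : ℕ} (h : ∀ e : Ext (ModuleCat.of R A) (ModuleCat.of R B) i, e = 0) :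
    EV R A B i := ⟨fun a b => by rw [h a, h b]⟩

theorem EV.eq_zero {i : ℕ} (h : EV R A B i) (e : Ext (ModuleCat.of R A) (ModuleCat.of R B) i) :
    e = 0 := by
  have : Subsingleton _ := h
  exact Subsingleton.elim _ _

section LES
variable {f : A₁ →ₗ[R] A₂} {g : A₂ →ₗ[R] A₃}

theorem EV.cov2 (hf : Function.Injective f)
    (hx : Function.Exact f g) (hg : Function.Surjective g) {i : ℕ} (h1 : EV R A A₁ i) (h3 : EV R A A₃ i) : EV R A A₂ i := by
  refine .of_forall fun e => ?_
  obtain ⟨x, hx'⟩ := Ext.covariant_sequence_exact₂ (ModuleCat.of R A) (SC_se hf hx hg) e (h3.eq_zero _)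
  rw [← hx', h1.eq_zero x]; simp

theorem EV.cov3 (hf : Function.Injective f)
    (hx : Function.Exact f g) (hg : Function.Surjective g) {i : ℕ} (h2 : EV R A A₂ i) (h1 : EV R A A₁ (i+1)) : EV R A A₃ i := by
  refine .of_forall fun e => ?_
  obtain ⟨x, hx'⟩ := Ext.covariant_sequence_exact₃ (ModuleCat.of R A) (SC_se hf hx hg) e rfl (h1.eq_zero _)
  rw [← hx', h2.eq_zero x]; simp

theorem EV.cov1 (hf : Function.Injective f)
    (hx : Function.Exact f g) (hg : Function.Surjective g) {i : ℕ} (h3 : EV R A A₃ i) (h2 : EV R A A₂ (i+1)) : EV R A A₁ (i+1) := by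
  refine .of_forall fun e => ?_
  obtain ⟨x, hx'⟩ := Ext.covariant_sequence_exact₁ (ModuleCat.of R A) (SC_se hf hx hg) e (h2.eq_zero _) rfl
  rw [← hx', h3.eq_zero x]; simp

theorem EV.con2 (hf : Function.Injective f)
    (hx : Function.Exact f g) (hg : Function.Surjective g) {i : ℕ} (h1 : EV R A₁ B i) (h3 : EV R A₃ B i) : EV R A₂ B i := by
  refine .of_forall fun e => ?_
  obtain ⟨x, hx'⟩ := Ext.contravariant_sequence_exact₂ (SC_se hf hx hg) (ModuleCat.of R B) e (h1.eq_zero _)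
  rw [← hx', h3.eq_zero x]; simp

theorem EV.con1 (hf : Function.Injective f)
    (hx : Function.Exact f g) (hg : Function.Surjective g) {i : ℕ} (h2 : EV R A₂ B i) (h3 : EV R A₃ B (i+1)) : EV R A₁ B i := by
  refine .of_forall fun e => ?_
  obtain ⟨x, hx'⟩ := Ext.contravariant_sequence_exact₁ (SC_se hf hx hg) (ModuleCat.of R B) e (add_comm 1 i) (h3.eq_zero _)
  rw [← hx', h2.eq_zero x]; simp

theorem EV.con3 (hf : Function.Injective f)
    (hx : Function.Exact f g) (hg : Function.Surjective g) {i : ℕ} (h1 : EV R A₁ B i) (h2 : EV R A₂ B (i+1)) : EV R A₃ B (i+1) := by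
  refine .of_forall fun e => ?_
  obtain ⟨x, hx'⟩ := Ext.contravariant_sequence_exact₃ (SC_se hf hx hg) (ModuleCat.of R B) e (h2.eq_zero _) (add_comm 1 i)
  rw [← hx', h1.eq_zero x]; simp

/-- lifting of homs -/
theorem EV.lift (hf : Function.Injective f)
    (hx : Function.Exact f g) (hg : Function.Surjective g) (h1 : EV R A A₁ 1) (φ : A →ₗ[R] A₃) : ∃ ψ : A →ₗ[R] A₂, g ∘ₗ ψ = φ := by
  obtain ⟨x, hx'⟩ := Ext.covariant_sequence_exact₃ (ModuleCat.of R A) (SC_se hf hx hg)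
    (Ext.mk₀ (ModuleCat.ofHom φ)) (zero_add 1) (h1.eq_zero _)
  obtain ⟨y, rfl⟩ := Ext.mk₀_bijective _ _ |>.2 x
  refine ⟨y.hom, ?_⟩
  simp only [Ext.mk₀_comp_mk₀] at hx'
  have := (Ext.mk₀_bijective _ _).1 hx'
  have := congrArg ModuleCat.Hom.hom this
  simpa using this

theorem EV.cov1_of_lift (hf : Function.Injective f)
    (hx : Function.Exact f g) (hg : Function.Surjective g) (h2 : EV R A A₂ 1) (h : ∀ φ : A →ₗ[R] A₃, ∃ ψ : A →ₗ[R] A₂, g ∘ₗ ψ = φ) :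
    EV R A A₁ 1 := by
  refine .of_forall fun e => ?_
  obtain ⟨x, hx'⟩ := Ext.covariant_sequence_exact₁ (ModuleCat.of R A) (SC_se hf hx hg) e (h2.eq_zero _) (zero_add 1)
  obtain ⟨y, rfl⟩ := Ext.mk₀_bijective _ _ |>.2 x
  obtain ⟨ψ, hψ⟩ := h y.hom
  have : y = ModuleCat.ofHom ψ ≫ (SC f g hx).g := by
    ext a; simpa using (LinearMap.congr_fun hψ a).symm
  rw [← hx', this, ← Ext.mk₀_comp_mk₀_assoc, ShortComplex.ShortExact.comp_extClass]
  simp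

/-- extension of homs -/
theorem EV.extend (hf : Function.Injective f)
    (hx : Function.Exact f g) (hg : Function.Surjective g) (h3 : EV R A₃ B 1) (φ : A₁ →ₗ[R] B) : ∃ ψ : A₂ →ₗ[R] B, ψ ∘ₗ f = φ := by
  obtain ⟨x, hx'⟩ := Ext.contravariant_sequence_exact₁ (SC_se hf hx hg) (ModuleCat.of R B)
    (Ext.mk₀ (ModuleCat.ofHom φ)) (add_zero 1) (h3.eq_zero _)
  obtain ⟨y, rfl⟩ := Ext.mk₀_bijective _ _ |>.2 x
  refine ⟨y.hom, ?_⟩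
  simp only [Ext.mk₀_comp_mk₀] at hx'
  have := (Ext.mk₀_bijective _ _).1 hx'
  have := congrArg ModuleCat.Hom.hom this
  simpa using this

theorem EV.con3_of_extend (hf : Function.Injective f)
    (hx : Function.Exact f g) (hg : Function.Surjective g) (h2 : EV R A₂ B 1) (h : ∀ φ : A₁ →ₗ[R] B, ∃ ψ : A₂ →ₗ[R] B, ψ ∘ₗ f = φ) :
    EV R A₃ B 1 := by
  refine .of_forall fun e => ?_
  obtain ⟨x, hx'⟩ := Ext.contravariant_sequence_exact₃ (SC_se hf hx hg) (ModuleCat.of R B) e (h2.eq_zero _) (add_zero 1)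
  obtain ⟨y, rfl⟩ := Ext.mk₀_bijective _ _ |>.2 x
  obtain ⟨ψ, hψ⟩ := h y.hom
  have : y = (SC f g hx).f ≫ ModuleCat.ofHom ψ := by
    ext a; simpa using (LinearMap.congr_fun hψ a).symm
  rw [← hx', this, ← Ext.mk₀_comp_mk₀, ← Ext.comp_assoc_of_third_deg_zero,
    ShortComplex.ShortExact.extClass_comp]
  simp
end LES

theorem EV.proj [Module.Projective R A] (i : ℕ) : EV R A B (i+1) := by
  have : Projective (ModuleCat.of R A) := (IsProjective.iff_projective A).1 inferInstance
  exact .of_forall fun e => Ext.eq_zero_of_projective e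

theorem EV.inj (hB : Module.Injective R B) (i : ℕ) : EV R A B (i+1) := by
  have : Injective (ModuleCat.of R B) := (Module.injective_iff_injective_object R B).1 hB
  exact .of_forall fun e => Ext.eq_zero_of_injective e

theorem EV.zero_iff : EV R A B 0 ↔ Subsingleton (A →ₗ[R] B) :=
  ((Ext.addEquiv₀ (X := ModuleCat.of R A) (Y := ModuleCat.of R B)).toEquiv.trans
    ModuleCat.homEquiv).subsingleton_congr

theorem EV.of_equiv {i : ℕ} (e₁ : A₁ ≃ₗ[R] A₂) (e₂ : B₁ ≃ₗ[R] B₂) (h : EV R A₁ B₁ i) :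
    EV R A₂ B₂ i := by
  refine .of_forall fun e => ?_
  have := h.eq_zero ((Ext.mk₀ (ModuleCat.ofHom e₁.toLinearMap)).comp (e.comp
    (Ext.mk₀ (ModuleCat.ofHom e₂.symm.toLinearMap)) (add_zero i)) (zero_add i))
  have h2 : e = (Ext.mk₀ (ModuleCat.ofHom e₁.symm.toLinearMap)).comp
     (((Ext.mk₀ (ModuleCat.ofHom e₁.toLinearMap)).comp (e.comp
    (Ext.mk₀ (ModuleCat.ofHom e₂.symm.toLinearMap)) (add_zero i)) (zero_add i)).comp
      (Ext.mk₀ (ModuleCat.ofHom e₂.toLinearMap)) (add_zero i)) (zero_add i) := by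
    simp only [Ext.comp_assoc_of_third_deg_zero, Ext.mk₀_comp_mk₀, Ext.mk₀_comp_mk₀_assoc,
      ← ModuleCat.ofHom_comp]
    simp [ModuleCat.ofHom_id]
  rw [h2, this]; simp

theorem EV.of_iso {i : ℕ} (e₁ : A₁ ≃ₗ[R] A₂) (h : EV R A₁ B i) : EV R A₂ B i :=
  h.of_equiv e₁ (.refl R B)

theorem EV.of_iso' {i : ℕ} (e₁ : B₁ ≃ₗ[R] B₂) (h : EV R A B₁ i) : EV R A B₂ i :=
  h.of_equiv (.refl R A) e₁

theorem EV.of_subsingleton_left [Subsingleton A] (i : ℕ) : EV R A B i := by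
  refine .of_forall fun e => ?_
  have : Ext.mk₀ (𝟙 (ModuleCat.of R A)) = 0 := by
    rw [Ext.mk₀_eq_zero_iff]; ext x; exact Subsingleton.elim _ _
  rw [← Ext.mk₀_id_comp e, this]; simp

theorem EV.of_subsingleton_right [Subsingleton B] (i : ℕ) : EV R A B i := by
  refine .of_forall fun e => ?_
  have : Ext.mk₀ (𝟙 (ModuleCat.of R B)) = 0 := by
    rw [Ext.mk₀_eq_zero_iff]; ext x; exact Subsingleton.elim _ _
  rw [← Ext.comp_mk₀_id e, this]; simp

end GGX


namespace GGX

open CategoryTheory CategoryTheory.Abelian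
open scoped Pointwise

variable {R : Type u} [CommRing R]
variable {A B A₁ A₂ A₃ B₁ B₂ B₃ : Type u}
  [AddCommGroup A] [Module R A] [AddCommGroup B] [Module R B]
  [AddCommGroup A₁] [Module R A₁] [AddCommGroup A₂] [Module R A₂] [AddCommGroup A₃] [Module R A₃]
  [AddCommGroup B₁] [Module R B₁] [AddCommGroup B₂] [Module R B₂] [AddCommGroup B₃] [Module R B₃]

theorem ext_smul_left (x : R) {i : ℕ} (e : Ext (ModuleCat.of R A) (ModuleCat.of R B) i) :
    (Ext.mk₀ (ModuleCat.ofHom (LinearMap.lsmul R A x))).comp e (zero_add i) = x • e := by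
  have : ModuleCat.ofHom (LinearMap.lsmul R A x) = x • 𝟙 (ModuleCat.of R A) := by
    ext a; simp
  rw [this, Ext.mk₀_smul, Ext.smul_comp, Ext.mk₀_id_comp]

theorem ext_smul_right (x : R) {i : ℕ} (e : Ext (ModuleCat.of R A) (ModuleCat.of R B) i) :
    e.comp (Ext.mk₀ (ModuleCat.ofHom (LinearMap.lsmul R B x))) (add_zero i) = x • e := by
  have : ModuleCat.ofHom (LinearMap.lsmul R B x) = x • 𝟙 (ModuleCat.of R B) := by
    ext a; simp
  rw [this, Ext.smul_eq_comp_mk₀]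

theorem ext_smul_eq_zero_left (x : R) (h : ∀ a : A, x • a = 0) {i : ℕ}
    (e : Ext (ModuleCat.of R A) (ModuleCat.of R B) i) : x • e = 0 := by
  rw [← ext_smul_left]
  have : ModuleCat.ofHom (LinearMap.lsmul R A x) = 0 := by
    ext a; simpa using h a
  rw [this]; simp

theorem subsingleton_of_smul_surj [IsLocalRing R] (x : R) (hx : x ∈ IsLocalRing.maximalIdeal R)
    {N : Type*} [AddCommGroup N] [Module R N] [Module.Finite R N]
    (h : ∀ e : N, ∃ e', x • e' = e) : Subsingleton N := by
  have : (⊤ : Submodule R N) = ⊥ := by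
    refine Submodule.eq_bot_of_le_smul_of_le_jacobson_bot (IsLocalRing.maximalIdeal R) _
      Module.Finite.fg_top ?_ (IsLocalRing.maximalIdeal_le_jacobson _)
    intro e _
    obtain ⟨e', rfl⟩ := h e
    exact Submodule.smul_mem_smul hx trivial
  exact (Submodule.subsingleton_iff R).1 (subsingleton_of_top_eq_bot this) 

section Nak
variable [IsLocalRing R] [IsNoetherianRing R] [Module.Finite R A] [Module.Finite R B]

theorem EV.nak_con {x : R} (hx : x ∈ IsLocalRing.maximalIdeal R) (hA : IsSMulRegular A x)
    {g : A →ₗ[R] A₃} (hex : Function.Exact (LinearMap.lsmul R A x) g) (hg : Function.Surjective g)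
    {i : ℕ} (h : EV R A₃ B (i+1)) : EV R A B i := by
  refine subsingleton_of_smul_surj x hx fun e => ?_
  obtain ⟨y, hy⟩ := Ext.contravariant_sequence_exact₁ (SC_se (f := LinearMap.lsmul R A x) hA hex hg) (ModuleCat.of R B) e (add_comm 1 i) (h.eq_zero _)
  exact ⟨y, by rw [← hy]; exact (ext_smul_left x y).symm⟩

theorem EV.nak_cov {x : R} (hx : x ∈ IsLocalRing.maximalIdeal R) (hB : IsSMulRegular B x)
    {g : B →ₗ[R] B₃} (hex : Function.Exact (LinearMap.lsmul R B x) g) (hg : Function.Surjective g)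
    {i : ℕ} (h : EV R A B₃ i) : EV R A B i := by
  refine subsingleton_of_smul_surj x hx fun e => ?_
  obtain ⟨y, hy⟩ := Ext.covariant_sequence_exact₂ (ModuleCat.of R A) (SC_se (f := LinearMap.lsmul R B x) hB hex hg) e (h.eq_zero _)
  exact ⟨y, by rw [← hy]; exact (ext_smul_right x y).symm⟩
end Nak

theorem EV.of_kill_bij (x : R) (hA : ∀ a : A, x • a = 0) (hB : Function.Bijective (fun b : B => x • b))
    (i : ℕ) : EV R A B i := by
  refine .of_forall fun e => ?_
  let f : B ≃ₗ[R] B := LinearEquiv.ofBijective (LinearMap.lsmul R B x) hB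
  have h1 := ext_smul_eq_zero_left x hA e
  rw [← ext_smul_right] at h1
  have h2 : (e.comp (Ext.mk₀ (ModuleCat.ofHom (LinearMap.lsmul R B x))) (add_zero i)).comp
    (Ext.mk₀ (ModuleCat.ofHom f.symm.toLinearMap)) (add_zero i) = e := by
    rw [Ext.comp_assoc_of_third_deg_zero, Ext.mk₀_comp_mk₀, ← ModuleCat.ofHom_comp]
    have : f.symm.toLinearMap ∘ₗ (LinearMap.lsmul R B x) = LinearMap.id := by
      ext b; exact f.symm_apply_apply b
    rw [this, ModuleCat.ofHom_id, Ext.comp_mk₀_id]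
  rw [← h2, h1]; simp

/-- quotient by x: the exact sequence -/
theorem exact_lsmul_mkQ (x : R) :
    Function.Exact (LinearMap.lsmul R A x) (Submodule.mkQ (x • (⊤ : Submodule R A))) := by
  intro a
  rw [Submodule.mkQ_apply, Submodule.Quotient.mk_eq_zero]
  constructor
  · intro h
    obtain ⟨b, -, hb⟩ := (Submodule.mem_smul_pointwise_iff_exists _ _ _).1 h
    exact ⟨b, hb⟩
  · rintro ⟨b, rfl⟩
    exact Submodule.smul_mem_pointwise_smul _ _ _ trivial

theorem exists_inj_embed (A : Type u) [AddCommGroup A] [Module R A] :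
    ∃ (I : ModuleCat.{u} R) (f : A →ₗ[R] I), Module.Injective R I ∧ Function.Injective f := by
  have : EnoughInjectives (ModuleCat.{u} R) := ModuleCat.enoughInjectives.{u} R
  let f := Injective.ι (ModuleCat.of R A)
  refine ⟨Injective.under (ModuleCat.of R A), f.hom, ?_, ?_⟩
  · exact (Module.injective_iff_injective_object R _).2 (inferInstanceAs (Injective (Injective.under (ModuleCat.of R A))))
  · exact (ModuleCat.mono_iff_injective f).1 inferInstance

theorem inj_of_EV (h : ∀ I : Ideal R, EV R (R ⧸ I) B 1) : Module.Injective R B := by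
  rw [← Module.Baer.iff_injective]
  intro I g
  obtain ⟨ψ, hψ⟩ := EV.extend (f := I.subtype) (g := I.mkQ) Subtype.val_injective
    (LinearMap.exact_subtype_mkQ I) (Submodule.mkQ_surjective I) (h I) g
  exact ⟨ψ, fun x hx => LinearMap.congr_fun hψ ⟨x, hx⟩⟩

/-- injective dimension at most `n` -/
def ID (R : Type u) [CommRing R] (B : Type u) [AddCommGroup B] [Module R B] (n : ℕ) : Prop :=
  ∀ (A : Type u) [AddCommGroup A] [Module R A] (i : ℕ), n < i → EV R A B i

theorem ID.mono {n m : ℕ} (h : ID R B n) (hnm : n ≤ m) : ID R B m :=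
  fun A _ _ i hi => h A i (by omega)

theorem ID.zero (hB : Module.Injective R B) : ID R B 0 := by
  intro A _ _ i hi
  obtain ⟨i, rfl⟩ : ∃ j, i = j + 1 := ⟨i - 1, by omega⟩
  exact .inj hB i

theorem ID.succ {f : B₁ →ₗ[R] B₂} {g : B₂ →ₗ[R] B₃} (hf : Function.Injective f)
    (hx : Function.Exact f g) (hg : Function.Surjective g) {n : ℕ} (h2 : ID R B₂ (n+1))
    (h3 : ID R B₃ n) : ID R B₁ (n+1) := by
  intro A _ _ i hi
  obtain ⟨i, rfl⟩ : ∃ j, i = j + 1 := ⟨i - 1, by omega⟩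
  exact EV.cov1 hf hx hg (h3 A i (by omega)) (h2 A (i+1) (by omega))

theorem ID.coker {f : B₁ →ₗ[R] B₂} {g : B₂ →ₗ[R] B₃} (hf : Function.Injective f)
    (hx : Function.Exact f g) (hg : Function.Surjective g) {n : ℕ} (h2 : ID R B₂ n)
    (h1 : ID R B₁ (n+1)) : ID R B₃ n := by
  intro A _ _ i hi
  exact EV.cov3 hf hx hg (h2 A i hi) (h1 A (i+1) (by omega))

theorem ID.inj (h : ID R B 0) : Module.Injective R B := inj_of_EV fun I => h _ 1 (by omega)

theorem ID_of_EV {n : ℕ} (h : ∀ I : Ideal R, EV R (R ⧸ I) B (n+1)) : ID R B n := by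
  induction n generalizing B with
  | zero => exact .zero (inj_of_EV h)
  | succ n ih =>
    obtain ⟨I, f, hI, hf⟩ := exists_inj_embed (R := R) B
    refine ID.succ hf (LinearMap.exact_map_mkQ_range f) (Submodule.mkQ_surjective _)
      ((ID.zero hI).mono (by omega)) (ih fun J => ?_)
    exact EV.cov3 hf (LinearMap.exact_map_mkQ_range f) (Submodule.mkQ_surjective _) (.inj hI _) (h J)

theorem ID.of_equiv {n : ℕ} (e : B₁ ≃ₗ[R] B₂) (h : ID R B₁ n) : ID R B₂ n :=
  fun A _ _ i hi => (h A i hi).of_iso' e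

theorem inj_of_equiv (e : B₁ ≃ₗ[R] B₂) (h : Module.Injective R B₁) : Module.Injective R B₂ :=
  ((ID.zero h).of_equiv e).inj

theorem EV.prod {i : ℕ} (h1 : EV R A B₁ i) (h2 : EV R A B₂ i) : EV R A (B₁ × B₂) i :=
  EV.cov2 (f := LinearMap.inl R B₁ B₂) (g := LinearMap.snd R B₁ B₂) LinearMap.inl_injective
    (.inl_snd) LinearMap.snd_surjective h1 h2

theorem EV.prod_left {i : ℕ} (h1 : EV R A₁ B i) (h2 : EV R A₂ B i) : EV R (A₁ × A₂) B i :=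
  EV.con2 (f := LinearMap.inl R A₁ A₂) (g := LinearMap.snd R A₁ A₂) LinearMap.inl_injective
    (.inl_snd) LinearMap.snd_surjective h1 h2

/-- retracts -/
theorem EV.retract_right {i : ℕ} (f : B₁ →ₗ[R] B₂) (g : B₂ →ₗ[R] B₁) (hgf : g ∘ₗ f = LinearMap.id)
    (h : EV R A B₂ i) : EV R A B₁ i := by
  refine .of_forall fun e => ?_
  have h2 : (e.comp (Ext.mk₀ (ModuleCat.ofHom f)) (add_zero i)).comp
    (Ext.mk₀ (ModuleCat.ofHom g)) (add_zero i) = e := by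
    rw [Ext.comp_assoc_of_third_deg_zero, Ext.mk₀_comp_mk₀, ← ModuleCat.ofHom_comp, hgf,
      ModuleCat.ofHom_id, Ext.comp_mk₀_id]
  rw [← h2, h.eq_zero (e.comp (Ext.mk₀ (ModuleCat.ofHom f)) (add_zero i))]; simp

theorem EV.retract_left {i : ℕ} (f : A₁ →ₗ[R] A₂) (g : A₂ →ₗ[R] A₁) (hgf : g ∘ₗ f = LinearMap.id)
    (h : EV R A₂ B i) : EV R A₁ B i := by
  refine .of_forall fun e => ?_
  have h2 : (Ext.mk₀ (ModuleCat.ofHom f)).comp ((Ext.mk₀ (ModuleCat.ofHom g)).comp e (zero_add i)) (zero_add i) = e := by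
    rw [Ext.mk₀_comp_mk₀_assoc, ← ModuleCat.ofHom_comp, hgf,
      ModuleCat.ofHom_id, Ext.mk₀_id_comp]
  rw [← h2, h.eq_zero ((Ext.mk₀ (ModuleCat.ofHom g)).comp e (zero_add i))]; simp

theorem EV.pi_fin {i : ℕ} (h : EV R A B i) (n : ℕ) : EV R A (Fin n → B) i := by
  induction n with
  | zero => exact .of_subsingleton_right _
  | succ n ih =>
    refine (h.prod ih).of_iso' (LinearEquiv.mk ⟨⟨fun p => Fin.cons p.1 p.2, ?_⟩, ?_⟩ (fun f => (f 0, fun j => f j.succ)) ?_ ?_)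
    · intro a b; ext j; refine Fin.cases ?_ (fun j => ?_) j <;> simp
    · intro a b; ext j; refine Fin.cases ?_ (fun j => ?_) j <;> simp
    · intro a; simp
    · intro a; ext j; refine Fin.cases ?_ (fun j => ?_) j <;> simp

theorem EV.pi_fin_left {i : ℕ} (h : EV R A B i) (n : ℕ) : EV R (Fin n → A) B i := by
  induction n with
  | zero => exact .of_subsingleton_left _
  | succ n ih =>
    refine (h.prod_left ih).of_iso (LinearEquiv.mk ⟨⟨fun p => Fin.cons p.1 p.2, ?_⟩, ?_⟩ (fun f => (f 0, fun j => f j.succ)) ?_ ?_)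
    · intro a b; ext j; refine Fin.cases ?_ (fun j => ?_) j <;> simp
    · intro a b; ext j; refine Fin.cases ?_ (fun j => ?_) j <;> simp
    · intro a; simp
    · intro a; ext j; refine Fin.cases ?_ (fun j => ?_) j <;> simp

/-- syzygy of a finitely generated module -/
theorem exists_syz [IsNoetherianRing R] (A : Type u) [AddCommGroup A] [Module R A] [Module.Finite R A] :
    ∃ (n : ℕ) (g : (Fin n → R) →ₗ[R] A), Function.Surjective g ∧ 
      Function.Exact (LinearMap.ker g).subtype g ∧ Module.Finite R (LinearMap.ker g) := by
  obtain ⟨n, g, hg⟩ := Module.Finite.exists_fin' R A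
  exact ⟨n, g, hg, LinearMap.exact_subtype_ker_map g, inferInstance⟩

end GGX


namespace GGX

open CategoryTheory CategoryTheory.Abelian
open scoped Pointwise

variable {R : Type u} [CommRing R]
variable {A B N A₁ A₂ A₃ : Type u}
  [AddCommGroup A] [Module R A] [AddCommGroup B] [Module R B] [AddCommGroup N] [Module R N]
  [AddCommGroup A₁] [Module R A₁] [AddCommGroup A₂] [Module R A₂] [AddCommGroup A₃] [Module R A₃]

theorem lcomp_inj {g : A₂ →ₗ[R] A₃} (hg : Function.Surjective g) :
    Function.Injective (LinearMap.lcomp R N g) := by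
  intro a b h
  ext x
  obtain ⟨y, rfl⟩ := hg x
  exact LinearMap.congr_fun h y

theorem lcomp_exact {f : A₁ →ₗ[R] A₂} {g : A₂ →ₗ[R] A₃} (hx : Function.Exact f g)
    (hg : Function.Surjective g) :
    Function.Exact (LinearMap.lcomp R N g) (LinearMap.lcomp R N f) := by
  intro φ
  constructor
  · intro h
    have h1 : LinearMap.ker g ≤ LinearMap.ker φ := by
      intro x hx'
      obtain ⟨y, rfl⟩ := (hx x).1 hx'
      exact LinearMap.congr_fun h y
    let e := g.quotKerEquivOfSurjective hg
    refine ⟨((LinearMap.ker g).liftQ φ h1) ∘ₗ e.symm.toLinearMap, ?_⟩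
    ext x
    have : e.symm (g x) = (LinearMap.ker g).mkQ x := by
      rw [LinearEquiv.symm_apply_eq]; rfl
    simp [this]
  · rintro ⟨ψ, rfl⟩
    ext x
    simp [hx.apply_apply_eq_zero x]

/-- contravariant hom is exact for injective targets (not nec. short exact) -/
theorem lcomp_exact_inj {f : A₁ →ₗ[R] A₂} {g : A₂ →ₗ[R] A₃} (hx : Function.Exact f g)
    (hN : Module.Injective R N) :
    Function.Exact (LinearMap.lcomp R N g) (LinearMap.lcomp R N f) := by
  intro φ
  constructor
  · intro h
    have hx' : Function.Exact f g.rangeRestrict := by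
      intro y; rw [← hx y]; simp [Subtype.ext_iff]
    obtain ⟨ψ, hψ⟩ := (lcomp_exact (N := N) hx' (LinearMap.surjective_rangeRestrict g) φ).1 h
    obtain ⟨χ, hχ⟩ := hN.out (LinearMap.range g).subtype Subtype.val_injective ψ
    refine ⟨χ, ?_⟩
    ext y
    rw [← hψ]
    simpa using hχ (g.rangeRestrict y)
  · rintro ⟨ψ, rfl⟩
    ext x
    simp [hx.apply_apply_eq_zero x]

theorem lcomp_surj_inj {f : A₁ →ₗ[R] A₂} (hf : Function.Injective f)
    (hN : Module.Injective R N) : Function.Surjective (LinearMap.lcomp R N f) := by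
  intro φ
  obtain ⟨χ, hχ⟩ := hN.out f hf φ
  exact ⟨χ, by ext y; simpa using hχ y⟩

theorem lcomp_surj_EV {f : A₁ →ₗ[R] A₂} {g : A₂ →ₗ[R] A₃} (hf : Function.Injective f)
    (hx : Function.Exact f g) (hg : Function.Surjective g) (h : EV R A₃ N 1) :
    Function.Surjective (LinearMap.lcomp R N f) := fun φ => EV.extend hf hx hg h φ

/-- Hom from a finite free module -/
noncomputable def homFin (n : ℕ) (N : Type u) [AddCommGroup N] [Module R N] :
    (Fin n → N) ≃ₗ[R] ((Fin n → R) →ₗ[R] N) := (LinearEquiv.piRing R N (Fin n) R).symm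

theorem EV.homFin {i n : ℕ} (h : EV R A N i) : EV R A ((Fin n → R) →ₗ[R] N) i :=
  (h.pi_fin n).of_iso' (GGX.homFin n N)

theorem EV.homFin_left {i n : ℕ} (h : EV R A N i) : EV R ((Fin n → R) →ₗ[R] A) N i :=
  (h.pi_fin_left n).of_iso (GGX.homFin n A)

theorem swap [IsNoetherianRing R] [Module.Finite R A] (hA : ∀ i, EV R A N (i+1))
    (hB : ∀ i, EV R B N (i+1)) (i : ℕ) :
    EV R A (B →ₗ[R] N) (i+1) ↔ EV R B (A →ₗ[R] N) (i+1) := by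
  induction i generalizing A with
  | zero =>
    obtain ⟨n, g, hg, hex, _⟩ := exists_syz (R := R) A
    have hf : Function.Injective (LinearMap.ker g).subtype := Subtype.val_injective
    have i1 := lcomp_inj (N := N) hg
    have e1 := lcomp_exact (N := N) hex hg
    have s1 := lcomp_surj_EV (N := N) hf hex hg (hA 0)
    constructor
    · intro h
      refine EV.cov1_of_lift i1 e1 s1 (hB 0).homFin fun φ => ?_
      obtain ⟨ψ, hψ⟩ := EV.extend hf hex hg h φ.flip
      refine ⟨ψ.flip, ?_⟩
      ext b x
      exact LinearMap.congr_fun (LinearMap.congr_fun hψ x) b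
    · intro h
      refine EV.con3_of_extend hf hex hg (.proj 0) fun φ => ?_
      obtain ⟨ψ, hψ⟩ := EV.lift i1 e1 s1 h φ.flip
      refine ⟨ψ.flip, ?_⟩
      apply LinearMap.ext; intro x
      apply LinearMap.ext; intro b
      exact LinearMap.congr_fun (LinearMap.congr_fun hψ b) x
  | succ i ih =>
    obtain ⟨n, g, hg, hex, _⟩ := exists_syz (R := R) A
    have hf : Function.Injective (LinearMap.ker g).subtype := Subtype.val_injective
    have i1 := lcomp_inj (N := N) hg
    have e1 := lcomp_exact (N := N) hex hg
    have s1 := lcomp_surj_EV (N := N) hf hex hg (hA 0)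
    have hK : ∀ i, EV R (LinearMap.ker g) N (i+1) := fun i =>
      EV.con1 hf hex hg (.proj i) (hA (i+1))
    constructor
    · intro h
      exact EV.cov1 i1 e1 s1 ((ih hK).1 (EV.con1 hf hex hg (.proj i) h)) (hB _).homFin
    · intro h
      exact EV.con3 hf hex hg ((ih hK).2 (EV.cov3 i1 e1 s1 (hB _).homFin h)) (.proj _)

section T
variable (N) (J I : Type u) [AddCommGroup J] [Module R J] [AddCommGroup I] [Module R I]

/-- the canonical map `T Hom(A,N) → Hom(A, T N)` -/
noncomputable def PhiT (A : Type u) [AddCommGroup A] [Module R A] :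
    (((A →ₗ[R] N) →ₗ[R] J) →ₗ[R] I) →ₗ[R] (A →ₗ[R] ((N →ₗ[R] J) →ₗ[R] I)) where
  toFun τ := LinearMap.mk₂ R (fun a g => τ (g ∘ₗ LinearMap.applyₗ a))
    (fun a b g => by rw [← map_add]; congr 1; ext h; simp)
    (fun c a g => by rw [← map_smul]; congr 1; ext h; simp)
    (fun a g g' => by rw [← map_add]; congr 1)
    (fun c a g => by rw [← map_smul]; congr 1)
  map_add' a b := by ext; simp
  map_smul' a b := by ext; simp

@[simp] theorem PhiT_apply (τ : (((A →ₗ[R] N) →ₗ[R] J) →ₗ[R] I)) (a : A) (g : N →ₗ[R] J) :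
    PhiT N J I A τ a g = τ (g ∘ₗ LinearMap.applyₗ a) := rfl

/-- coordinate insert -/
noncomputable def cins (n : ℕ) (j : Fin n) : N →ₗ[R] ((Fin n → R) →ₗ[R] N) :=
  LinearMap.mk₂ R (fun y c => c j • y) (by simp) (fun a y c => smul_comm _ _ _) (by simp [add_smul]) (by simp [mul_smul])

@[simp] theorem cins_apply (n : ℕ) (j : Fin n) (y : N) (c : Fin n → R) : cins N n j y c = c j • y := rfl

theorem cins_sum (n : ℕ) (h : (Fin n → R) →ₗ[R] N) :
    h = ∑ j, cins N n j (h (Pi.single j 1)) := by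
  apply LinearMap.pi_ext'
  intro j
  ext
  simp [LinearMap.sum_apply, Pi.single_apply, ite_smul]

theorem xi_sum (n : ℕ) (ξ : ((Fin n → R) →ₗ[R] N) →ₗ[R] J) :
    ξ = ∑ j, (ξ ∘ₗ cins N n j) ∘ₗ LinearMap.applyₗ (Pi.single j 1 : Fin n → R) := by
  apply LinearMap.ext; intro h
  conv_lhs => rw [cins_sum N n h]
  simp [LinearMap.sum_apply]

theorem PhiT_free (n : ℕ) : Function.Bijective (PhiT (R := R) N J I (Fin n → R)) := by
  constructor
  · rw [injective_iff_map_eq_zero]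
    intro τ hτ
    ext ξ
    rw [xi_sum N J n ξ, map_sum]
    refine Finset.sum_eq_zero fun j _ => ?_
    exact LinearMap.congr_fun (LinearMap.congr_fun hτ (Pi.single j 1)) (ξ ∘ₗ cins N n j)
  · intro ψ
    refine ⟨∑ j, (ψ (Pi.single j 1)) ∘ₗ LinearMap.lcomp R J (cins N n j), ?_⟩
    apply LinearMap.pi_ext'
    intro j
    ext g
    simp only [LinearMap.coe_comp, LinearMap.coe_single, Function.comp_apply, PhiT_apply,
      LinearMap.sum_apply, LinearMap.lcomp_apply']
    rw [Finset.sum_eq_single j]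
    · congr 1; ext y; simp
    · intro k _ hk
      have : (g ∘ₗ LinearMap.applyₗ (Pi.single j 1 : Fin n → R)) ∘ₗ cins N n k = 0 := by
        ext y; simp [Pi.single_apply, hk]
      rw [this, map_zero]
    · simp

variable {J I}
theorem PhiT_surj [IsNoetherianRing R] [Module.Finite R A] (hJ : Module.Injective R J)
    (hI : Module.Injective R I) : Function.Surjective (PhiT (R := R) N J I A) := by
  intro ψ
  obtain ⟨n, g, hg, hex, _⟩ := exists_syz (R := R) A
  obtain ⟨m, g', hg', -, _⟩ := exists_syz (R := R) (LinearMap.ker g)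
  let f : (Fin m → R) →ₗ[R] (Fin n → R) := (LinearMap.ker g).subtype ∘ₗ g'
  have hfg : Function.Exact f g := by
    intro y
    rw [hex y]
    constructor
    · rintro ⟨z, rfl⟩
      obtain ⟨w, rfl⟩ := hg' z
      exact ⟨w, rfl⟩
    · rintro ⟨z, rfl⟩
      exact ⟨g' z, rfl⟩
  have e1 := lcomp_exact (N := N) hfg hg
  have i1 := lcomp_inj (N := N) hg
  have e2 := lcomp_exact_inj (N := I) (lcomp_exact_inj (N := J) e1 hJ) hI
  obtain ⟨τ, hτ⟩ := (PhiT_free N J I n).2 (ψ ∘ₗ g)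
  have : LinearMap.lcomp R I (LinearMap.lcomp R J (LinearMap.lcomp R N f)) τ = 0 := by
    apply (PhiT_free N J I m).1
    ext c h
    have := LinearMap.congr_fun (LinearMap.congr_fun hτ (f (Pi.single c 1))) h
    simp [hfg.apply_apply_eq_zero] at this
    simp only [map_zero, LinearMap.coe_comp, Function.comp_apply, LinearMap.coe_single, PhiT_apply]
    exact this
  obtain ⟨σ, hσ⟩ := (e2 τ).1 this
  refine ⟨σ, ?_⟩
  ext a h
  obtain ⟨b, rfl⟩ := hg a
  have := LinearMap.congr_fun (LinearMap.congr_fun hτ b) h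
  rw [LinearMap.comp_apply] at this
  rw [← this, ← hσ]
  rfl

theorem EV_T [IsNoetherianRing R] [Module.Finite R A] (hJ : Module.Injective R J)
    (hI : Module.Injective R I) (h : ∀ i, EV R A N (i+1)) (i : ℕ) :
    EV R A ((N →ₗ[R] J) →ₗ[R] I) (i+1) := by
  induction i generalizing A with
  | zero =>
    obtain ⟨n, g, hg, hex, _⟩ := exists_syz (R := R) A
    have hf : Function.Injective (LinearMap.ker g).subtype := Subtype.val_injective
    refine EV.con3_of_extend hf hex hg (.proj 0) fun φ => ?_
    obtain ⟨τ, rfl⟩ := PhiT_surj N hJ hI φ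
    have s1 := lcomp_surj_EV (N := N) hf hex hg (h 0)
    have s3 := lcomp_surj_inj (lcomp_inj (N := J) s1) hI
    obtain ⟨σ, rfl⟩ := s3 τ
    exact ⟨PhiT N J I _ σ, rfl⟩
  | succ i ih =>
    obtain ⟨n, g, hg, hex, _⟩ := exists_syz (R := R) A
    have hf : Function.Injective (LinearMap.ker g).subtype := Subtype.val_injective
    exact EV.con3 hf hex hg (ih fun i => EV.con1 hf hex hg (.proj i) (h (i+1))) (.proj _)
end T

end GGX


namespace GGX

open CategoryTheory CategoryTheory.Abelian
open scoped Pointwise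

variable {R : Type u} [CommRing R]

/-- evaluation map into the double dual -/
noncomputable def evd (R : Type u) [CommRing R] (ω X : Type u) [AddCommGroup ω] [Module R ω]
    [AddCommGroup X] [Module R X] : X →ₗ[R] ((X →ₗ[R] ω) →ₗ[R] ω) := LinearMap.applyₗ

@[simp] theorem evd_apply (ω X : Type u) [AddCommGroup ω] [Module R ω]
    [AddCommGroup X] [Module R X] (x : X) (h : X →ₗ[R] ω) : evd R ω X x h = h x := rfl

/-- `ω`-reflexive modules -/
structure Ref (R : Type u) [CommRing R] (ω X : Type u) [AddCommGroup ω] [Module R ω]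
    [AddCommGroup X] [Module R X] : Prop where
  fin : Module.Finite R X
  ev : ∀ i, EV R X ω (i+1)
  ev' : ∀ i, EV R (X →ₗ[R] ω) ω (i+1)
  bij : Function.Bijective (evd R ω X)

/-- semidualizing modules -/
structure Sdual (R : Type u) [CommRing R] (ω : Type u) [AddCommGroup ω] [Module R ω] : Prop where
  fin : Module.Finite R ω
  ev : ∀ i, EV R ω ω (i+1)
  bij : Function.Bijective (LinearMap.lsmul R ω)

/-- totally reflexive modules -/
abbrev TR (R : Type u) [CommRing R] (X : Type u) [AddCommGroup X] [Module R X] : Prop := Ref R R X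

theorem Sdual.self : Sdual R R where
  fin := inferInstance
  ev i := .proj i
  bij := by
    constructor
    · intro a b h
      simpa using LinearMap.congr_fun h 1
    · intro f
      exact ⟨f 1, by ext; simp⟩

section
variable {ω X : Type u} [AddCommGroup ω] [Module R ω] [AddCommGroup X] [Module R X]
  {Y : Type u} [AddCommGroup Y] [Module R Y]

theorem evd_inj_free (hω : Sdual R ω) (n : ℕ) (a : Fin n → R)
    (h : ∀ φ : (Fin n → R) →ₗ[R] ω, φ a = 0) : a = 0 := by
  ext j
  apply hω.bij.1
  ext y
  simpa using h (cins ω n j y)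

theorem evd_surj_free (hω : Sdual R ω) (n : ℕ) (Ψ : ((Fin n → R) →ₗ[R] ω) →ₗ[R] ω) :
    ∃ a, ∀ φ, Ψ φ = φ a := by
  choose r hr using fun j => hω.bij.2 (Ψ ∘ₗ cins ω n j)
  refine ⟨r, fun φ => ?_⟩
  conv_lhs => rw [cins_sum ω n φ]
  conv_rhs => rw [cins_sum ω n φ]
  rw [map_sum, LinearMap.sum_apply]
  refine Finset.sum_congr rfl fun j _ => ?_
  have := LinearMap.congr_fun (hr j) (φ (Pi.single j 1))
  simp at this
  simp [this]

theorem Ref.of_equiv (e : X ≃ₗ[R] Y) (h : Ref R ω X) : Ref R ω Y where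
  fin := by have := h.fin; exact Module.Finite.equiv e
  ev i := (h.ev i).of_iso e
  ev' i := (h.ev' i).of_iso (LinearEquiv.congrLeft ω R e)
  bij := by
    have : evd R ω Y = (LinearEquiv.congrLeft ω R (LinearEquiv.congrLeft ω R e)).toLinearMap ∘ₗ
        evd R ω X ∘ₗ e.symm.toLinearMap := by
      ext y h
      simp [LinearEquiv.congrLeft]
    rw [this]
    simpa using h.bij

theorem EV_dual_of_ID [IsNoetherianRing R] (hω : Sdual R ω) {n : ℕ} (hid : ID R ω n)
    [Module.Finite R X] (hX : ∀ i, EV R X ω (i+1)) (i : ℕ) : EV R (X →ₗ[R] ω) ω (i+1) := by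
  suffices H : ∀ k : ℕ, ∀ (X : Type u) [AddCommGroup X] [Module R X] [Module.Finite R X]
      (_ : ∀ i, EV R X ω (i+1)) (i : ℕ), n < i + 1 + k → EV R (X →ₗ[R] ω) ω (i+1) from
    H n X hX i (by omega)
  intro k
  induction k with
  | zero => intro X _ _ _ hX i hi; exact hid _ _ hi
  | succ k ih =>
    intro X _ _ _ hX i hi
    obtain ⟨n, g, hg, hex, _⟩ := exists_syz (R := R) X
    have hf : Function.Injective (LinearMap.ker g).subtype := Subtype.val_injective
    exact EV.con1 (lcomp_inj (N := ω) hg) (lcomp_exact (N := ω) hex hg)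
      (lcomp_surj_EV (N := ω) hf hex hg (hX 0)) (hω.ev i).homFin_left
      (ih (LinearMap.ker g) (fun i => EV.con1 hf hex hg (.proj i) (hX (i+1))) (i+1) (by omega))

/-- L5 -/
theorem Ref.of_ID [IsNoetherianRing R] (hω : Sdual R ω) {n : ℕ} (hid : ID R ω n)
    [Module.Finite R X] (hX : ∀ i, EV R X ω (i+1)) : Ref R ω X := by
  have surj : ∀ (X : Type u) [AddCommGroup X] [Module R X] [Module.Finite R X]
      (_ : ∀ i, EV R X ω (i+1)), Function.Surjective (evd R ω X) := by
    intro X _ _ _ hX Ψ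
    obtain ⟨n, g, hg, hex, _⟩ := exists_syz (R := R) X
    have hf : Function.Injective (LinearMap.ker g).subtype := Subtype.val_injective
    obtain ⟨Ψ', hΨ⟩ := EV.extend (lcomp_inj (N := ω) hg) (lcomp_exact (N := ω) hex hg)
      (lcomp_surj_EV (N := ω) hf hex hg (hX 0))
      (EV_dual_of_ID hω hid (fun i => EV.con1 hf hex hg (.proj i) (hX (i+1))) 0) Ψ
    obtain ⟨a, ha⟩ := evd_surj_free hω n Ψ'
    refine ⟨g a, ?_⟩
    ext h
    rw [← hΨ]
    simp [ha]
  refine ⟨inferInstance, hX, EV_dual_of_ID hω hid hX, ?_, surj X hX⟩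
  rw [injective_iff_map_eq_zero]
  intro x hx
  obtain ⟨n, g, hg, hex, _⟩ := exists_syz (R := R) X
  have hf : Function.Injective (LinearMap.ker g).subtype := Subtype.val_injective
  obtain ⟨a, rfl⟩ := hg x
  have hK : ∀ i, EV R (LinearMap.ker g) ω (i+1) := fun i => EV.con1 hf hex hg (.proj i) (hX (i+1))
  have s1 := lcomp_surj_EV (N := ω) hf hex hg (hX 0)
  obtain ⟨Ψ, hΨ⟩ := (lcomp_exact (N := ω) (lcomp_exact (N := ω) hex hg) s1 (LinearMap.applyₗ a)).1 (by
    ext h; exact LinearMap.congr_fun hx h)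
  obtain ⟨b, rfl⟩ := surj _ hK Ψ
  have : a - b.1 = 0 := evd_inj_free hω n _ fun φ => by
    have := LinearMap.congr_fun hΨ φ
    simp at this
    simp [this]
  rw [sub_eq_zero] at this
  rw [this]; exact b.2

/-- syzygies of reflexive modules -/
theorem Ref.syz [IsNoetherianRing R] (hω : Sdual R ω) (hX : Ref R ω X) {n : ℕ}
    {g : (Fin n → R) →ₗ[R] X} (hg : Function.Surjective g) : Ref R ω (LinearMap.ker g) := by
  have hf : Function.Injective (LinearMap.ker g).subtype := Subtype.val_injective
  have hex : Function.Exact (LinearMap.ker g).subtype g := LinearMap.exact_subtype_ker_map g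
  have i1 := (lcomp_inj (N := ω) hg)
  have e1 := (lcomp_exact (N := ω) hex hg)
  have s1 := (lcomp_surj_EV (N := ω) hf hex hg (hX.ev 0))
  refine ⟨inferInstance, fun i => EV.con1 hf hex hg (.proj i) (hX.ev (i+1)), fun i => ?_, ?_, ?_⟩
  · cases i with
    | zero =>
      refine EV.con3_of_extend i1 e1 s1 (hω.ev 0).homFin_left fun φ => ?_
      obtain ⟨l, rfl⟩ := hX.bij.2 φ
      obtain ⟨a, rfl⟩ := hg l
      exact ⟨LinearMap.applyₗ a, by ext; simp⟩
    | succ i => exact EV.con3 i1 e1 s1 (hX.ev' i) (hω.ev (i+1)).homFin_left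
  · rw [injective_iff_map_eq_zero]
    intro k hk
    apply hf
    rw [map_zero]
    refine evd_inj_free hω n _ fun φ => ?_
    exact LinearMap.congr_fun hk (φ ∘ₗ (LinearMap.ker g).subtype)
  · intro Ψ
    obtain ⟨a, ha⟩ := evd_surj_free hω n (Ψ ∘ₗ (LinearMap.lcomp R ω (LinearMap.ker g).subtype))
    have : g a = 0 := by
      apply hX.bij.1
      ext h
      have := ha (h ∘ₗ g)
      have h2 : LinearMap.lcomp R ω (LinearMap.ker g).subtype (h ∘ₗ g) = 0 := e1.apply_apply_eq_zero h
      rw [LinearMap.comp_apply, h2] at this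
      simpa using this.symm
    refine ⟨⟨a, this⟩, ?_⟩
    ext h
    obtain ⟨φ, rfl⟩ := s1 h
    simpa using (ha φ).symm

theorem Ref.dual [IsNoetherianRing R] [Module.Finite R ω] (hX : Ref R ω X) : Ref R ω (X →ₗ[R] ω) := by
  have := hX.fin
  let e : X ≃ₗ[R] ((X →ₗ[R] ω) →ₗ[R] ω) := LinearEquiv.ofBijective _ hX.bij
  refine ⟨inferInstance, hX.ev', fun i => (hX.ev i).of_iso e, ?_⟩
  have h : Function.Bijective (LinearMap.lcomp R ω (evd R ω X)) :=
    (LinearEquiv.congrLeft ω R e.symm).bijective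
  have h2 : (LinearMap.lcomp R ω (evd R ω X)) ∘ (evd R ω (X →ₗ[R] ω)) = id := by
    ext f x; rfl
  have h3 : Function.Bijective ((LinearMap.lcomp R ω (evd R ω X)) ∘ (evd R ω (X →ₗ[R] ω))) := by
    rw [h2]; exact Function.bijective_id
  exact (Function.Bijective.of_comp_iff' h _).1 h3

theorem TR.cosyz [IsNoetherianRing R] (hX : TR R X) :
    ∃ (n : ℕ) (L : ModuleCat.{u} R) (f : X →ₗ[R] (Fin n → R)) (g : (Fin n → R) →ₗ[R] L),
      Function.Injective f ∧ Function.Exact f g ∧ Function.Surjective g ∧ TR R L := by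
  have hd := hX.dual
  have := hd.fin
  obtain ⟨n, g, hg, hex, _⟩ := exists_syz (R := R) (X →ₗ[R] R)
  have hf : Function.Injective (LinearMap.ker g).subtype := Subtype.val_injective
  have i1 := (lcomp_inj (N := R) hg)
  have e1 := (lcomp_exact (N := R) hex hg)
  have s1 := (lcomp_surj_EV (N := R) hf hex hg (hd.ev 0))
  let e := homFin (R := R) n R
  refine ⟨n, ModuleCat.of R (LinearMap.ker g →ₗ[R] R), 
    e.symm.toLinearMap ∘ₗ LinearMap.lcomp R R g ∘ₗ evd R R X,
    LinearMap.lcomp R R (LinearMap.ker g).subtype ∘ₗ e.toLinearMap, ?_, ?_, ?_, (hd.syz .self hg).dual⟩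
  · exact e.symm.injective.comp (i1.comp hX.bij.1)
  · intro y
    have := e1 (e y)
    rw [LinearMap.comp_apply]
    refine this.trans ?_
    constructor
    · rintro ⟨z, hz⟩
      obtain ⟨x, rfl⟩ := hX.bij.2 z
      exact ⟨x, by simp [hz]⟩
    · rintro ⟨x, rfl⟩
      exact ⟨evd R R X x, by simp⟩
  · exact s1.comp e.surjective
end

end GGX


namespace GGX

open CategoryTheory CategoryTheory.Abelian
open scoped Pointwise

variable {R : Type u} [CommRing R]

/-- short exactness for linear maps -/
structure SES {A B C : Type u} [AddCommGroup A] [Module R A] [AddCommGroup B] [Module R B]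
    [AddCommGroup C] [Module R C] (f : A →ₗ[R] B) (g : B →ₗ[R] C) : Prop where
  inj : Function.Injective f
  ex : Function.Exact f g
  surj : Function.Surjective g

/-- the class of cycles in complete injective resolutions -/
def GIc (R : Type u) [CommRing R] (N : Type u) [AddCommGroup N] [Module R N] : Prop :=
  ∃ (X : ℤ → ModuleCat.{u} R) (d : ∀ n : ℤ, X n →ₗ[R] X (n + 1)),
    (∀ n, Module.Injective R (X n)) ∧
    (∀ n, LinearMap.range (d n) = LinearMap.ker (d (n + 1))) ∧
    (∀ (I : ModuleCat.{u} R), Module.Injective R I →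
      ∀ (n : ℤ) (φ : I →ₗ[R] X (n + 1)), (d (n + 1)).comp φ = 0 →
        ∃ ψ : I →ₗ[R] X n, (d n).comp ψ = φ) ∧
    ∃ n, Nonempty (N ≃ₗ[R] LinearMap.ker (d n))

section
variable {N : Type u} [AddCommGroup N] [Module R N]

theorem GIc.of (h : GG.IsGorensteinInjective R N) : GIc R N := by
  obtain ⟨X, d, h1, h2, h3, h4⟩ := h
  exact ⟨X, d, h1, h2, h3, 0, h4⟩

theorem cyc_ses (X : ℤ → ModuleCat.{u} R) (d : ∀ n : ℤ, X n →ₗ[R] X (n + 1))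
    (h2 : ∀ n, LinearMap.range (d n) = LinearMap.ker (d (n + 1))) (n : ℤ) :
    SES (LinearMap.ker (d n)).subtype
      ((d n).codRestrict (LinearMap.ker (d (n+1))) (fun x => by rw [← h2]; exact ⟨x, rfl⟩)) where
  inj := Subtype.val_injective
  ex := by
    intro y
    constructor
    · intro h; exact ⟨⟨y, congrArg Subtype.val h⟩, rfl⟩
    · rintro ⟨z, rfl⟩; ext; exact z.2
  surj := by
    rintro ⟨y, hy⟩
    rw [← h2] at hy
    obtain ⟨x, hx⟩ := hy
    exact ⟨x, Subtype.ext hx⟩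

theorem SES.congr_left {A A' B C : Type u} [AddCommGroup A] [Module R A] [AddCommGroup A'] [Module R A']
    [AddCommGroup B] [Module R B]
    [AddCommGroup C] [Module R C] {f : A →ₗ[R] B} {g : B →ₗ[R] C} (h : SES f g) (e : A' ≃ₗ[R] A) :
    SES (f ∘ₗ e.toLinearMap) g where
  inj := h.inj.comp e.injective
  ex := by
    intro y; rw [h.ex y]
    constructor
    · rintro ⟨x, rfl⟩; exact ⟨e.symm x, by simp⟩
    · rintro ⟨x, rfl⟩; exact ⟨e x, rfl⟩
  surj := h.surj

theorem SES.congr_right {A C' B C : Type u} [AddCommGroup A] [Module R A] [AddCommGroup C'] [Module R C']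
    [AddCommGroup B] [Module R B]
    [AddCommGroup C] [Module R C] {f : A →ₗ[R] B} {g : B →ₗ[R] C} (h : SES f g) (e : C ≃ₗ[R] C') :
    SES f (e.toLinearMap ∘ₗ g) where
  inj := h.inj
  ex := by
    intro y; rw [← h.ex y]; simp
  surj := e.surjective.comp h.surj

theorem SES.mkQ {A B : Type u} [AddCommGroup A] [Module R A] [AddCommGroup B] [Module R B] 
    {f : A →ₗ[R] B} (hf : Function.Injective f) : SES f (LinearMap.range f).mkQ :=
  ⟨hf, LinearMap.exact_map_mkQ_range f, Submodule.mkQ_surjective _⟩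

theorem GIc.right (h : GIc R N) : ∃ (I N' : ModuleCat.{u} R) (f : N →ₗ[R] I) (g : I →ₗ[R] N'),
    Module.Injective R I ∧ SES f g ∧ GIc R N' := by
  obtain ⟨X, d, h1, h2, h3, n, ⟨e⟩⟩ := h
  exact ⟨X n, ModuleCat.of R (LinearMap.ker (d (n+1))), _, _, h1 n,
    (cyc_ses X d h2 n).congr_left e, X, d, h1, h2, h3, n+1, ⟨.refl _ _⟩⟩

theorem GIc.left (h : GIc R N) : ∃ (I N' : ModuleCat.{u} R) (f : N' →ₗ[R] I) (g : I →ₗ[R] N),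
    Module.Injective R I ∧ SES f g ∧ GIc R N' := by
  obtain ⟨X, d, h1, h2, h3, n, ⟨e⟩⟩ := h
  obtain ⟨n, rfl⟩ : ∃ m, n = m + 1 := ⟨n - 1, by omega⟩
  exact ⟨X n, ModuleCat.of R (LinearMap.ker (d n)), _, _, h1 n,
    (cyc_ses X d h2 n).congr_right e.symm, X, d, h1, h2, h3, n, ⟨.refl _ _⟩⟩

theorem GIc.ev1 (h : GIc R N) {J : Type u} [AddCommGroup J] [Module R J] (hJ : Module.Injective R J) :
    EV R J N 1 := by
  obtain ⟨X, d, h1, h2, h3, n, ⟨e⟩⟩ := h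
  have hs := cyc_ses X d h2 n
  refine EV.of_iso' e.symm (EV.cov1_of_lift hs.inj hs.ex hs.surj (.inj (h1 n) 0) fun φ => ?_)
  obtain ⟨ψ, hψ⟩ := h3 (ModuleCat.of R J) hJ n ((LinearMap.ker (d (n+1))).subtype ∘ₗ φ) (by
    ext x; exact (φ x).2)
  refine ⟨ψ, ?_⟩
  ext x
  exact LinearMap.congr_fun hψ x

theorem GIc.ev (h : GIc R N) {J : Type u} [AddCommGroup J] [Module R J] (hJ : Module.Injective R J)
    (i : ℕ) : EV R J N (i+1) := by
  induction i generalizing N with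
  | zero => exact h.ev1 hJ
  | succ i ih =>
    obtain ⟨I, N', f, g, hI, hs, hN'⟩ := h.right
    exact EV.cov1 hs.inj hs.ex hs.surj (ih hN') (.inj hI _)

/-- criterion -/
theorem GI_of_class (C : ModuleCat.{u} R → Prop)
    (hr : ∀ N, C N → ∃ (I N' : ModuleCat.{u} R) (f : N →ₗ[R] I) (g : I →ₗ[R] N'),
      Module.Injective R I ∧ SES f g ∧ C N')
    (hl : ∀ N, C N → ∃ (I N' : ModuleCat.{u} R) (f : N' →ₗ[R] I) (g : I →ₗ[R] N),
      Module.Injective R I ∧ SES f g ∧ C N')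
    (he : ∀ N, C N → ∀ J : ModuleCat.{u} R, Module.Injective R J → EV R J N 1)
    (N : ModuleCat.{u} R) (hN : C N) : GG.IsGorensteinInjective R N := by
  choose! rI rN rf rg rh using hr
  choose! lI lN lf lg lh using hl
  let Zr : ℕ → ModuleCat.{u} R := fun k => Nat.rec N (fun _ M => rN M) k
  let Zl : ℕ → ModuleCat.{u} R := fun k => Nat.rec N (fun _ M => lN M) k
  have hZr : ∀ k, C (Zr k) := fun k => by
    induction k with
    | zero => exact hN
    | succ k ih => exact (rh _ ih).2.2
  have hZl : ∀ k, C (Zl k) := fun k => by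
    induction k with
    | zero => exact hN
    | succ k ih => exact (lh _ ih).2.2
  let Z : ℤ → ModuleCat.{u} R := fun n => match n with
    | Int.ofNat k => Zr k
    | Int.negSucc k => Zl (k+1)
  have hZ : ∀ n, C (Z n) := by
    rintro (k | k)
    · exact hZr k
    · exact hZl (k+1)
  have hs : ∀ n : ℤ, ∃ (I : ModuleCat.{u} R) (f : Z n →ₗ[R] I) (g : I →ₗ[R] Z (n+1)),
      Module.Injective R I ∧ SES f g := by
    rintro (k | k)
    · exact ⟨_, rf (Zr k), rg (Zr k), (rh _ (hZr k)).1, (rh _ (hZr k)).2.1⟩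
    · cases k with
      | zero => exact ⟨_, lf (Zl 0), lg (Zl 0), (lh _ (hZl 0)).1, (lh _ (hZl 0)).2.1⟩
      | succ k => exact ⟨_, lf (Zl (k+1)), lg (Zl (k+1)), (lh _ (hZl (k+1))).1, (lh _ (hZl (k+1))).2.1⟩
  choose X f g hI hs using hs
  have key : ∀ n (x : X n), (f (n+1) ∘ₗ g n) x = 0 → g n x = 0 := fun n x hx => 
    (hs (n+1)).inj (by simpa using hx)
  refine ⟨X, fun n => f (n+1) ∘ₗ g n, hI, fun n => ?_, fun J hJ n φ hφ => ?_, ⟨?_⟩⟩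
  · ext y
    constructor
    · rintro ⟨x, rfl⟩
      simp [(hs (n+1)).ex.apply_apply_eq_zero]
    · intro hy
      obtain ⟨z, rfl⟩ := ((hs (n+1)).ex y).1 (key _ _ hy)
      obtain ⟨x, rfl⟩ := (hs n).surj z
      exact ⟨x, rfl⟩
  · let e : Z (n+1) ≃ₗ[R] LinearMap.range (f (n+1)) := LinearEquiv.ofInjective _ (hs (n+1)).inj
    let φ' : J →ₗ[R] Z (n+1) := e.symm.toLinearMap ∘ₗ φ.codRestrict (LinearMap.range (f (n+1))) (fun x => by
      exact ((hs (n+1)).ex (φ x)).1 (key _ _ (LinearMap.congr_fun hφ x)))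
    obtain ⟨ψ, hψ⟩ := EV.lift (hs n).inj (hs n).ex (hs n).surj (he _ (hZ n) J hJ) φ'
    refine ⟨ψ, ?_⟩
    rw [LinearMap.comp_assoc, hψ]
    ext x
    have : (e (φ' x)).1 = φ x := by simp [φ']; rfl
    exact this
  · refine (LinearEquiv.ofInjective (f 0) (hs 0).inj).trans (LinearEquiv.ofEq _ _ ?_)
    ext y
    constructor
    · rintro ⟨x, rfl⟩
      simp [(hs 0).ex.apply_apply_eq_zero]
    · intro hy
      exact ((hs 0).ex y).1 (key _ _ hy)

theorem GI_of_equiv {N' : Type u} [AddCommGroup N'] [Module R N'] (e : N ≃ₗ[R] N')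
    (h : GG.IsGorensteinInjective R N) : GG.IsGorensteinInjective R N' := by
  obtain ⟨X, d, h1, h2, h3, ⟨h4⟩⟩ := h
  exact ⟨X, d, h1, h2, h3, ⟨e.symm.trans h4⟩⟩

end

theorem inj_homFin {J : Type u} [AddCommGroup J] [Module R J] (hJ : Module.Injective R J) (n : ℕ) :
    Module.Injective R ((Fin n → R) →ₗ[R] J) :=
  inj_of_EV fun _ => EV.homFin (.inj hJ 0)

theorem inj_pi_fin {J : Type u} [AddCommGroup J] [Module R J] (hJ : Module.Injective R J) (n : ℕ) :
    Module.Injective R (Fin n → J) :=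
  inj_of_EV fun _ => EV.pi_fin (.inj hJ 0) n

/-- L7 -/
theorem GI_hom [IsNoetherianRing R] {L J : Type u} [AddCommGroup L] [Module R L]
    [AddCommGroup J] [Module R J] (hL : TR R L) (hJ : Module.Injective R J) :
    GG.IsGorensteinInjective R (L →ₗ[R] J) := by
  refine GI_of_class (fun N => ∃ L' : ModuleCat.{u} R, TR R L' ∧ Nonempty (N ≃ₗ[R] (L' →ₗ[R] J)))
    ?_ ?_ ?_ (ModuleCat.of R (L →ₗ[R] J)) ⟨ModuleCat.of R L, hL, ⟨.refl _ _⟩⟩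
  · rintro N ⟨L', hL', ⟨e⟩⟩
    have := hL'.fin
    obtain ⟨n, g, hg, hex, _⟩ := exists_syz (R := R) L'
    have hf : Function.Injective (LinearMap.ker g).subtype := Subtype.val_injective
    have : SES (LinearMap.lcomp R J g) (LinearMap.lcomp R J (LinearMap.ker g).subtype) :=
      ⟨lcomp_inj hg, lcomp_exact hex hg, lcomp_surj_inj hf hJ⟩
    exact ⟨ModuleCat.of R ((Fin n → R) →ₗ[R] J), ModuleCat.of R (LinearMap.ker g →ₗ[R] J), _, _, 
      inj_homFin hJ n, this.congr_left e, ModuleCat.of R (LinearMap.ker g), hL'.syz .self hg, ⟨.refl _ _⟩⟩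
  · rintro N ⟨L', hL', ⟨e⟩⟩
    obtain ⟨n, L'', f, g, hf, hex, hg, hL''⟩ := hL'.cosyz
    have : SES (LinearMap.lcomp R J g) (LinearMap.lcomp R J f) :=
      ⟨lcomp_inj hg, lcomp_exact hex hg, lcomp_surj_inj hf hJ⟩
    exact ⟨ModuleCat.of R ((Fin n → R) →ₗ[R] J), ModuleCat.of R (L'' →ₗ[R] J), _, _, 
      inj_homFin hJ n, this.congr_right e.symm, L'', hL'', ⟨.refl _ _⟩⟩
  · rintro N ⟨L', hL', ⟨e⟩⟩ I hI
    have := hL'.fin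
    refine EV.of_iso' e.symm ((swap (fun i => .inj hJ i) (fun i => .inj hJ i) 0).1 ?_)
    have h := EV_T (A := L') R hI hJ hL'.ev 0
    exact h.of_iso' (LinearEquiv.congrLeft J R (LinearMap.ringLmapEquivSelf R R I))

end GGX


namespace GGX

open CategoryTheory CategoryTheory.Abelian
open scoped Pointwise TensorProduct

variable {R : Type u} [CommRing R]

/-- post-composition: `Hom(X,I) → Hom(Hom(ω,X),Hom(ω,I))` -/
noncomputable def thB (R : Type u) [CommRing R] (ω X I : Type u) [AddCommGroup ω] [Module R ω]
    [AddCommGroup X] [Module R X] [AddCommGroup I] [Module R I] :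
    (X →ₗ[R] I) →ₗ[R] ((ω →ₗ[R] X) →ₗ[R] (ω →ₗ[R] I)) :=
  LinearMap.llcomp R ω X I

@[simp] theorem thB_apply {ω X I : Type u} [AddCommGroup ω] [Module R ω]
    [AddCommGroup X] [Module R X] [AddCommGroup I] [Module R I] (f : X →ₗ[R] I) (h : ω →ₗ[R] X)
    (w : ω) : thB R ω X I f h w = f (h w) := rfl

/-- Bass-class type condition -/
structure BC (R : Type u) [CommRing R] (ω X : Type u) [AddCommGroup ω] [Module R ω]
    [AddCommGroup X] [Module R X] : Prop where
  b1 : ∀ i, EV R ω X (i+1)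
  b2 : ∀ (I : Type u) [AddCommGroup I] [Module R I], Module.Injective R I →
    ∀ i, EV R (ω →ₗ[R] X) (ω →ₗ[R] I) (i+1)
  b3 : ∀ (I : Type u) [AddCommGroup I] [Module R I], Module.Injective R I →
    Function.Bijective (thB R ω X I)

variable {ω X Y J I K : Type u} [AddCommGroup ω] [Module R ω] [AddCommGroup X] [Module R X]
  [AddCommGroup Y] [Module R Y] [AddCommGroup I] [Module R I] [AddCommGroup J] [Module R J]
  [AddCommGroup K] [Module R K]

theorem PhiT_inj [IsNoetherianRing R] [Module.Finite R X] (hJ : Module.Injective R J)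
    (hI : Module.Injective R I) : Function.Injective (PhiT (R := R) Y J I X) := by
  rw [injective_iff_map_eq_zero]
  intro τ hτ
  obtain ⟨n, g, hg, hex, _⟩ := exists_syz (R := R) X
  have i1 := lcomp_inj (N := Y) hg
  have s2 := lcomp_surj_inj i1 hJ
  have i3 := lcomp_inj (N := I) s2
  apply i3
  apply (PhiT_free Y J I n).1
  rw [map_zero, map_zero]
  apply LinearMap.ext; intro c
  apply LinearMap.ext; intro h
  exact LinearMap.congr_fun (LinearMap.congr_fun hτ (g c)) h

theorem BC.inj [IsNoetherianRing R] (hω : Sdual R ω) (hJ : Module.Injective R J) : BC R ω J := by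
  have := hω.fin
  let e : R ≃ₗ[R] (ω →ₗ[R] ω) := LinearEquiv.ofBijective _ hω.bij
  have he : ∀ s : ω →ₗ[R] ω, ∀ w, e.symm s • w = s w := fun s w => by
    conv_rhs => rw [← e.apply_symm_apply s]
    rfl
  refine ⟨fun i => .inj hJ i, fun I _ _ hI i => ?_, fun I _ _ hI => ⟨?_, ?_⟩⟩
  · exact (swap (fun i => .inj hI i) (fun i => .inj hI i) i).1 (EV_T ω hJ hI hω.ev i)
  · rw [injective_iff_map_eq_zero]
    intro f hf
    let τ : ((ω →ₗ[R] ω) →ₗ[R] J) →ₗ[R] I := f ∘ₗ LinearMap.applyₗ LinearMap.id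
    have hτ : τ = 0 := by
      apply PhiT_inj (X := ω) (Y := ω) hJ hI
      rw [map_zero]
      ext w h
      exact LinearMap.congr_fun (LinearMap.congr_fun hf h) w
    ext j
    have := LinearMap.congr_fun hτ ((LinearMap.toSpanSingleton R J j) ∘ₗ e.symm.toLinearMap)
    have h1 : e.symm LinearMap.id = 1 := by
      rw [LinearEquiv.symm_apply_eq]; ext; simp [e]
    simpa [τ, h1] using this
  · intro Θ
    obtain ⟨τ, hτ⟩ := PhiT_surj (A := ω) ω hJ hI Θ.flip
    let u : J →ₗ[R] ((ω →ₗ[R] ω) →ₗ[R] J) := LinearMap.mk₂ R (fun j s => e.symm s • j)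
      (by simp) (fun c j s => smul_comm _ _ _) (by intros; simp [add_smul]) (by intros; simp [mul_smul])
    refine ⟨τ ∘ₗ u, ?_⟩
    ext h w
    have := LinearMap.congr_fun (LinearMap.congr_fun hτ w) h
    simp only [PhiT_apply, LinearMap.flip_apply] at this
    rw [← this]
    simp only [thB_apply, LinearMap.comp_apply]
    congr 1
    ext s
    simp only [u, LinearMap.mk₂_apply, LinearMap.comp_apply, LinearMap.applyₗ_apply_apply]
    rw [← map_smul, he]

theorem EV_of_ID_left [IsNoetherianRing R] {n : ℕ} (hid : ID R Y n) (hX : GIc R X) (i : ℕ) : EV R Y X (i+1) := by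
  induction n generalizing Y i with
  | zero => exact hX.ev hid.inj i
  | succ n ih =>
    obtain ⟨I, f, hI, hf⟩ := exists_inj_embed (R := R) Y
    have s := SES.mkQ hf
    exact EV.con1 s.inj s.ex s.surj (hX.ev hI i)
      (ih (ID.coker s.inj s.ex s.surj ((ID.zero hI).mono (Nat.zero_le _)) hid) (i+1))

/-- covariant hom of a short exact sequence -/
theorem SES.hom {A B C : Type u} [AddCommGroup A] [Module R A] [AddCommGroup B] [Module R B]
    [AddCommGroup C] [Module R C] {f : A →ₗ[R] B} {g : B →ₗ[R] C} (h : SES f g)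
    (hs : ∀ φ : ω →ₗ[R] C, ∃ ψ : ω →ₗ[R] B, g ∘ₗ ψ = φ) :
    SES (thB R ω A B f) (thB R ω B C g) where
  inj := by
    intro a b hab
    ext w
    exact h.inj (LinearMap.congr_fun hab w)
  ex := by
    intro φ
    constructor
    · intro hφ
      let e : A ≃ₗ[R] LinearMap.range f := LinearEquiv.ofInjective _ h.inj
      have hm : ∀ w, φ w ∈ LinearMap.range f := fun w => (h.ex _).1 (LinearMap.congr_fun hφ w)
      refine ⟨e.symm.toLinearMap ∘ₗ φ.codRestrict (LinearMap.range f) hm, ?_⟩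
      ext w
      have : (e (e.symm ⟨φ w, hm w⟩)).1 = φ w := by simp
      exact this
    · rintro ⟨ψ, rfl⟩
      ext w
      exact h.ex.apply_apply_eq_zero _
  surj := fun φ => by
    obtain ⟨ψ, rfl⟩ := hs φ
    exact ⟨ψ, rfl⟩

theorem thB_inj_GIc [IsNoetherianRing R] (hω : Sdual R ω) (hX : GIc R X) (hI : Module.Injective R I) :
    Function.Injective (thB R ω X I) := by
  obtain ⟨J, N, f, g, hJ, hs, hN⟩ := hX.left
  rw [injective_iff_map_eq_zero]
  intro a ha
  have : a ∘ₗ g = 0 := by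
    apply ((BC.inj hω hJ).b3 I hI).1
    rw [map_zero]
    ext h w
    exact LinearMap.congr_fun (LinearMap.congr_fun ha (g ∘ₗ h)) w
  ext x
  obtain ⟨y, rfl⟩ := hs.surj x
  exact LinearMap.congr_fun this y

theorem thB_bij_GIc [IsNoetherianRing R] (hω : Sdual R ω) {n : ℕ} (hid : ID R ω n)
    (hX : GIc R X) (hI : Module.Injective R I) :
    Function.Bijective (thB R ω X I) := by
  refine ⟨thB_inj_GIc hω hX hI, fun Θ => ?_⟩
  obtain ⟨J, N, f, g, hJ, hs, hN⟩ := hX.left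
  obtain ⟨b, hb⟩ := ((BC.inj hω hJ).b3 I hI).2 (Θ ∘ₗ thB R ω J X g)
  have hbf : b ∘ₗ f = 0 := by
    apply thB_inj_GIc hω hN hI
    rw [map_zero]
    ext h w
    have h1 := LinearMap.congr_fun (LinearMap.congr_fun hb (f ∘ₗ h)) w
    have h2 : thB R ω J X g (f ∘ₗ h) = 0 := by
      ext w; exact hs.ex.apply_apply_eq_zero _
    rw [LinearMap.comp_apply, h2, map_zero] at h1
    exact h1
  obtain ⟨a, ha⟩ := (lcomp_exact hs.ex hs.surj b).1 hbf
  refine ⟨a, ?_⟩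
  ext h w
  obtain ⟨h', rfl⟩ := EV.lift hs.inj hs.ex hs.surj (EV_of_ID_left hid hN 0) h
  have h1 := LinearMap.congr_fun (LinearMap.congr_fun hb h') w
  rw [← ha] at h1
  exact h1

theorem BC.GIc [IsNoetherianRing R] (hω : Sdual R ω) {n : ℕ} (hid : ID R ω n)
    (hX : GIc R X) : BC R ω X := by
  refine ⟨EV_of_ID_left hid hX, fun I _ _ hI i => ?_, fun I _ _ hI => thB_bij_GIc hω hid hX hI⟩
  induction i generalizing X with
  | zero =>
    obtain ⟨J, N, f, g, hJ, hs, hN⟩ := hX.left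
    have hs' := hs.hom (ω := ω) (EV.lift hs.inj hs.ex hs.surj (EV_of_ID_left hid hN 0))
    refine EV.con3_of_extend hs'.inj hs'.ex hs'.surj ((BC.inj hω hJ).b2 I hI 0) fun φ => ?_
    obtain ⟨a, rfl⟩ := (thB_bij_GIc hω hid hN hI).2 φ
    obtain ⟨b, rfl⟩ := lcomp_surj_inj hs.inj hI a
    exact ⟨thB R ω _ _ b, rfl⟩
  | succ i ih =>
    obtain ⟨J, N, f, g, hJ, hs, hN⟩ := hX.left
    have hs' := hs.hom (ω := ω) (EV.lift hs.inj hs.ex hs.surj (EV_of_ID_left hid hN 0))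
    exact EV.con3 hs'.inj hs'.ex hs'.surj (ih hN) ((BC.inj hω hJ).b2 I hI _)

theorem Sdual.ann (hω : Sdual R ω) {r : R} (h : r ∈ Module.annihilator R ω) : r = 0 := by
  apply hω.bij.1
  ext w
  simpa using Module.mem_annihilator.1 h w

theorem subsingleton_of_hom_hom [IsNoetherianRing R] (hω : Sdual R ω) {C : Type u} [AddCommGroup C]
    [Module R C] (h : ∀ (I : Type u) [AddCommGroup I] [Module R I], Module.Injective R I →
      Subsingleton (C →ₗ[R] (ω →ₗ[R] I))) : Subsingleton C := by
  by_contra hC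
  rw [not_subsingleton_iff_nontrivial] at hC
  obtain ⟨I, f, hI, hf⟩ := exists_inj_embed (R := R) C
  have hne : Nontrivial (C →ₗ[R] I) := by
    refine ⟨f, 0, fun h0 => ?_⟩
    obtain ⟨a, b, hab⟩ := hC
    exact hab (hf (by simp [h0]))
  obtain ⟨p, hp⟩ := associatedPrimes.nonempty R (C →ₗ[R] I)
  have hpp : p.IsPrime := hp.isPrime
  obtain ⟨x, hx⟩ := ((isAssociatedPrime_iff_exists_injective_linearMap ..).1 hp).2
  have hfin := hω.fin
  have : Subsingleton (ω →ₗ[R] (R ⧸ p)) := by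
    refine ⟨fun a b => ?_⟩
    have := h I hI
    have h2 : (x ∘ₗ a).flip = (x ∘ₗ b).flip := Subsingleton.elim _ _
    have h3 : x ∘ₗ a = x ∘ₗ b := by
      ext w c; exact LinearMap.congr_fun (LinearMap.congr_fun h2 c) w
    ext w
    exact hx (LinearMap.congr_fun h3 w)
  obtain ⟨r, hr, hr'⟩ := IsSMulRegular.subsingleton_linearMap_iff.1 this
  rw [hω.ann hr] at hr'
  have : (1 : R ⧸ p) = 0 := hr' (by simp)
  exact one_ne_zero this

theorem BC.ker [IsNoetherianRing R] (hω : Sdual R ω) {A B C : Type u} [AddCommGroup A] [Module R A]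
    [AddCommGroup B] [Module R B]
    [AddCommGroup C] [Module R C] {f : A →ₗ[R] B} {g : B →ₗ[R] C} (h : SES f g)
    (hB : BC R ω B) (hC : BC R ω C) : BC R ω A := by
  have lift : ∀ φ : ω →ₗ[R] C, ∃ ψ : ω →ₗ[R] B, g ∘ₗ ψ = φ := by
    have : Subsingleton ((ω →ₗ[R] C) ⧸ LinearMap.range (thB R ω B C g)) := by
      refine subsingleton_of_hom_hom hω fun I _ _ hI => ⟨fun a b => ?_⟩
      suffices H : ∀ a : ((ω →ₗ[R] C) ⧸ LinearMap.range (thB R ω B C g)) →ₗ[R] (ω →ₗ[R] I), a = 0 by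
        rw [H a, H b]
      intro a
      obtain ⟨c, hc⟩ := (hC.b3 I hI).2 (a ∘ₗ Submodule.mkQ _)
      have : c ∘ₗ g = 0 := by
        apply (hB.b3 I hI).1
        rw [map_zero]
        ext k w
        have h1 := LinearMap.congr_fun (LinearMap.congr_fun hc (g ∘ₗ k)) w
        have h2 : Submodule.mkQ (LinearMap.range (thB R ω B C g)) (g ∘ₗ k) = 0 := by
          rw [Submodule.mkQ_apply, Submodule.Quotient.mk_eq_zero]; exact ⟨k, rfl⟩
        rw [LinearMap.comp_apply, h2, map_zero] at h1
        exact h1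
      have hc0 : c = 0 := by
        ext x
        obtain ⟨y, rfl⟩ := h.surj x
        exact LinearMap.congr_fun this y
      rw [hc0, map_zero] at hc
      refine LinearMap.ext fun q => ?_
      obtain ⟨q, rfl⟩ := Submodule.mkQ_surjective _ q
      exact (LinearMap.congr_fun hc q).symm
    intro φ
    have h1 : Submodule.mkQ (LinearMap.range (thB R ω B C g)) φ = 0 := Subsingleton.elim _ _
    rw [Submodule.mkQ_apply, Submodule.Quotient.mk_eq_zero] at h1
    exact h1
  have hs := h.hom lift
  refine ⟨fun i => ?_, fun I _ _ hI i => ?_, fun I _ _ hI => ⟨?_, fun Θ => ?_⟩⟩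
  · cases i with
    | zero => exact EV.cov1_of_lift h.inj h.ex h.surj (hB.b1 0) lift
    | succ i => exact EV.cov1 h.inj h.ex h.surj (hC.b1 i) (hB.b1 _)
  · exact EV.con1 hs.inj hs.ex hs.surj (hB.b2 I hI _) (hC.b2 I hI _)
  · rw [injective_iff_map_eq_zero]
    intro a ha
    obtain ⟨b, rfl⟩ := lcomp_surj_inj h.inj hI a
    obtain ⟨c, hc⟩ := (lcomp_exact hs.ex hs.surj (thB R ω B I b)).1 ha
    obtain ⟨d, rfl⟩ := (hC.b3 I hI).2 c
    have : d ∘ₗ g = b := (hB.b3 I hI).1 (by rw [← hc]; rfl)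
    rw [← this]
    ext x
    simp [h.ex.apply_apply_eq_zero]
  · obtain ⟨Ξ, hΞ⟩ := EV.extend hs.inj hs.ex hs.surj (hC.b2 I hI 0) Θ
    obtain ⟨b, rfl⟩ := (hB.b3 I hI).2 Ξ
    exact ⟨b ∘ₗ f, by rw [← hΞ]; rfl⟩

theorem BC.of_equiv (e : X ≃ₗ[R] Y) (h : BC R ω X) : BC R ω Y := by
  refine ⟨fun i => (h.b1 i).of_iso' e, fun I _ _ hI i => (h.b2 I hI i).of_iso (LinearEquiv.congrRight e),
    fun I _ _ hI => ⟨?_, fun Θ => ?_⟩⟩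
  · rw [injective_iff_map_eq_zero]
    intro a ha
    have : a ∘ₗ e.toLinearMap = 0 := by
      apply (h.b3 I hI).1
      rw [map_zero]
      ext k w
      exact LinearMap.congr_fun (LinearMap.congr_fun ha (e.toLinearMap ∘ₗ k)) w
    ext x
    simpa using LinearMap.congr_fun this (e.symm x)
  · obtain ⟨a, ha⟩ := (h.b3 I hI).2 (Θ ∘ₗ (LinearEquiv.congrRight e : (ω →ₗ[R] X) ≃ₗ[R] (ω →ₗ[R] Y)).toLinearMap)
    refine ⟨a ∘ₗ e.symm.toLinearMap, ?_⟩
    ext k w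
    have := LinearMap.congr_fun (LinearMap.congr_fun ha (e.symm.toLinearMap ∘ₗ k)) w
    have h2 : (LinearEquiv.congrRight e : (ω →ₗ[R] X) ≃ₗ[R] (ω →ₗ[R] Y)) (e.symm.toLinearMap ∘ₗ k) = k := by
      ext w; exact e.apply_symm_apply _
    rw [LinearMap.comp_apply, LinearEquiv.coe_coe, h2] at this
    rw [← this]; rfl

theorem gidLE_zero (h : GG.gidLE R X 0) : GIc R X := by
  obtain ⟨G, d, ε, h1, h2, h3, h4, h5⟩ := h
  have hd : d 0 = 0 := by ext x; exact h5 1 (by omega) _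
  rw [hd, LinearMap.ker_zero] at h3
  exact GIc.of (GI_of_equiv (LinearEquiv.ofBijective ε ⟨h2, LinearMap.range_eq_top.1 h3⟩).symm (h1 0))

theorem gidLE_succ {n : ℕ} (h : GG.gidLE R X (n+1)) : ∃ (G C : ModuleCat.{u} R) (f : X →ₗ[R] G) (g : G →ₗ[R] C),
    GG.IsGorensteinInjective R G ∧ SES f g ∧ GG.gidLE R C n := by
  obtain ⟨G, d, ε, h1, h2, h3, h4, h5⟩ := h
  refine ⟨G 0, ModuleCat.of R (LinearMap.range (d 0)), ε, (d 0).rangeRestrict, h1 0,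
    ⟨h2, ?_, LinearMap.surjective_rangeRestrict _⟩, fun i => G (i+1), fun i => d (i+1),
    (LinearMap.range (d 0)).subtype, fun i => h1 _, Subtype.val_injective, ?_, fun i => h4 _, fun i hi => h5 _ (by omega)⟩
  · intro y
    have : y ∈ LinearMap.ker (d 0) ↔ y ∈ LinearMap.range ε := by rw [h3]
    simpa [Subtype.ext_iff] using this
  · simp [h4]

theorem BC.gid [IsNoetherianRing R] (hω : Sdual R ω) {n : ℕ} (hid : ID R ω n) {m : ℕ}
    (hX : GG.gidLE R X m) : BC R ω X := by
  induction m generalizing X with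
  | zero => exact BC.GIc hω hid (gidLE_zero hX)
  | succ m ih =>
    obtain ⟨G, C, f, g, hG, hs, hC⟩ := gidLE_succ hX
    exact BC.ker hω hs (BC.GIc hω hid (.of hG)) (ih hC)

end GGX


namespace GGX

open CategoryTheory CategoryTheory.Abelian
open scoped Pointwise TensorProduct

variable {R : Type u} [CommRing R]
variable {ω X Y J I K : Type u} [AddCommGroup ω] [Module R ω] [AddCommGroup X] [Module R X]
  [AddCommGroup Y] [Module R Y] [AddCommGroup I] [Module R I] [AddCommGroup J] [Module R J]
  [AddCommGroup K] [Module R K]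

theorem bij_of_lcomp_bij (u : Y →ₗ[R] X) (h : ∀ (I : Type u) [AddCommGroup I] [Module R I],
    Module.Injective R I → Function.Bijective (LinearMap.lcomp R I u)) : Function.Bijective u := by
  constructor
  · obtain ⟨I, f, hI, hf⟩ := exists_inj_embed (R := R) Y
    obtain ⟨g, rfl⟩ := (h I hI).2 f
    exact Function.Injective.of_comp hf
  · obtain ⟨I, f, hI, hf⟩ := exists_inj_embed (R := R) (X ⧸ LinearMap.range u)
    have h0 : f ∘ₗ Submodule.mkQ _ = 0 := by
      apply (h I hI).1
      ext y
      have : Submodule.mkQ (LinearMap.range u) (u y) = 0 := by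
        rw [Submodule.mkQ_apply, Submodule.Quotient.mk_eq_zero]; exact ⟨y, rfl⟩
      simp only [LinearMap.lcomp_apply', LinearMap.comp_apply, this, map_zero, LinearMap.zero_apply]
    intro x
    have h1 : Submodule.mkQ (LinearMap.range u) x = 0 := hf (by simpa using LinearMap.congr_fun h0 x)
    rw [Submodule.mkQ_apply, Submodule.Quotient.mk_eq_zero] at h1
    exact h1

theorem EV_tensor [IsNoetherianRing R] [Module.Finite R K] (hω : ∀ i, EV R ω ω (i+1))
    (h1 : ∀ (I : Type u) [AddCommGroup I] [Module R I], Module.Injective R I →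
      ∀ i, EV R K (ω →ₗ[R] I) (i+1))
    (h2 : ∀ i, EV R (K ⊗[R] ω) ω (i+1)) (i : ℕ) : EV R K (ω →ₗ[R] ω) (i+1) := by
  induction i generalizing K with
  | zero =>
    obtain ⟨n, g, hg, hex, _⟩ := exists_syz (R := R) K
    have hf : Function.Injective (LinearMap.ker g).subtype := Subtype.val_injective
    have hinj : Function.Injective (LinearMap.rTensor ω (LinearMap.ker g).subtype) := by
      obtain ⟨I, f, hI, hf'⟩ := exists_inj_embed (R := R) ((LinearMap.ker g) ⊗[R] ω)
      obtain ⟨b, hb⟩ := EV.extend hf hex hg (h1 I hI 0) (TensorProduct.curry f)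
      have : TensorProduct.lift b ∘ₗ LinearMap.rTensor ω (LinearMap.ker g).subtype = f := by
        ext k w
        exact LinearMap.congr_fun (LinearMap.congr_fun hb k) w
      rw [← this] at hf'
      exact Function.Injective.of_comp hf'
    have hex' := rTensor_exact ω hex hg
    have hg' := LinearMap.rTensor_surjective ω hg
    refine EV.con3_of_extend hf hex hg (.proj 0) fun φ => ?_
    obtain ⟨ψ, hψ⟩ := EV.extend (A₁ := (LinearMap.ker g) ⊗[R] ω) hinj hex' hg' (h2 0) (TensorProduct.lift φ)
    refine ⟨TensorProduct.curry ψ, ?_⟩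
    apply LinearMap.ext; intro k
    apply LinearMap.ext; intro w
    exact LinearMap.congr_fun hψ (k ⊗ₜ w)
  | succ i ih =>
    obtain ⟨n, g, hg, hex, _⟩ := exists_syz (R := R) K
    have hf : Function.Injective (LinearMap.ker g).subtype := Subtype.val_injective
    have hinj : Function.Injective (LinearMap.rTensor ω (LinearMap.ker g).subtype) := by
      obtain ⟨I, f, hI, hf'⟩ := exists_inj_embed (R := R) ((LinearMap.ker g) ⊗[R] ω)
      obtain ⟨b, hb⟩ := EV.extend hf hex hg (h1 I hI 0) (TensorProduct.curry f)
      have : TensorProduct.lift b ∘ₗ LinearMap.rTensor ω (LinearMap.ker g).subtype = f := by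
        ext k w
        exact LinearMap.congr_fun (LinearMap.congr_fun hb k) w
      rw [← this] at hf'
      exact Function.Injective.of_comp hf'
    have hex' := rTensor_exact ω hex hg
    have hg' := LinearMap.rTensor_surjective ω hg
    have hFree : ∀ i, EV R ((Fin n → R) ⊗[R] ω) ω (i+1) := fun i =>
      ((hω i).pi_fin_left n).of_iso
        ((TensorProduct.piScalarRight R R ω (Fin n)).symm.trans (TensorProduct.comm R ω (Fin n → R)))
    refine EV.con3 hf hex hg (ih (fun I _ _ hI i => ?_) (fun i => ?_)) (.proj _)
    · exact EV.con1 hf hex hg (.proj _) (h1 I hI (i+1))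
    · exact EV.con1 hinj hex' hg' (hFree i) (h2 _)

theorem TR_of_BC [IsNoetherianRing R] (hω : Sdual R ω) (hX : Ref R ω X) (hB : BC R ω X) :
    TR R (X →ₗ[R] ω) := by
  have := hX.fin
  have := hω.fin
  let e : R ≃ₗ[R] (ω →ₗ[R] ω) := LinearEquiv.ofBijective _ hω.bij
  have he : ∀ s : ω →ₗ[R] ω, ∀ w, e.symm s • w = s w := fun s w => by
    conv_rhs => rw [← e.apply_symm_apply s]
    rfl
  have he' : ∀ r r' : R, (∀ w : ω, r • w = r' • w) → r = r' := fun r r' h => by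
    apply hω.bij.1; ext w; exact h w
  let E : X ≃ₗ[R] ((X →ₗ[R] ω) →ₗ[R] ω) := LinearEquiv.ofBijective _ hX.bij
  have hE : ∀ Φ (l : X →ₗ[R] ω), l (E.symm Φ) = Φ l := fun Φ l => by
    conv_rhs => rw [← E.apply_symm_apply Φ]
    rfl
  -- the evaluation map
  let u : (ω →ₗ[R] X) ⊗[R] ω →ₗ[R] X := TensorProduct.lift LinearMap.id
  have hu : Function.Bijective u := by
    refine bij_of_lcomp_bij u fun I _ _ hI => ?_
    have h3 := hB.b3 I hI
    have : ⇑(LinearMap.lcomp R I u) = (TensorProduct.lift.equiv (RingHom.id R) (ω →ₗ[R] X) ω I) ∘ (thB R ω X I) := by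
      funext a
      apply TensorProduct.ext'
      intro k w
      simp [u]
    rw [this]
    exact (LinearEquiv.bijective _).comp h3
  have hu' : ∀ {N : Type u} [AddCommGroup N] [Module R N] (a b : X →ₗ[R] N),
      (∀ (k : ω →ₗ[R] X) w, a (k w) = b (k w)) → a = b := by
    intro N _ _ a b h
    apply lcomp_inj hu.2
    apply TensorProduct.ext'
    intro k w
    simpa [u] using h k w
  -- dual of L
  let lam : (ω →ₗ[R] X) ≃ₗ[R] ((X →ₗ[R] ω) →ₗ[R] R) := LinearEquiv.ofBijective
    (LinearMap.mk₂ R (fun k l => e.symm (l ∘ₗ k)) (by intros; simp [LinearMap.comp_add]) 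
      (by intros; simp [LinearMap.comp_smul]) (by intros; simp [LinearMap.add_comp])
      (by intros; simp [LinearMap.smul_comp])) (by
      constructor
      · intro k k' h
        ext w
        apply hX.bij.1
        ext l
        have := LinearMap.congr_fun h l
        simp only [LinearMap.mk₂_apply] at this
        exact LinearMap.congr_fun (e.symm.injective this) w
      · intro ρ
        refine ⟨E.symm.toLinearMap ∘ₗ LinearMap.mk₂ R (fun w l => ρ l • w) (by simp) (fun c w l => smul_comm _ _ _)
          (by intros; simp [add_smul]) (by intros; simp [mul_smul]), ?_⟩
        ext l
        apply he'
        intro w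
        simp only [LinearMap.mk₂_apply]
        rw [he]
        simp [hE])
  have hlam : ∀ k l w, lam k l • w = l (k w) := fun k l w => he _ w
  refine ⟨inferInstance, fun i => ?_, fun i => ?_, ?_, ?_⟩
  · refine EV.of_iso' e.symm ((swap hX.ev' hω.ev i).2 ?_)
    exact (hB.b1 i).of_iso' E
  · refine EV.of_iso lam (EV.of_iso' e.symm (EV_tensor hω.ev (fun I _ _ hI i => hB.b2 I hI i) (fun i => ?_) i))
    exact (hX.ev i).of_iso (LinearEquiv.ofBijective u hu).symm
  · intro l l' h
    apply hu'
    intro k w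
    have := LinearMap.congr_fun h (lam k)
    simp only [evd_apply] at this
    rw [← hlam, ← hlam, this]
  · intro Ψ
    let m : (ω →ₗ[R] X) →ₗ[R] (ω →ₗ[R] ω) := e.toLinearMap ∘ₗ Ψ ∘ₗ lam.toLinearMap
    let U := LinearEquiv.ofBijective u hu
    refine ⟨TensorProduct.lift m ∘ₗ U.symm.toLinearMap, ?_⟩
    ext ρ
    obtain ⟨k, rfl⟩ := lam.surjective ρ
    apply he'
    intro w
    rw [evd_apply, hlam]
    have : U.symm (k w) = k ⊗ₜ w := by
      rw [LinearEquiv.symm_apply_eq]; simp [U, u]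
    simp only [LinearMap.comp_apply, LinearEquiv.coe_coe, this, TensorProduct.lift.tmul]
    rfl

end GGX


namespace GGX

open CategoryTheory CategoryTheory.Abelian RingTheory.Sequence IsLocalRing
open scoped Pointwise

variable {R : Type u} [CommRing R]
variable {A B N : Type u}
  [AddCommGroup A] [Module R A] [AddCommGroup B] [Module R B] [AddCommGroup N] [Module R N]

theorem qs {x : R} (h : IsSMulRegular A x) :
    SES (LinearMap.lsmul R A x) (Submodule.mkQ (x • (⊤ : Submodule R A))) :=
  ⟨h, exact_lsmul_mkQ x, Submodule.mkQ_surjective _⟩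

theorem EV.rees {x : R} (hA : ∀ a : A, x • a = 0) (hB : IsSMulRegular B x) {i : ℕ}
    (h : EV R A (QuotSMulTop x B) i) : EV R A B (i+1) := by
  refine .of_forall fun e => ?_
  have s := qs hB
  obtain ⟨y, hy⟩ := Ext.covariant_sequence_exact₁ (ModuleCat.of R A) (SC_se s.inj s.ex s.surj) e
    ((ext_smul_right x e).trans (ext_smul_eq_zero_left x hA e)) rfl
  rw [← hy, EV.eq_zero h y]; simp

theorem EV.kill_zero {x : R} (hA : ∀ a : A, x • a = 0) (hB : IsSMulRegular B x) : EV R A B 0 := by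
  rw [EV.zero_iff]
  refine ⟨fun f g => ?_⟩
  ext a
  apply hB
  simp only [← map_smul, hA, map_zero]

/-- prime filtration -/
theorem EV.pf [IsNoetherianRing R] [Module.Finite R A] {i : ℕ}
    (h : ∀ p : PrimeSpectrum R, Module.annihilator R A ≤ p.asIdeal → EV R (R ⧸ p.asIdeal) B i) :
    EV R A B i := by
  have key := IsNoetherianRing.induction_on_isQuotientEquivQuotientPrime R (M := A) inferInstance
    (motive := fun N _ _ _ => (∀ p : PrimeSpectrum R, Module.annihilator R N ≤ p.asIdeal →
      EV R (R ⧸ p.asIdeal) B i) → EV R N B i)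
  refine key ?_ ?_ ?_ h
  · intro N _ _ _ _ _; exact .of_subsingleton_left _
  · intro N _ _ _ p e h
    refine EV.of_iso e.symm (h p ?_)
    rw [e.annihilator_eq, Ideal.annihilator_quotient]
  · intro N₁ _ _ _ N₂ _ _ _ N₃ _ _ _ f g hf hg hx h1 h3 h
    refine EV.con2 hf hx hg (h1 fun p hp => h p ?_) (h3 fun p hp => h p ?_)
    · exact (LinearMap.annihilator_le_of_injective f hf).trans hp
    · exact (LinearMap.annihilator_le_of_surjective g hg).trans hp

theorem EV.pf' [IsNoetherianRing R] (I : Ideal R) {i : ℕ}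
    (h : ∀ p : PrimeSpectrum R, I ≤ p.asIdeal → EV R (R ⧸ p.asIdeal) B i) :
    EV R (R ⧸ I) B i := EV.pf fun p hp => h p (by rwa [Ideal.annihilator_quotient] at hp)

theorem reg_quot_prime {p : Ideal R} [hp : p.IsPrime] {x : R} (hx : x ∉ p) : IsSMulRegular (R ⧸ p) x := by
  intro a b hab
  obtain ⟨a, rfl⟩ := Ideal.Quotient.mk_surjective a
  obtain ⟨b, rfl⟩ := Ideal.Quotient.mk_surjective b
  rw [Ideal.Quotient.eq]
  have : x * (a - b) ∈ p := by
    have h : Ideal.Quotient.mk p (x * a) = Ideal.Quotient.mk p (x * b) := hab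
    rw [Ideal.Quotient.eq] at h
    rwa [mul_sub]
  exact (hp.mem_or_mem this).resolve_left hx

variable [IsLocalRing R]

theorem ne_max {p : PrimeSpectrum R} (h : p.asIdeal ≠ maximalIdeal R) : ∃ x ∈ maximalIdeal R, x ∉ p.asIdeal := by
  by_contra hc
  push Not at hc
  exact h (le_antisymm (le_maximalIdeal p.2.ne_top) hc)

/-- Nakayama step for primes: if `Ext^{i+1}(R/q,B)=0` for all `q` strictly containing `p`,
then `Ext^i(R/p,B)=0`. -/
theorem EV.prime_step [IsNoetherianRing R] [Module.Finite R B] (p : PrimeSpectrum R) {x : R}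
    (hx : x ∈ maximalIdeal R) (hxp : x ∉ p.asIdeal) {i : ℕ}
    (h : ∀ q : PrimeSpectrum R, p < q → x ∈ q.asIdeal → EV R (R ⧸ q.asIdeal) B (i+1)) :
    EV R (R ⧸ p.asIdeal) B i := by
  have hr : IsSMulRegular (R ⧸ p.asIdeal) x := reg_quot_prime hxp
  have s := qs hr
  refine EV.nak_con hx hr s.ex s.surj (EV.pf fun q hq => ?_)
  have hxq : x ∈ q.asIdeal := hq (by
    rw [Module.mem_annihilator]
    intro m
    obtain ⟨m, rfl⟩ := Submodule.mkQ_surjective _ m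
    rw [← map_smul, Submodule.mkQ_apply, Submodule.Quotient.mk_eq_zero]
    exact Submodule.smul_mem_pointwise_smul _ _ _ trivial)
  have hpq : p.asIdeal ≤ q.asIdeal := by
    refine le_trans ?_ hq
    refine le_trans ?_ (LinearMap.annihilator_le_of_surjective _ s.surj)
    rw [Ideal.annihilator_quotient]
  refine h q (lt_of_le_of_ne hpq ?_) hxq
  rintro rfl
  exact hxp hxq

/-- vanishing of Ext from residue field below `t` -/
def Dp (R : Type u) [CommRing R] [IsLocalRing R] (N : Type u) [AddCommGroup N] [Module R N] (t : ℕ) : Prop :=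
  ∀ i < t, EV R (R ⧸ maximalIdeal R) N i

theorem kill_k {x : R} (hx : x ∈ maximalIdeal R) (a : R ⧸ maximalIdeal R) : x • a = 0 := by
  obtain ⟨a, rfl⟩ := Ideal.Quotient.mk_surjective a
  exact Ideal.Quotient.eq_zero_iff_mem.2 (Ideal.mul_mem_right _ _ hx)

theorem Dp.mono {t s : ℕ} (h : Dp R N t) (hs : s ≤ t) : Dp R N s := fun i hi => h i (by omega)

theorem Dp.quot {x : R} (hN : IsSMulRegular N x) {t : ℕ} (h : Dp R N (t+1)) :
    Dp R (QuotSMulTop x N) t := fun i hi =>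
  EV.cov3 (qs hN).inj (qs hN).ex (qs hN).surj (h i (by omega)) (h (i+1) (by omega))

theorem Dp.of_quot {x : R} (hx : x ∈ maximalIdeal R) (hN : IsSMulRegular N x) {t : ℕ}
    (h : Dp R (QuotSMulTop x N) t) : Dp R N (t+1) := by
  intro i hi
  cases i with
  | zero => exact .kill_zero (kill_k hx) hN
  | succ i => exact .rees (kill_k hx) hN (h i (by omega))

theorem Dp.of_reg (xs : List R) (hx : ∀ x ∈ xs, x ∈ maximalIdeal R) (h : IsWeaklyRegular N xs) :
    Dp R N xs.length := by
  induction xs generalizing N with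
  | nil => intro i hi; simp at hi
  | cons x xs ih =>
    rw [isWeaklyRegular_cons_iff] at h
    exact (ih (fun y hy => hx y (by simp [hy])) h.2).of_quot (hx x (by simp)) h.1

theorem Dp.quots (xs : List R) (h : IsWeaklyRegular N xs) {t : ℕ} (hD : Dp R N (xs.length + t)) :
    Dp R (N ⧸ Ideal.ofList xs • (⊤ : Submodule R N)) t := by
  induction xs generalizing N with
  | nil =>
    intro i hi
    have e : N ≃ₗ[R] (N ⧸ Ideal.ofList ([] : List R) • (⊤ : Submodule R N)) :=
      (Submodule.quotEquivOfEqBot _ (by simp)).symm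
    exact (hD i (by simpa using hi)).of_iso' e
  | cons x xs ih =>
    rw [isWeaklyRegular_cons_iff] at h
    intro i hi
    refine EV.of_iso' (Submodule.quotOfListConsSMulTopEquivQuotSMulTopInner N x xs).symm (ih h.2 (hD.mono ?_ |>.quot h.1) i hi)
    simp
    try omega

theorem Dp.exists_reg [IsNoetherianRing R] [Module.Finite R N] {t : ℕ} (h : Dp R N (t+1)) :
    ∃ x ∈ maximalIdeal R, IsSMulRegular N x := by
  have := EV.zero_iff.1 (h 0 (by omega))
  obtain ⟨r, hr, hr'⟩ := IsSMulRegular.subsingleton_linearMap_iff.1 this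
  exact ⟨r, by rwa [Ideal.annihilator_quotient] at hr, hr'⟩

theorem Dp.exists_seq [IsNoetherianRing R] [Module.Finite R N] {t : ℕ} (h : Dp R N t) :
    ∃ xs : List R, xs.length = t ∧ (∀ x ∈ xs, x ∈ maximalIdeal R) ∧ IsWeaklyRegular N xs := by
  induction t generalizing N with
  | zero => exact ⟨[], rfl, by simp, by simp⟩
  | succ t ih =>
    obtain ⟨x, hx, hr⟩ := h.exists_reg
    obtain ⟨xs, h1, h2, h3⟩ := ih (h.quot hr)
    exact ⟨x :: xs, by simp [h1], by simpa using ⟨hx, h2⟩, by rw [isWeaklyRegular_cons_iff]; exact ⟨hr, h3⟩⟩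

theorem isReg [Nontrivial N] [Module.Finite R N] {xs : List R} (h : ∀ x ∈ xs, x ∈ maximalIdeal R)
    (hw : IsWeaklyRegular N xs) : RingTheory.Sequence.IsRegular N xs :=
  (IsLocalRing.isRegular_iff_isWeaklyRegular_of_subset_maximalIdeal h).2 hw

theorem reg_mem {xs : List R} (h : RingTheory.Sequence.IsRegular N xs) : ∀ x ∈ xs, x ∈ maximalIdeal R := by
  intro x hx
  by_contra hc
  have hu : IsUnit x := by simpa using hc
  apply h.top_ne_smul
  have : Ideal.ofList xs = ⊤ := Ideal.eq_top_of_isUnit_mem _ (Ideal.subset_span hx) hu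
  rw [this]; simp

theorem reg_len_le [IsNoetherianRing R] [Module.Finite R N] {xs : List R}
    (h : RingTheory.Sequence.IsRegular N xs) : (xs.length : WithBot ℕ∞) ≤ Module.supportDim R N := by
  rw [← Module.supportDim_add_length_eq_supportDim_of_isRegular xs h]
  have : Nontrivial (N ⧸ Ideal.ofList xs • (⊤ : Submodule R N)) := by
    rw [Submodule.Quotient.nontrivial_iff]; exact h.top_ne_smul.symm
  have : 0 ≤ Module.supportDim R (N ⧸ Ideal.ofList xs • (⊤ : Submodule R N)) := by
    obtain ⟨c, hc⟩ := WithBot.ne_bot_iff_exists.1 (Module.supportDim_ne_bot_of_nontrivial R (N ⧸ Ideal.ofList xs • (⊤ : Submodule R N)))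
    rw [← hc]; exact WithBot.coe_le_coe.2 zero_le
  exact le_add_of_nonneg_left this

end GGX


namespace GGX

open CategoryTheory CategoryTheory.Abelian RingTheory.Sequence IsLocalRing
open scoped Pointwise

variable {R : Type u} [CommRing R]
variable {A B N W : Type u}
  [AddCommGroup A] [Module R A] [AddCommGroup B] [Module R B] [AddCommGroup N] [Module R N]
  [AddCommGroup W] [Module R W]

noncomputable def quotNil (N : Type u) [AddCommGroup N] [Module R N] :
    (N ⧸ Ideal.ofList ([] : List R) • (⊤ : Submodule R N)) ≃ₗ[R] N :=
  Submodule.quotEquivOfEqBot _ (by simp)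

noncomputable def quotCons (N : Type u) [AddCommGroup N] [Module R N] (x : R) (xs : List R) :
    (N ⧸ Ideal.ofList (x :: xs) • (⊤ : Submodule R N)) ≃ₗ[R]
      (QuotSMulTop x N ⧸ Ideal.ofList xs • (⊤ : Submodule R (QuotSMulTop x N))) :=
  Submodule.quotOfListConsSMulTopEquivQuotSMulTopInner N x xs

theorem EV.pd (xs : List R) (hw : IsWeaklyRegular A xs) {n : ℕ}
    (h : ∀ i, n ≤ i → EV R A W i) (i : ℕ) (hi : n + xs.length ≤ i) :
    EV R (A ⧸ Ideal.ofList xs • (⊤ : Submodule R A)) W i := by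
  induction xs generalizing A n with
  | nil => exact (h i (by simpa using hi)).of_iso (quotNil A).symm
  | cons x xs ih =>
    rw [isWeaklyRegular_cons_iff] at hw
    simp only [List.length_cons] at hi
    refine EV.of_iso (quotCons A x xs).symm (ih hw.2 (n := n+1) ?_ (by omega))
    intro j hj
    obtain ⟨j, rfl⟩ : ∃ j', j = j'+1 := ⟨j-1, by omega⟩
    exact EV.con3 (qs hw.1).inj (qs hw.1).ex (qs hw.1).surj (h _ (by omega)) (h _ (by omega))

theorem EV.pd_ring (xs : List R) (hw : IsWeaklyRegular R xs) (i : ℕ) (hi : xs.length < i) :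
    EV R (R ⧸ Ideal.ofList xs • (⊤ : Submodule R R)) W i :=
  EV.pd xs hw (n := 1) (fun j hj => by
    obtain ⟨j, rfl⟩ : ∃ j', j = j'+1 := ⟨j-1, by omega⟩
    exact EV.proj j) i (by omega)

theorem GIc.ev_pd (xs : List R) (hw : IsWeaklyRegular R xs) (n : ℕ) :
    ∀ {G : Type u} [AddCommGroup G] [Module R G], GIc R G → ∀ i, 1 ≤ i → xs.length < i + n →
    EV R (R ⧸ Ideal.ofList xs • (⊤ : Submodule R R)) G i := by
  induction n with
  | zero => intro G _ _ hG i h1 h2; exact EV.pd_ring xs hw i (by omega)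
  | succ n ih =>
    intro G _ _ hG i h1 h2
    obtain ⟨I, N', f, g, hI, hs, hN'⟩ := hG.left
    obtain ⟨j, rfl⟩ : ∃ j', i = j'+1 := ⟨i-1, by omega⟩
    exact EV.cov3 hs.inj hs.ex hs.surj (EV.inj hI j) (ih hN' _ (by omega) (by omega))

theorem gidLE_ev (xs : List R) (hw : IsWeaklyRegular R xs) (n : ℕ) :
    ∀ {G : Type u} [AddCommGroup G] [Module R G], GG.gidLE R G n → ∀ i, n < i →
    EV R (R ⧸ Ideal.ofList xs • (⊤ : Submodule R R)) G i := by
  induction n with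
  | zero => intro G _ _ hG i h1; exact (gidLE_zero hG).ev_pd xs hw (xs.length) i (by omega) (by omega)
  | succ n ih =>
    intro G _ _ hG i h1
    obtain ⟨G', C, f, g, hG', hs, hC⟩ := gidLE_succ hG
    obtain ⟨j, rfl⟩ : ∃ j', i = j'+1 := ⟨i-1, by omega⟩
    exact EV.cov1 hs.inj hs.ex hs.surj (ih hC j (by omega))
      ((GIc.of hG').ev_pd xs hw (xs.length) _ (by omega) (by omega))

variable [IsLocalRing R]

theorem Dp.of_quots (xs : List R) (hx : ∀ x ∈ xs, x ∈ maximalIdeal R) (h : IsWeaklyRegular N xs) {t : ℕ}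
    (hD : Dp R (N ⧸ Ideal.ofList xs • (⊤ : Submodule R N)) t) : Dp R N (xs.length + t) := by
  induction xs generalizing N with
  | nil => intro i hi; exact (hD i (by simpa using hi)).of_iso' (quotNil N)
  | cons x xs ih =>
    rw [isWeaklyRegular_cons_iff] at h
    have := (ih (fun y hy => hx y (by simp [hy])) h.2 (fun i hi => (hD i hi).of_iso' (quotCons N x xs))).of_quot (hx x (by simp)) h.1
    exact this.mono (by simp; omega)

theorem EV.nak_list [IsNoetherianRing R] [Module.Finite R A] [Module.Finite R W] (xs : List R)
    (hx : ∀ x ∈ xs, x ∈ maximalIdeal R) (hw : IsWeaklyRegular A xs) {i : ℕ}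
    (h : EV R (A ⧸ Ideal.ofList xs • (⊤ : Submodule R A)) W (i + xs.length)) : EV R A W i := by
  induction xs generalizing A i with
  | nil => exact EV.of_iso (quotNil A) h
  | cons x xs ih =>
    rw [isWeaklyRegular_cons_iff] at hw
    refine EV.nak_con (hx x (by simp)) hw.1 (qs hw.1).ex (qs hw.1).surj
      (ih (fun y hy => hx y (by simp [hy])) hw.2 ?_)
    refine EV.of_iso (quotCons A x xs) ?_
    convert h using 1
    simp; omega

/-- L1 -/
theorem EV.mcm [IsNoetherianRing R] [Module.Finite R A] [Module.Finite R W] (xs : List R)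
    (hx : ∀ x ∈ xs, x ∈ maximalIdeal R) (hw : IsWeaklyRegular A xs) (hW : ID R W xs.length) (i : ℕ) :
    EV R A W (i+1) := EV.nak_list xs hx hw (hW _ _ (by omega))

theorem gid_ge [IsNoetherianRing R] [Module.Finite R N] [Nontrivial N] (xs : List R)
    (hx : ∀ x ∈ xs, x ∈ maximalIdeal R) (hw : IsWeaklyRegular R xs) {n : ℕ} (h : GG.gidLE R N n) :
    xs.length ≤ n := by
  by_contra hc
  have h0 : EV R R N 0 := EV.nak_list xs hx hw (gidLE_ev xs hw n h _ (by omega))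
  have := EV.zero_iff.1 h0
  obtain ⟨a, b, hab⟩ := exists_pair_ne N
  apply hab
  have : LinearMap.toSpanSingleton R N a = LinearMap.toSpanSingleton R N b := Subsingleton.elim _ _
  simpa using LinearMap.congr_fun this 1

theorem exists_max_reg [IsNoetherianRing R] [Module.Finite R N] [Nontrivial N] :
    ∃ xs : List R, (∀ x ∈ xs, x ∈ maximalIdeal R) ∧ RingTheory.Sequence.IsRegular N xs ∧
      ¬ EV R (R ⧸ maximalIdeal R) (N ⧸ Ideal.ofList xs • (⊤ : Submodule R N)) 0 := by
  have hfin : Module.supportDim R N < ⊤ := by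
    refine lt_of_le_of_lt (Module.supportDim_le_ringKrullDim R N) ringKrullDim_lt_top
  obtain ⟨n, hn⟩ : ∃ n : ℕ, Module.supportDim R N = (n : WithBot ℕ∞) := by
    obtain ⟨c, hc⟩ := WithBot.ne_bot_iff_exists.1 (Module.supportDim_ne_bot_of_nontrivial R N)
    rw [← hc] at hfin ⊢
    have : c ≠ ⊤ := by rintro rfl; exact lt_irrefl _ hfin
    lift c to ℕ using this
    exact ⟨c, rfl⟩
  have hb : ∀ t, Dp R N t → t ≤ n := by
    intro t ht
    obtain ⟨xs, h1, h2, h3⟩ := ht.exists_seq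
    have := reg_len_le (isReg h2 h3)
    rw [hn, h1] at this
    exact_mod_cast this
  classical
  obtain ⟨t, ht, ht'⟩ : ∃ t, Dp R N t ∧ ¬ Dp R N (t+1) := by
    by_contra hc
    push Not at hc
    have : ∀ t, Dp R N t := fun t => Nat.rec (fun i hi => absurd hi (Nat.not_lt_zero i)) (fun t ih => hc t ih) t
    have := hb _ (this (n+1))
    omega
  obtain ⟨xs, h1, h2, h3⟩ := ht.exists_seq
  refine ⟨xs, h2, isReg h2 h3, fun h => ht' ?_⟩
  rw [← h1]
  exact Dp.of_quots xs h2 h3 (fun i hi => by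
    obtain rfl : i = 0 := by omega
    exact h)

theorem k_embed (h : ¬ EV R (R ⧸ maximalIdeal R) N 0) :
    ∃ f : (R ⧸ maximalIdeal R) →ₗ[R] N, Function.Injective f := by
  rw [EV.zero_iff] at h
  have : Nontrivial ((R ⧸ maximalIdeal R) →ₗ[R] N) := not_subsingleton_iff_nontrivial.1 h
  obtain ⟨f, hf⟩ := exists_ne (0 : (R ⧸ maximalIdeal R) →ₗ[R] N)
  refine ⟨f, ?_⟩
  have : IsSimpleModule R (R ⧸ maximalIdeal R) := by
    rw [isSimpleModule_iff_isCoatom]; exact (maximalIdeal.isMaximal R).1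
  exact (LinearMap.injective_or_eq_zero f).resolve_right hf

theorem bass_bound' [IsNoetherianRing R] [Module.Finite R W] {m n : ℕ} (hW : ID R W m)
    (ys : List R) (hreg : IsWeaklyRegular R ys)
    (hk : ¬ EV R (R ⧸ maximalIdeal R) (R ⧸ Ideal.ofList ys • (⊤ : Submodule R R)) 0)
    (hlen : ys.length ≤ n) : ID R W n := by
  obtain ⟨f, hf⟩ := k_embed hk
  have key : ∀ l, ∀ j, n < j → m < j + l → ∀ p : PrimeSpectrum R, EV R (R ⧸ p.asIdeal) W j := by
    intro l
    induction l with
    | zero => intro j _ hj p; exact hW _ j (by omega)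
    | succ l ih =>
      intro j hj1 hj2 p
      by_cases hp : p.asIdeal = maximalIdeal R
      · rw [hp]
        have s : SES f (LinearMap.range f).mkQ := ⟨hf, by rw [LinearMap.exact_iff]; simp, Submodule.mkQ_surjective _⟩
        exact EV.con1 s.inj s.ex s.surj (EV.pd_ring ys hreg j (by omega))
          (EV.pf fun q _ => ih _ (by omega) (by omega) q)
      · obtain ⟨x, hx, hxp⟩ := ne_max hp
        exact EV.prime_step p hx hxp fun q _ _ => ih _ (by omega) (by omega) q
  exact ID_of_EV fun I => EV.pf' I fun p _ => key m (n+1) (by omega) (by omega) p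

theorem bass_bound [IsNoetherianRing R] [Module.Finite R W] {m n : ℕ} (hW : ID R W m)
    (hn : ringKrullDim R ≤ n) : ID R W n := by
  obtain ⟨ys, hy, hreg, hk⟩ := exists_max_reg (R := R) (N := R)
  have hlen : ys.length ≤ n := by
    have := reg_len_le hreg
    rw [Module.supportDim_self_eq_ringKrullDim] at this
    exact_mod_cast this.trans hn
  exact bass_bound' hW ys hreg.toIsWeaklyRegular hk hlen

theorem isch_param [IsNoetherianRing R] [Module.Finite R N] {t : ℕ} (h : Dp R N t) (ys : List R) (p : PrimeSpectrum R)
    (hy : ∀ y ∈ ys, y ∈ maximalIdeal R)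
    (hp : maximalIdeal R ≤ (p.asIdeal ⊔ Ideal.ofList ys).radical) {i : ℕ} (hi : i + ys.length < t) :
    EV R (R ⧸ p.asIdeal) N i := by
  induction ys generalizing p i with
  | nil =>
    have : p.asIdeal = maximalIdeal R := by
      refine le_antisymm (le_maximalIdeal p.2.ne_top) (hp.trans ?_)
      simp [p.2.radical]
    rw [this]; exact h i (by simpa using hi)
  | cons y ys ih =>
    simp only [List.length_cons] at hi
    have hr : ∀ q : PrimeSpectrum R, p ≤ q → y ∈ q.asIdeal →
        maximalIdeal R ≤ (q.asIdeal ⊔ Ideal.ofList ys).radical := by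
      intro q hpq hyq
      refine hp.trans (Ideal.radical_mono ?_)
      rw [Ideal.ofList_cons, sup_le_iff, sup_le_iff]
      refine ⟨le_trans hpq le_sup_left, le_trans ?_ le_sup_left, le_sup_right⟩
      rwa [Ideal.span_singleton_le_iff_mem]
    by_cases hyp : y ∈ p.asIdeal
    · exact ih p (fun z hz => hy z (by simp [hz])) (hr p le_rfl hyp) (by omega)
    · exact EV.prime_step p (hy y (by simp)) hyp fun q hpq hyq =>
        ih q (fun z hz => hy z (by simp [hz])) (hr q hpq.le hyq) (by omega)

theorem isch_coh [IsNoetherianRing R] [Module.Finite R N] {t : ℕ} (h : Dp R N t) (c : ℕ) (p : PrimeSpectrum R)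
    (hc : Order.coheight p ≤ c) {i : ℕ} (hi : i + c < t) :
    EV R (R ⧸ p.asIdeal) N i := by
  induction c generalizing p i with
  | zero =>
    have : p.asIdeal = maximalIdeal R := by
      have : IsMax p := by
        rw [← Order.coheight_eq_zero]; simpa using hc
      have h2 : p ≤ closedPoint R := le_maximalIdeal p.2.ne_top
      have := this.eq_of_le h2
      rw [this]; rfl
    rw [this]; exact h i (by simpa using hi)
  | succ c ih =>
    by_cases hp : p.asIdeal = maximalIdeal R
    · rw [hp]; exact h i (by omega)
    · obtain ⟨x, hx, hxp⟩ := ne_max hp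
      refine EV.prime_step p hx hxp fun q hpq _ => ih q ?_ (by omega)
      have := Order.coheight_add_one_le hpq
      have := this.trans hc
      push_cast at this
      exact (ENat.add_le_add_iff_right (by simp)).1 this

theorem reg_of_EV [IsNoetherianRing R] {x : R}
    (h : ∀ p : PrimeSpectrum R, Module.annihilator R N ≤ p.asIdeal → x ∈ p.asIdeal → EV R (R ⧸ p.asIdeal) N 0) : IsSMulRegular N x := by
  by_contra hc
  have hex : ∃ n : N, n ≠ 0 ∧ x • n = 0 := by
    by_contra hc'
    push Not at hc'
    apply hc
    rw [isSMulRegular_iff_right_eq_zero_of_smul]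
    intro n hn; by_contra h0; exact hc' n h0 hn
  obtain ⟨n, hn0, hn⟩ := hex
  obtain ⟨p, hp, hle⟩ := exists_le_isAssociatedPrime_of_isNoetherianRing R n hn0
  obtain ⟨f, hf⟩ := (isAssociatedPrime_iff_exists_injective_linearMap p N).1 hp |>.2
  have hxp : x ∈ p := hle (by simpa [Submodule.mem_colon_singleton, LinearMap.mem_ker] using hn)
  have : Module.annihilator R N ≤ p := by
    have := LinearMap.annihilator_le_of_injective f hf
    rwa [Ideal.annihilator_quotient] at this
  have := EV.zero_iff.1 (h ⟨p, hp.isPrime⟩ this hxp)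
  have h0 : f = 0 := Subsingleton.elim _ _
  have : (Ideal.Quotient.mk p) 1 = 0 := hf (by rw [h0]; simp)
  exact hp.isPrime.ne_top ((Ideal.eq_top_iff_one _).2 (Ideal.Quotient.eq_zero_iff_mem.1 this))

theorem bal [IsNoetherianRing R] [Module.Finite R N] (I : Ideal R) (hI : I ≤ Module.annihilator R N) (xs : List R)
    (hx : ∀ x ∈ xs, x ∈ maximalIdeal R) (hp : maximalIdeal R ≤ (I ⊔ Ideal.ofList xs).radical)
    (h : Dp R N xs.length) : IsWeaklyRegular N xs := by
  induction xs generalizing N I with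
  | nil => simp
  | cons x xs ih =>
    have hr : IsSMulRegular N x := by
      refine reg_of_EV fun p hpN hxp => isch_param h xs p (fun z hz => hx z (by simp [hz])) ?_ (by simp)
      refine hp.trans (Ideal.radical_mono ?_)
      rw [Ideal.ofList_cons, sup_le_iff, sup_le_iff]
      refine ⟨le_trans (hI.trans hpN) le_sup_left, le_trans ?_ le_sup_left, le_sup_right⟩
      rwa [Ideal.span_singleton_le_iff_mem]
    rw [isWeaklyRegular_cons_iff]
    refine ⟨hr, ih (I ⊔ Ideal.span {x}) ?_ (fun z hz => hx z (by simp [hz])) ?_ (h.quot hr)⟩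
    · rw [sup_le_iff]
      refine ⟨hI.trans (LinearMap.annihilator_le_of_surjective _ (qs hr).surj), ?_⟩
      rw [Ideal.span_singleton_le_iff_mem, Module.mem_annihilator]
      intro m
      obtain ⟨m, rfl⟩ := Submodule.mkQ_surjective _ m
      rw [← map_smul, Submodule.mkQ_apply, Submodule.Quotient.mk_eq_zero]
      exact Submodule.smul_mem_pointwise_smul _ _ _ trivial
    · rwa [sup_assoc, ← Ideal.ofList_cons]

end GGX


namespace GGX

open CategoryTheory CategoryTheory.Abelian RingTheory.Sequence IsLocalRing
open scoped Pointwise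

section
variable {R : Type u} [CommRing R]
variable {A B C N A' B' N' : Type u}
  [AddCommGroup A] [Module R A] [AddCommGroup B] [Module R B] [AddCommGroup C] [Module R C]
  [AddCommGroup N] [Module R N]
  [AddCommGroup A'] [Module R A'] [AddCommGroup B'] [Module R B'] [AddCommGroup N'] [Module R N']

/-- `π` is the reduction modulo `I` -/
structure Red (I : Ideal R) (π : A →ₗ[R] A') : Prop where
  surj : Function.Surjective π
  ker : LinearMap.ker π = I • ⊤

theorem Red.mkQ (I : Ideal R) (A : Type u) [AddCommGroup A] [Module R A] :
    Red I (Submodule.mkQ (I • (⊤ : Submodule R A))) := ⟨Submodule.mkQ_surjective _, Submodule.ker_mkQ _⟩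

theorem Red.mkQ_elt (x : R) (A : Type u) [AddCommGroup A] [Module R A] :
    Red (Ideal.span {x}) (Submodule.mkQ (x • (⊤ : Submodule R A))) :=
  ⟨Submodule.mkQ_surjective _, by rw [Submodule.ker_mkQ, Submodule.ideal_span_singleton_smul]⟩

theorem Red.comp {I J : Ideal R} {π : A →ₗ[R] B} {ρ : B →ₗ[R] C} (h1 : Red I π) (h2 : Red J ρ) :
    Red (I ⊔ J) (ρ ∘ₗ π) := by
  refine ⟨h2.surj.comp h1.surj, ?_⟩
  rw [LinearMap.ker_comp, h2.ker, ← LinearMap.range_eq_top.2 h1.surj, ← Submodule.map_top,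
    ← Submodule.map_smul'', Submodule.comap_map_eq, h1.ker, sup_comm, Submodule.sup_smul]

theorem Red.factor {I J : Ideal R} {π : A →ₗ[R] B} {ρ : A →ₗ[R] C} (h1 : Red I π) (h2 : Red (I ⊔ J) ρ) :
    ∃ σ : B →ₗ[R] C, Red J σ ∧ σ ∘ₗ π = ρ := by
  have hle : LinearMap.ker π ≤ LinearMap.ker ρ := by
    rw [h1.ker, h2.ker, Submodule.sup_smul]; exact le_sup_left
  let e := π.quotKerEquivOfSurjective h1.surj
  have he : ∀ a, e.symm (π a) = Submodule.Quotient.mk a := fun a => by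
    rw [LinearEquiv.symm_apply_eq]; rfl
  let σ : B →ₗ[R] C := (LinearMap.ker π).liftQ ρ hle ∘ₗ e.symm.toLinearMap
  have hσ : σ ∘ₗ π = ρ := by
    ext a
    simp [σ, he]
  refine ⟨σ, ⟨fun c => ?_, ?_⟩, hσ⟩
  · obtain ⟨a, rfl⟩ := h2.surj c
    exact ⟨π a, LinearMap.congr_fun hσ a⟩
  · have : LinearMap.ker σ = (LinearMap.ker ρ).map π := by
      rw [← hσ, LinearMap.ker_comp π σ, Submodule.map_comap_eq_of_surjective h1.surj]
    rw [this, h2.ker, Submodule.sup_smul, Submodule.map_sup, ← h1.ker, Submodule.map_smul'',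
      Submodule.map_top, LinearMap.range_eq_top.2 h1.surj]
    simp [Submodule.map_le_iff_le_comap]

/-- L2 -/
theorem Red.homR (xs : List R) {ρ : N →ₗ[R] N'} (hρ : Red (Ideal.ofList xs) ρ) (hN : IsWeaklyRegular N xs)
    (hE : ∀ i, EV R A N (i+1)) :
    Red (Ideal.ofList xs) (ρ.compRight R : (A →ₗ[R] N) →ₗ[R] (A →ₗ[R] N')) ∧
      IsWeaklyRegular (A →ₗ[R] N) xs ∧ ∀ i, EV R A N' (i+1) := by
  induction xs generalizing N with
  | nil =>
    have hk : LinearMap.ker ρ = ⊥ := by rw [hρ.ker]; simp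
    let e : N ≃ₗ[R] N' := LinearEquiv.ofBijective ρ ⟨LinearMap.ker_eq_bot.1 hk, hρ.surj⟩
    have he : ∀ n, e n = ρ n := fun _ => rfl
    refine ⟨⟨fun f => ⟨e.symm.toLinearMap ∘ₗ f, ?_⟩, ?_⟩, by simp, fun i => (hE i).of_iso' e⟩
    · ext a; change ρ (e.symm (f a)) = _; rw [← he]; simp
    · simp only [Ideal.ofList_nil, Submodule.bot_smul]
      rw [LinearMap.ker_eq_bot]
      intro f g hfg
      ext a
      exact e.injective (LinearMap.congr_fun hfg a)
  | cons x xs ih =>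
    rw [isWeaklyRegular_cons_iff] at hN
    rw [Ideal.ofList_cons] at hρ ⊢
    have s := qs hN.1
    obtain ⟨σ, hσ, rfl⟩ := (Red.mkQ_elt x N).factor hρ
    obtain ⟨h1, h2, h3⟩ := ih hσ hN.2 (fun i => EV.cov3 s.inj s.ex s.surj (hE i) (hE (i+1)))
    have h4 : Red (Ideal.span {x}) ((Submodule.mkQ (x • (⊤ : Submodule R N))).compRight R : (A →ₗ[R] N) →ₗ[R] (A →ₗ[R] _)) := by
      refine ⟨fun f => EV.lift s.inj s.ex s.surj (hE 0) f, le_antisymm ?_ ?_⟩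
      · intro f hf
        rw [Submodule.ideal_span_singleton_smul]
        obtain ⟨g, hg⟩ := ((s.hom (ω := A) (fun φ => EV.lift s.inj s.ex s.surj (hE 0) φ)).ex f).1 hf
        refine ⟨g, trivial, ?_⟩
        rw [← hg]; rfl
      · rw [Submodule.ideal_span_singleton_smul]
        rintro _ ⟨g, -, rfl⟩
        rw [LinearMap.mem_ker]
        ext a
        exact (s.ex _).2 ⟨g a, rfl⟩
    refine ⟨h4.comp h1, ?_, h3⟩
    rw [isWeaklyRegular_cons_iff]
    have hk := h4.ker
    rw [Submodule.ideal_span_singleton_smul] at hk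
    let e : QuotSMulTop x (A →ₗ[R] N) ≃ₗ[R] (A →ₗ[R] QuotSMulTop x N) :=
      (Submodule.quotEquivOfEq _ _ hk.symm).trans (LinearMap.quotKerEquivOfSurjective _ h4.surj)
    refine ⟨fun f g hfg => ?_, (e.isWeaklyRegular_congr xs).2 h2⟩
    ext a
    exact hN.1 (LinearMap.congr_fun hfg a)

theorem SES.quot {f : A →ₗ[R] B} {g : B →ₗ[R] C} (h : SES f g) {x : R} (hC : IsSMulRegular C x) :
    SES (QuotSMulTop.map x f) (QuotSMulTop.map x g) := by
  refine ⟨?_, QuotSMulTop.map_exact x h.ex h.surj, QuotSMulTop.map_surjective x h.surj⟩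
  rw [injective_iff_map_eq_zero]
  intro a ha
  have := QuotSMulTop.map_first_exact_on_four_term_exact_of_isSMulRegular_last (r := x)
    (f₁ := (0 : PUnit.{u+1} →ₗ[R] A)) (f₂ := f) (f₃ := g)
    (by rw [LinearMap.exact_zero_iff_injective]; exact h.inj) h.ex hC
  obtain ⟨y, rfl⟩ := (this a).1 ha
  obtain ⟨y, rfl⟩ := Submodule.mkQ_surjective _ y
  simp

theorem SES.wreg {f : A →ₗ[R] B} {g : B →ₗ[R] C} (h : SES f g) (xs : List R) (hB : IsWeaklyRegular B xs)
    (hC : IsWeaklyRegular C xs) : IsWeaklyRegular A xs := by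
  induction xs generalizing A B C with
  | nil => simp
  | cons x xs ih =>
    rw [isWeaklyRegular_cons_iff] at *
    refine ⟨hB.1.of_injective f h.inj, ih (h.quot hC.1) hB.2 hC.2⟩

theorem SES.tor {f : A →ₗ[R] B} {g : B →ₗ[R] C} (h : SES f g) (xs : List R)
    (hC : IsWeaklyRegular C xs) {a : A} (ha : f a ∈ Ideal.ofList xs • (⊤ : Submodule R B)) :
    a ∈ Ideal.ofList xs • (⊤ : Submodule R A) := by
  induction xs generalizing A B C with
  | nil => simpa [h.inj.eq_iff' (map_zero f)] using ha
  | cons x xs ih =>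
    rw [isWeaklyRegular_cons_iff] at hC
    have h1 := ((Red.mkQ_elt x A).comp (Red.mkQ (Ideal.ofList xs) _)).ker
    have h2 := ((Red.mkQ_elt x B).comp (Red.mkQ (Ideal.ofList xs) _)).ker
    rw [Ideal.ofList_cons] at ha ⊢
    rw [← h2] at ha
    rw [← h1]
    simp only [LinearMap.mem_ker, LinearMap.comp_apply, Submodule.mkQ_apply, Submodule.Quotient.mk_eq_zero] at ha ⊢
    exact ih (h.quot hC.1) hC.2 ha

variable {S : Type u} [CommRing S] [Algebra R S]
  [Module S A'] [IsScalarTower R S A'] [Module S N'] [IsScalarTower R S N'] [Module S B'] [IsScalarTower R S B']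
variable {I : Ideal R}

theorem slin (hS : Function.Surjective (algebraMap R S)) (f : A' →ₗ[R] B') : ∃ f' : A' →ₗ[S] B', ∀ a, f' a = f a :=
  ⟨{ toFun := f, map_add' := f.map_add, map_smul' := fun s a => by
      obtain ⟨r, rfl⟩ := hS s
      simp }, fun _ => rfl⟩

/-- R-homs to an S-module factor through the reduction -/
theorem Red.lift {π : A →ₗ[R] A'} (hπ : Red I π) (hS : Function.Surjective (algebraMap R S))
    (hI : ∀ r ∈ I, algebraMap R S r = 0) (f : A →ₗ[R] B') : ∃ f' : A' →ₗ[S] B', ∀ a, f' (π a) = f a := by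
  have h0 : Red (⊥ : Ideal R) (LinearMap.id : B' →ₗ[R] B') := ⟨Function.surjective_id, by simp⟩
  have hle : LinearMap.ker π ≤ LinearMap.ker f := by
    rw [hπ.ker, Submodule.smul_le]
    intro r hr a _
    rw [LinearMap.mem_ker, map_smul, ← algebraMap_smul S r, hI r hr, zero_smul]
  let e := π.quotKerEquivOfSurjective hπ.surj
  have he : ∀ a, e.symm (π a) = Submodule.Quotient.mk a := fun a => by
    rw [LinearEquiv.symm_apply_eq]; rfl
  obtain ⟨f', hf'⟩ := slin hS ((LinearMap.ker π).liftQ f hle ∘ₗ e.symm.toLinearMap)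
  refine ⟨f', fun a => ?_⟩
  rw [hf']; simp [he]

/-- reduction of Hom -/
theorem Red.hom (xs : List R) (hS : Function.Surjective (algebraMap R S))
    (hI : ∀ r ∈ Ideal.ofList xs, algebraMap R S r = 0) {π : A →ₗ[R] A'} (hπ : Red (Ideal.ofList xs) π)
    {ρ : N →ₗ[R] N'} (hρ : Red (Ideal.ofList xs) ρ) (hN : IsWeaklyRegular N xs)
    (hE : ∀ i, EV R A N (i+1)) :
    ∃ β : (A →ₗ[R] N) →ₗ[R] (A' →ₗ[S] N'), Red (Ideal.ofList xs) β ∧ ∀ f a, β f (π a) = ρ (f a) := by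
  obtain ⟨h1, -, -⟩ := Red.homR xs hρ hN hE
  choose t ht using fun f : A →ₗ[R] N => hπ.lift hS hI (ρ ∘ₗ f)
  let β : (A →ₗ[R] N) →ₗ[R] (A' →ₗ[S] N') :=
    { toFun := t
      map_add' := fun f g => by
        ext a; obtain ⟨a, rfl⟩ := hπ.surj a; simp [ht]
      map_smul' := fun r f => by
        ext a; obtain ⟨a, rfl⟩ := hπ.surj a; simp [ht] }
  have hβ : ∀ f a, β f (π a) = ρ (f a) := ht
  refine ⟨β, ⟨fun f => ?_, ?_⟩, hβ⟩
  · obtain ⟨g, hg⟩ := h1.surj (f.restrictScalars R ∘ₗ π)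
    refine ⟨g, ?_⟩
    ext a; obtain ⟨a, rfl⟩ := hπ.surj a
    rw [hβ]; exact LinearMap.congr_fun hg a
  · rw [← h1.ker]
    ext f
    rw [LinearMap.mem_ker, LinearMap.mem_ker]
    constructor
    · intro h; ext a
      change ρ (f a) = 0
      rw [← hβ, h]; rfl
    · intro h; ext a; obtain ⟨a, rfl⟩ := hπ.surj a
      rw [hβ]; exact LinearMap.congr_fun h a

/-- uniqueness of reductions -/
theorem Red.equiv (hS : Function.Surjective (algebraMap R S)) {π : A →ₗ[R] A'} (hπ : Red I π)
    {ρ : A →ₗ[R] B'} (hρ : Red I ρ) : Nonempty (A' ≃ₗ[S] B') := by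
  obtain ⟨σ, hσ, h⟩ := Red.factor (J := ⊥) hπ (by simpa using hρ)
  obtain ⟨σ', hσ'⟩ := slin hS σ
  refine ⟨LinearEquiv.ofBijective σ' ⟨?_, ?_⟩⟩
  · have : LinearMap.ker σ = ⊥ := by rw [hσ.ker]; simp
    have := LinearMap.ker_eq_bot.1 this
    intro a b hab
    exact this (by rw [← hσ', ← hσ', hab])
  · intro b; obtain ⟨a, rfl⟩ := hσ.surj b; exact ⟨a, hσ' a⟩

/-- bijectivity passes to the reduction -/
theorem Red.bij {φ : A →ₗ[R] N} {φ' : A' → N'} {π : A →ₗ[R] A'} {ρ : N →ₗ[R] N'} (hπ : Red I π) (hρ : Red I ρ)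
    (hc : ∀ a, φ' (π a) = ρ (φ a)) (h : Function.Bijective φ) : Function.Bijective φ' := by
  constructor
  · intro a b hab
    obtain ⟨a, rfl⟩ := hπ.surj a
    obtain ⟨b, rfl⟩ := hπ.surj b
    rw [hc, hc, ← sub_eq_zero, ← map_sub, ← LinearMap.mem_ker, hρ.ker, ← map_sub,
      ← LinearMap.range_eq_top.2 h.2, ← Submodule.map_top, ← Submodule.map_smul''] at hab
    obtain ⟨c, hc', hcd⟩ := hab
    rw [h.1 hcd, SetLike.mem_coe, ← hπ.ker, LinearMap.mem_ker, map_sub, sub_eq_zero] at hc'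
    exact hc'
  · intro n
    obtain ⟨n, rfl⟩ := hρ.surj n
    obtain ⟨a, rfl⟩ := h.2 n
    exact ⟨π a, hc a⟩

theorem Red.bij_conv [IsLocalRing R] [IsNoetherianRing R] [Module.Finite R A] [Module.Finite R N] (xs : List R)
    (hx : ∀ x ∈ xs, x ∈ maximalIdeal R)
    {φ : A →ₗ[R] N} {φ' : A' → N'} {π : A →ₗ[R] A'} {ρ : N →ₗ[R] N'} (hπ : Red (Ideal.ofList xs) π)
    (hρ : Red (Ideal.ofList xs) ρ) (hN : IsWeaklyRegular N xs)
    (hc : ∀ a, φ' (π a) = ρ (φ a)) (h : Function.Bijective φ') : Function.Bijective φ := by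
  have hle : Ideal.ofList xs ≤ maximalIdeal R := Ideal.span_le.2 hx
  have hJ : Ideal.ofList xs ≤ Ideal.jacobson ⊥ := by rwa [IsLocalRing.jacobson_eq_maximalIdeal _ bot_ne_top]
  have hsurj : Function.Surjective φ := by
    rw [← LinearMap.range_eq_top]
    refine top_le_iff.1 (Submodule.le_of_le_smul_of_le_jacobson_bot (I := Ideal.ofList xs) Module.Finite.fg_top hJ ?_)
    intro n _
    obtain ⟨a', ha'⟩ := h.2 (ρ n)
    obtain ⟨a, rfl⟩ := hπ.surj a'
    rw [hc, eq_comm, ← sub_eq_zero, ← map_sub, ← LinearMap.mem_ker, hρ.ker] at ha'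
    have : n = φ a + (n - φ a) := by abel
    rw [this]
    exact Submodule.add_mem_sup ⟨a, rfl⟩ ha'
  refine ⟨?_, hsurj⟩
  have s : SES (LinearMap.ker φ).subtype φ :=
    ⟨Subtype.val_injective, by rw [LinearMap.exact_iff]; simp, hsurj⟩
  rw [← LinearMap.ker_eq_bot]
  refine Submodule.eq_bot_of_le_smul_of_le_jacobson_bot (Ideal.ofList xs) _ (IsNoetherian.noetherian _) ?_ hJ
  intro a ha
  have h1 : π a = 0 := by
    apply h.1
    have h0 := hc 0
    rw [map_zero, map_zero, map_zero] at h0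
    rw [hc, LinearMap.mem_ker.1 ha, map_zero, h0]
  have h2 := s.tor xs hN (a := ⟨a, ha⟩) (by rw [← hπ.ker]; exact h1)
  have h3 := Submodule.mem_map_of_mem (f := (LinearMap.ker φ).subtype) h2
  rwa [Submodule.map_smul'', Submodule.map_top, Submodule.range_subtype] at h3
end

end GGX


namespace GGX

open CategoryTheory CategoryTheory.Abelian RingTheory.Sequence IsLocalRing
open scoped Pointwise

variable {R : Type u} [CommRing R]
variable {A B N A' B' N' : Type u}
  [AddCommGroup A] [Module R A] [AddCommGroup B] [Module R B]
  [AddCommGroup N] [Module R N]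
  [AddCommGroup A'] [Module R A'] [AddCommGroup B'] [Module R B'] [AddCommGroup N'] [Module R N']

theorem wreg_pi {xs : List R} (h : IsWeaklyRegular R xs) (n : ℕ) : IsWeaklyRegular (Fin n → R) xs := by
  have := (Red.homR (A := Fin n → R) xs (Red.mkQ _ R) h (fun i => EV.proj i)).2.1
  exact ((LinearEquiv.piRing R R (Fin n) R).isWeaklyRegular_congr xs).1 this

theorem EV.kill_list (xs : List R) (hA : ∀ x ∈ xs, ∀ a : A, x • a = 0) (hN : IsWeaklyRegular N xs) {i : ℕ}
    (hi : i < xs.length) : EV R A N i := by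
  induction xs generalizing N i with
  | nil => simp at hi
  | cons x xs ih =>
    rw [isWeaklyRegular_cons_iff] at hN
    cases i with
    | zero => exact .kill_zero (hA x (by simp)) hN.1
    | succ i => exact .rees (hA x (by simp)) hN.1 (ih (fun y hy => hA y (by simp [hy])) hN.2 (by simpa using hi))

theorem ext_red (xs : List R) (hA : ∀ x ∈ xs, ∀ a : A, x • a = 0) (hB : ∀ x ∈ xs, ∀ a : B, x • a = 0)
    (f : A →ₗ[R] B) {ρ : N →ₗ[R] N'} (hρ : Red (Ideal.ofList xs) ρ) (hN : IsWeaklyRegular N xs)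
    (h : ∀ e : Ext (ModuleCat.of R A) (ModuleCat.of R N) xs.length,
      ∃ b : Ext (ModuleCat.of R B) (ModuleCat.of R N) xs.length,
        (Ext.mk₀ (ModuleCat.ofHom f)).comp b (zero_add _) = e) (φ : A →ₗ[R] N') :
    ∃ ψ : B →ₗ[R] N', ψ ∘ₗ f = φ := by
  induction xs generalizing N with
  | nil =>
    have hk : LinearMap.ker ρ = ⊥ := by rw [hρ.ker]; simp
    let e : N ≃ₗ[R] N' := LinearEquiv.ofBijective ρ ⟨LinearMap.ker_eq_bot.1 hk, hρ.surj⟩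
    obtain ⟨b, hb⟩ := h (Ext.mk₀ (ModuleCat.ofHom (e.symm.toLinearMap ∘ₗ φ)))
    obtain ⟨y, rfl⟩ := Ext.mk₀_bijective _ _ |>.2 b
    rw [Ext.mk₀_comp_mk₀] at hb
    have := Ext.mk₀_bijective _ _ |>.1 hb
    refine ⟨e.toLinearMap ∘ₗ y.hom, ?_⟩
    ext a
    have h2 : y.hom (f a) = e.symm (φ a) := congrArg (fun t => t.hom a) this
    simp [h2]
  | cons x xs ih =>
    rw [isWeaklyRegular_cons_iff] at hN
    have s := qs hN.1
    rw [Ideal.ofList_cons] at hρ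
    obtain ⟨σ, hσ, rfl⟩ := (Red.mkQ_elt x N).factor hρ
    refine ih (fun y hy => hA y (by simp [hy])) (fun y hy => hB y (by simp [hy])) hσ hN.2 ?_
    intro e
    have hse := SC_se s.inj s.ex s.surj
    obtain ⟨b, hb⟩ := h (e.comp hse.extClass rfl)
    obtain ⟨b', hb'⟩ := Ext.covariant_sequence_exact₁ (ModuleCat.of R B) hse b
      ((ext_smul_right x b).trans (ext_smul_eq_zero_left x (hB x (by simp)) b)) rfl
    refine ⟨b', ?_⟩
    have h0 : (e - (Ext.mk₀ (ModuleCat.ofHom f)).comp b' (zero_add _)).comp hse.extClass rfl = 0 := by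
      rw [sub_eq_add_neg, Ext.add_comp, Ext.neg_comp, ← sub_eq_add_neg, ← hb, ← hb', sub_eq_zero]
      exact (Ext.comp_assoc _ _ _ _ _ (by simp)).symm
    obtain ⟨c, hc⟩ := Ext.covariant_sequence_exact₃ (ModuleCat.of R A) hse _ rfl h0
    have : c = 0 := (EV.kill_list (N := N) (x :: xs) hA (by rw [isWeaklyRegular_cons_iff]; exact hN) (by simp)).eq_zero c
    rw [this, Ext.zero_comp] at hc
    exact (sub_eq_zero.1 hc.symm).symm

theorem EV.nak_cov_list [IsLocalRing R] [IsNoetherianRing R] [Module.Finite R A] [Module.Finite R N] (xs : List R)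
    (hx : ∀ x ∈ xs, x ∈ maximalIdeal R) (hN : IsWeaklyRegular N xs) {ρ : N →ₗ[R] N'}
    (hρ : Red (Ideal.ofList xs) ρ) {i : ℕ} (h : EV R A N' i) : EV R A N i := by
  induction xs generalizing N with
  | nil =>
    have hk : LinearMap.ker ρ = ⊥ := by rw [hρ.ker]; simp
    exact h.of_iso' (LinearEquiv.ofBijective ρ ⟨LinearMap.ker_eq_bot.1 hk, hρ.surj⟩).symm
  | cons x xs ih =>
    rw [isWeaklyRegular_cons_iff] at hN
    rw [Ideal.ofList_cons] at hρ
    obtain ⟨σ, hσ, rfl⟩ := (Red.mkQ_elt x N).factor hρ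
    have s := qs hN.1
    exact EV.nak_cov (hx x (by simp)) hN.1 s.ex s.surj (ih (fun y hy => hx y (by simp [hy])) hN.2 hσ)

section SS
variable {xs : List R}

variable [Module (R ⧸ Ideal.ofList xs) A'] [IsScalarTower R (R ⧸ Ideal.ofList xs) A'] [Module (R ⧸ Ideal.ofList xs) N'] [IsScalarTower R (R ⧸ Ideal.ofList xs) N'] [Module (R ⧸ Ideal.ofList xs) B'] [IsScalarTower R (R ⧸ Ideal.ofList xs) B']

theorem sS : Function.Surjective (algebraMap R (R ⧸ Ideal.ofList xs)) := Ideal.Quotient.mk_surjective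
theorem iS : ∀ r ∈ Ideal.ofList xs, algebraMap R (R ⧸ Ideal.ofList xs) r = 0 := fun _ hr => Ideal.Quotient.eq_zero_iff_mem.2 hr

theorem Red.quotRing : Red (Ideal.ofList xs) (Algebra.linearMap R (R ⧸ Ideal.ofList xs)) :=
  ⟨sS, by ext r; simp [Ideal.Quotient.eq_zero_iff_mem]⟩

theorem Red.pi (n : ℕ) : ∃ ρ : (Fin n → R) →ₗ[R] (Fin n → (R ⧸ Ideal.ofList xs)), Red (Ideal.ofList xs) ρ := by
  let ρ : (Fin n → R) →ₗ[R] (Fin n → (R ⧸ Ideal.ofList xs)) := LinearMap.pi fun i => Algebra.linearMap R (R ⧸ Ideal.ofList xs) ∘ₗ LinearMap.proj i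
  refine ⟨ρ, ⟨fun v => ?_, ?_⟩⟩
  · choose w hw using fun i => sS (xs := xs) (v i)
    exact ⟨w, funext hw⟩
  · apply le_antisymm
    · intro v hv
      have h2 : ∀ i, v i ∈ Ideal.ofList xs := fun i => Ideal.Quotient.eq_zero_iff_mem.1 (congrFun (LinearMap.mem_ker.1 hv) i)
      have : v = ∑ i, v i • (Pi.single i 1 : Fin n → R) := by
        ext j; simp [Finset.sum_apply, Pi.single_apply]
      rw [this]
      exact Submodule.sum_mem _ fun i _ => Submodule.smul_mem_smul (h2 i) trivial
    · rw [Submodule.smul_le]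
      intro r hr v _
      rw [LinearMap.mem_ker]
      ext i
      simp only [ρ, LinearMap.pi_apply, LinearMap.comp_apply, LinearMap.proj_apply, Pi.smul_apply, Pi.zero_apply]
      exact Ideal.Quotient.eq_zero_iff_mem.2 (Ideal.mul_mem_right _ _ hr)

theorem Red.ses {C C' : Type u} [AddCommGroup C] [Module R C] [AddCommGroup C'] [Module R C'] [Module (R ⧸ Ideal.ofList xs) C'] [IsScalarTower R (R ⧸ Ideal.ofList xs) C']
    {f : A →ₗ[R] B} {g : B →ₗ[R] C} (h : SES f g) (hC : IsWeaklyRegular C xs)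
    {π : A →ₗ[R] A'} (hπ : Red (Ideal.ofList xs) π) {ρ : B →ₗ[R] B'} (hρ : Red (Ideal.ofList xs) ρ)
    {σ : C →ₗ[R] C'} (hσ : Red (Ideal.ofList xs) σ) :
    ∃ (f' : A' →ₗ[(R ⧸ Ideal.ofList xs)] B') (g' : B' →ₗ[(R ⧸ Ideal.ofList xs)] C'), SES f' g' ∧ (∀ a, f' (π a) = ρ (f a)) ∧ ∀ b, g' (ρ b) = σ (g b) := by
  obtain ⟨f', hf'⟩ := hπ.lift sS iS (ρ ∘ₗ f)
  obtain ⟨g', hg'⟩ := hρ.lift sS iS (σ ∘ₗ g)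
  simp only [LinearMap.comp_apply] at hf' hg'
  refine ⟨f', g', ⟨?_, ?_, ?_⟩, hf', hg'⟩
  · rw [injective_iff_map_eq_zero]
    intro a ha
    obtain ⟨a, rfl⟩ := hπ.surj a
    rw [hf', ← LinearMap.mem_ker, hρ.ker] at ha
    rw [← LinearMap.mem_ker, hπ.ker]
    exact h.tor xs hC ha
  · intro b
    obtain ⟨b, rfl⟩ := hρ.surj b
    constructor
    · intro hb
      rw [hg', ← LinearMap.mem_ker, hσ.ker, ← LinearMap.range_eq_top.2 h.surj, ← Submodule.map_top, ← Submodule.map_smul''] at hb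
      obtain ⟨c, hc, hcb⟩ := hb
      obtain ⟨a, ha⟩ := (h.ex (b - c)).1 (by rw [map_sub, hcb, sub_self])
      refine ⟨π a, ?_⟩
      rw [hf', ha, map_sub, sub_eq_self]
      rw [SetLike.mem_coe, ← hρ.ker] at hc
      exact hc
    · rintro ⟨a, ha⟩
      obtain ⟨a, rfl⟩ := hπ.surj a
      rw [← ha, hf', hg', (h.ex _).2 ⟨a, rfl⟩, map_zero]
  · intro c
    obtain ⟨c, rfl⟩ := hσ.surj c
    obtain ⟨b, rfl⟩ := h.surj c
    exact ⟨ρ b, hg' b⟩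

theorem Red.ev_zero {K K' F F' : Type u} [AddCommGroup K] [Module R K] [AddCommGroup F] [Module R F]
    [AddCommGroup K'] [Module R K'] [Module (R ⧸ Ideal.ofList xs) K'] [IsScalarTower R (R ⧸ Ideal.ofList xs) K']
    [AddCommGroup F'] [Module R F'] [Module (R ⧸ Ideal.ofList xs) F'] [IsScalarTower R (R ⧸ Ideal.ofList xs) F']
    [Module.Projective R F] [Module.Projective (R ⧸ Ideal.ofList xs) F']
    {τ : K →ₗ[R] K'} (hτ : Red (Ideal.ofList xs) τ) {ρ : F →ₗ[R] F'} (hρ : Red (Ideal.ofList xs) ρ)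
    {f : K →ₗ[R] F} {g : F →ₗ[R] A} (s : SES f g) {f' : K' →ₗ[R ⧸ Ideal.ofList xs] F'}
    {g' : F' →ₗ[R ⧸ Ideal.ofList xs] A'} (s' : SES f' g') (hf' : ∀ a, f' (τ a) = ρ (f a)) :
    EV R A B' (0+1) ↔ EV (R ⧸ Ideal.ofList xs) A' B' (0+1) := by
  constructor
  · intro h
    refine EV.con3_of_extend s'.inj s'.ex s'.surj (EV.proj 0) fun φ => ?_
    obtain ⟨ψ, hψ⟩ := EV.extend s.inj s.ex s.surj h (φ.restrictScalars R ∘ₗ τ)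
    obtain ⟨ψ', hψ'⟩ := hρ.lift sS iS ψ
    refine ⟨ψ', ?_⟩
    ext a
    obtain ⟨a, rfl⟩ := hτ.surj a
    rw [LinearMap.comp_apply, hf', hψ']
    exact LinearMap.congr_fun hψ a
  · intro h
    refine EV.con3_of_extend s.inj s.ex s.surj (EV.proj 0) fun φ => ?_
    obtain ⟨φ', hφ'⟩ := hτ.lift sS iS φ
    obtain ⟨ψ, hψ⟩ := EV.extend s'.inj s'.ex s'.surj h φ'
    refine ⟨ψ.restrictScalars R ∘ₗ ρ, ?_⟩
    ext a
    have h1 := LinearMap.congr_fun hψ (τ a)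
    rw [LinearMap.comp_apply, hf', hφ'] at h1
    exact h1

theorem Red.ev [IsNoetherianRing R] (hR : IsWeaklyRegular R xs) (i : ℕ) : ∀ {A A' : Type u} [AddCommGroup A] [Module R A]
    [AddCommGroup A'] [Module R A'] [Module (R ⧸ Ideal.ofList xs) A'] [IsScalarTower R (R ⧸ Ideal.ofList xs) A'] [Module.Finite R A]
    {π : A →ₗ[R] A'} (_ : Red (Ideal.ofList xs) π) (_ : IsWeaklyRegular A xs),
    EV R A B' (i+1) ↔ EV (R ⧸ Ideal.ofList xs) A' B' (i+1) := by
  induction i with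
  | zero =>
    intro A A' _ _ _ _ _ _ _ π hπ hA
    obtain ⟨n, g, hg, hx, hK⟩ := exists_syz (R := R) A
    have s : SES (LinearMap.ker g).subtype g := ⟨Subtype.val_injective, hx, hg⟩
    obtain ⟨ρ, hρ⟩ := Red.pi (xs := xs) n
    have hτ := Red.mkQ (Ideal.ofList xs) (LinearMap.ker g)
    obtain ⟨f', g', s', hf', hg'⟩ := Red.ses s hA hτ hρ hπ
    exact Red.ev_zero hτ hρ s s' hf'
  | succ i ih =>
    intro A A' _ _ _ _ _ _ _ π hπ hA
    obtain ⟨n, g, hg, hx, hK⟩ := exists_syz (R := R) A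
    have s : SES (LinearMap.ker g).subtype g := ⟨Subtype.val_injective, hx, hg⟩
    obtain ⟨ρ, hρ⟩ := Red.pi (xs := xs) n
    have hτ := Red.mkQ (Ideal.ofList xs) (LinearMap.ker g)
    obtain ⟨f', g', s', hf', hg'⟩ := Red.ses s hA hτ hρ hπ
    have := ih (A := LinearMap.ker g) hτ (s.wreg xs (wreg_pi hR n) hA)
    constructor
    · intro h
      exact EV.con3 s'.inj s'.ex s'.surj (this.1 (EV.con1 s.inj s.ex s.surj (EV.proj _) h)) (EV.proj _)
    · intro h
      exact EV.con3 s.inj s.ex s.surj (this.2 (EV.con1 s'.inj s'.ex s'.surj (EV.proj _) h)) (EV.proj _)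

theorem kill_of_S (x : R) (hx : x ∈ xs) (a : A') : x • a = 0 := by
  rw [← algebraMap_smul (R ⧸ Ideal.ofList xs) x, iS x (Ideal.subset_span hx), zero_smul]

theorem inj_red {ω : Type u} [AddCommGroup ω] [Module R ω] (hw : IsWeaklyRegular ω xs) (hid : ID R ω xs.length)
    {ρ : ω →ₗ[R] N'} (hρ : Red (Ideal.ofList xs) ρ) : Module.Injective (R ⧸ Ideal.ofList xs) N' := by
  refine inj_of_EV fun J => ?_
  have s : SES (Submodule.subtype J) (Submodule.mkQ J) :=
    ⟨Subtype.val_injective, by rw [LinearMap.exact_iff]; simp, Submodule.mkQ_surjective _⟩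
  refine EV.con3_of_extend s.inj s.ex s.surj (EV.proj 0) fun φ => ?_
  have s' : SES ((Submodule.subtype J).restrictScalars R) ((Submodule.mkQ J).restrictScalars R) := ⟨s.inj, s.ex, s.surj⟩
  obtain ⟨ψ, hψ⟩ := ext_red xs (fun x hx => kill_of_S (xs := xs) x hx) (fun x hx => kill_of_S (xs := xs) x hx)
    ((Submodule.subtype J).restrictScalars R) hρ hw (fun e => by
      obtain ⟨b, hb⟩ := Ext.contravariant_sequence_exact₁ (SC_se s'.inj s'.ex s'.surj) (ModuleCat.of R ω) e (add_comm 1 _)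
        ((hid _ _ (by omega)).eq_zero _)
      exact ⟨b, hb⟩) (φ.restrictScalars R)
  obtain ⟨ψ', hψ'⟩ := slin (sS (xs := xs)) ψ
  refine ⟨ψ', ?_⟩
  ext a
  rw [LinearMap.comp_apply, hψ']
  exact LinearMap.congr_fun hψ a

theorem Red.fin [Module.Finite R A] {π : A →ₗ[R] A'} (hπ : Red (Ideal.ofList xs) π) : Module.Finite (R ⧸ Ideal.ofList xs) A' := by
  have : Module.Finite R A' := Module.Finite.of_surjective π hπ.surj
  exact Module.Finite.of_restrictScalars_finite R (R ⧸ Ideal.ofList xs) A'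

theorem sdual_red {ω : Type u} [AddCommGroup ω] [Module R ω] (hω : Sdual R ω) (hw : IsWeaklyRegular ω xs) (hid : ID R ω xs.length)
    {ρ : ω →ₗ[R] N'} (hρ : Red (Ideal.ofList xs) ρ) : Sdual (R ⧸ Ideal.ofList xs) N' := by
  have := hω.fin
  have hfin := hρ.fin
  refine ⟨hfin, fun i => EV.inj (inj_red hw hid hρ) i, ?_⟩
  obtain ⟨β, hβ, h⟩ := Red.hom xs sS iS hρ hρ hw hω.ev
  refine Red.bij (Red.quotRing (xs := xs)) hβ ?_ hω.bij
  intro r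
  ext n
  obtain ⟨n, rfl⟩ := hρ.surj n
  rw [h]
  exact (algebraMap_smul (R ⧸ Ideal.ofList xs) r (ρ n)).trans (map_smul ρ r n).symm

theorem TR.red [IsNoetherianRing R] (hR : IsWeaklyRegular R xs) (hA : TR R A) (hw : IsWeaklyRegular A xs)
    {π : A →ₗ[R] A'} (hπ : Red (Ideal.ofList xs) π) : TR (R ⧸ Ideal.ofList xs) A' := by
  have := hA.fin
  have hfin := hπ.fin
  obtain ⟨β, hβ, h⟩ := Red.hom xs sS iS hπ (Red.quotRing (xs := xs)) hR hA.ev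
  have h1 := Red.homR xs (Red.quotRing (xs := xs)) hR hA.ev
  obtain ⟨γ, hγ, h'⟩ := Red.hom xs sS iS hβ (Red.quotRing (xs := xs)) hR hA.ev'
  have h2 := Red.homR xs (Red.quotRing (xs := xs)) hR hA.ev'
  refine ⟨hfin, fun i => (Red.ev hR i hπ hw).1 (h1.2.2 i), fun i => (Red.ev hR i hβ h1.2.1).1 (h2.2.2 i), ?_⟩
  refine Red.bij hπ hγ ?_ hA.bij
  intro a
  ext f
  obtain ⟨f, rfl⟩ := hβ.surj f
  rw [h', evd_apply, evd_apply, h]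

theorem TR.of_red [IsLocalRing R] [IsNoetherianRing R] [Module.Finite R A] (hx : ∀ x ∈ xs, x ∈ maximalIdeal R)
    (hR : IsWeaklyRegular R xs) (hw : IsWeaklyRegular A xs)
    {π : A →ₗ[R] A'} (hπ : Red (Ideal.ofList xs) π) (hA : TR (R ⧸ Ideal.ofList xs) A') : TR R A := by
  have e1 : ∀ i, EV R A R (i+1) := fun i => EV.nak_cov_list xs hx hR (Red.quotRing (xs := xs)) ((Red.ev hR i hπ hw).2 (hA.ev i))
  obtain ⟨β, hβ, h⟩ := Red.hom xs sS iS hπ (Red.quotRing (xs := xs)) hR e1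
  have h1 := Red.homR xs (Red.quotRing (xs := xs)) hR e1
  have e2 : ∀ i, EV R (A →ₗ[R] R) R (i+1) := fun i =>
    EV.nak_cov_list xs hx hR (Red.quotRing (xs := xs)) ((Red.ev hR i hβ h1.2.1).2 (hA.ev' i))
  obtain ⟨γ, hγ, h'⟩ := Red.hom xs sS iS hβ (Red.quotRing (xs := xs)) hR e2
  have h2 := Red.homR xs (Red.quotRing (xs := xs)) hR e2
  refine ⟨inferInstance, e1, e2, ?_⟩
  refine Red.bij_conv xs hx hπ hγ h2.2.1 ?_ hA.bij
  intro a
  ext f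
  obtain ⟨f, rfl⟩ := hβ.surj f
  rw [h', evd_apply, evd_apply, h]

end SS

end GGX


namespace GGX

open CategoryTheory CategoryTheory.Abelian RingTheory.Sequence IsLocalRing
open scoped Pointwise

variable {R : Type u} [CommRing R]
variable {A B N A' B' N' W V : Type u}
  [AddCommGroup A] [Module R A] [AddCommGroup B] [Module R B]
  [AddCommGroup N] [Module R N] [AddCommGroup W] [Module R W]

theorem idLE_ID {n : ℕ} (h : GG.idLE R N n) : ID R N n := by
  induction n generalizing N with
  | zero =>
    obtain ⟨G, d, ε, h1, h2, h3, h4, h5⟩ := h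
    have hd : d 0 = 0 := by ext x; exact h5 1 (by omega) _
    rw [hd, LinearMap.ker_zero] at h3
    exact ID.zero (inj_of_equiv (LinearEquiv.ofBijective ε ⟨h2, LinearMap.range_eq_top.1 h3⟩).symm (h1 0))
  | succ n ih =>
    obtain ⟨G, d, ε, h1, h2, h3, h4, h5⟩ := h
    refine ID.succ (f := ε) (g := (d 0).rangeRestrict) h2 ?_ (LinearMap.surjective_rangeRestrict _)
      ((ID.zero (h1 0)).mono (by omega))
      (ih ⟨fun i => G (i+1), fun i => d (i+1),
        (LinearMap.range (d 0)).subtype, fun i => h1 _, Subtype.val_injective, ?_, fun i => h4 _, fun i hi => h5 _ (by omega)⟩)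
    · rw [LinearMap.exact_iff, LinearMap.ker_rangeRestrict, h3]
    · rw [Submodule.range_subtype]; exact h4 0

section CH
variable {S : Type u} [CommRing S] [Algebra R S] [AddCommGroup V] [Module S V]

theorem EV.change [IsNoetherianRing S] (c : ℕ) (hfree : ∀ j, EV R S W (c+j+1))
    (base : ∀ (A : Type u) [AddCommGroup A] [Module S A] [Module R A] [IsScalarTower R S A] [Module.Finite S A],
      EV R A W (c+1) → EV S A V 1) (i : ℕ) : ∀ (A : Type u) [AddCommGroup A] [Module S A] [Module R A]
      [IsScalarTower R S A] [Module.Finite S A], EV R A W (c+i+1) → EV S A V (i+1) := by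
  induction i with
  | zero => intro A _ _ _ _ _ h; exact base A h
  | succ i ih =>
    intro A _ _ _ _ _ h
    obtain ⟨n, g, hg, hx, hK⟩ := exists_syz (R := S) A
    have := ih (LinearMap.ker g) (by
      refine EV.con1 (f := (LinearMap.ker g).subtype.restrictScalars R) (g := g.restrictScalars R)
        Subtype.val_injective hx hg (EV.pi_fin_left (hfree i) n) h)
    exact EV.con3 Subtype.val_injective hx hg this (EV.proj _)

end CH

section CR
variable {xs : List R} [AddCommGroup N'] [Module R N']
variable [Module (R ⧸ Ideal.ofList xs) N'] [IsScalarTower R (R ⧸ Ideal.ofList xs) N']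

theorem ID_red [IsNoetherianRing R] (hR : IsWeaklyRegular R xs) (hw : IsWeaklyRegular N xs) {n : ℕ} (hid : ID R N (xs.length + n))
    {ρ : N →ₗ[R] N'} (hρ : Red (Ideal.ofList xs) ρ) : ID (R ⧸ Ideal.ofList xs) N' n := by
  refine ID_of_EV fun J => ?_
  refine EV.change (R := R) (W := N) xs.length ?_ ?_ n _ (hid _ _ (by omega))
  · intro j
    have e := Red.equiv (S := R) (Function.surjective_id) (Red.mkQ (Ideal.ofList xs) R) (Red.quotRing (xs := xs))
    exact (EV.pd_ring (W := N) xs hR (xs.length + j + 1) (by omega)).of_iso e.some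
  · intro A _ _ _ _ _ h
    obtain ⟨n, g, hg, hx, hK⟩ := exists_syz (R := R ⧸ Ideal.ofList xs) A
    refine EV.con3_of_extend Subtype.val_injective hx hg (EV.proj 0) fun φ => ?_
    have s' : SES ((LinearMap.ker g).subtype.restrictScalars R) (g.restrictScalars R) := ⟨Subtype.val_injective, hx, hg⟩
    obtain ⟨ψ, hψ⟩ := ext_red xs (fun x hx => kill_of_S (xs := xs) x hx) (fun x hx => kill_of_S (xs := xs) x hx)
      ((LinearMap.ker g).subtype.restrictScalars R) hρ hw (fun e => by
        obtain ⟨b, hb⟩ := Ext.contravariant_sequence_exact₁ (SC_se s'.inj s'.ex s'.surj) (ModuleCat.of R N) e (add_comm 1 _)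
          (h.eq_zero _)
        exact ⟨b, hb⟩) (φ.restrictScalars R)
    obtain ⟨ψ', hψ'⟩ := slin (sS (xs := xs)) ψ
    refine ⟨ψ', ?_⟩
    ext a
    rw [LinearMap.comp_apply, hψ']
    exact LinearMap.congr_fun hψ a

end CR

end GGX


namespace GGX

open CategoryTheory CategoryTheory.Abelian RingTheory.Sequence IsLocalRing
open scoped Pointwise

/-- coinduced module -/
def CoHom (Q S : Type u) [CommRing Q] [CommRing S] [Algebra Q S] : Type u := S →ₗ[Q] Q

section CoHom
variable (Q S : Type u) [CommRing Q] [CommRing S] [Algebra Q S]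

noncomputable instance : AddCommGroup (CoHom Q S) := inferInstanceAs (AddCommGroup (S →ₗ[Q] Q))
noncomputable instance : Module Q (CoHom Q S) := inferInstanceAs (Module Q (S →ₗ[Q] Q))
noncomputable instance : SMul S (CoHom Q S) := ⟨fun s f => (show S →ₗ[Q] Q from f) ∘ₗ LinearMap.mulLeft Q s⟩

/-- identity -/
noncomputable def CoHom.toHom : CoHom Q S ≃ₗ[Q] (S →ₗ[Q] Q) := LinearEquiv.refl _ _

variable {Q S}

theorem CoHom.ext' {f g : CoHom Q S} (h : ∀ t, CoHom.toHom Q S f t = CoHom.toHom Q S g t) : f = g :=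
  (CoHom.toHom Q S).injective (LinearMap.ext h)

theorem CoHom.smul_apply (s : S) (f : CoHom Q S) (t : S) : CoHom.toHom Q S (s • f) t = CoHom.toHom Q S f (s * t) := rfl

noncomputable instance : Module S (CoHom Q S) where
  one_smul f := CoHom.ext' fun t => by rw [CoHom.smul_apply, one_mul]
  mul_smul r s f := CoHom.ext' fun t => by rw [CoHom.smul_apply, CoHom.smul_apply, CoHom.smul_apply]; congr 1; ring
  smul_zero r := CoHom.ext' fun t => by rw [CoHom.smul_apply]; simp
  smul_add r f g := CoHom.ext' fun t => by rw [CoHom.smul_apply]; simp [CoHom.smul_apply]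
  add_smul r s f := CoHom.ext' fun t => by rw [CoHom.smul_apply, add_mul]; simp [CoHom.smul_apply]
  zero_smul f := CoHom.ext' fun t => by rw [CoHom.smul_apply]; simp

instance : IsScalarTower Q S (CoHom Q S) := IsScalarTower.of_algebraMap_smul fun q f => CoHom.ext' fun t => by
  rw [CoHom.smul_apply, ← Algebra.smul_def]; simp

/-- adjunction -/
noncomputable def CoHom.adj {A : Type u} [AddCommGroup A] [Module S A] [Module Q A] [IsScalarTower Q S A] (ψ : A →ₗ[Q] Q) :
    A →ₗ[S] CoHom Q S where
  toFun a := (CoHom.toHom Q S).symm (ψ ∘ₗ (LinearMap.toSpanSingleton S A a).restrictScalars Q)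
  map_add' a b := CoHom.ext' fun t => by simp
  map_smul' s a := CoHom.ext' fun t => by
    rw [RingHom.id_apply, CoHom.smul_apply]
    change ψ (t • s • a) = ψ ((s * t) • a)
    rw [smul_smul, mul_comm]

theorem CoHom.adj_apply {A : Type u} [AddCommGroup A] [Module S A] [Module Q A] [IsScalarTower Q S A] (ψ : A →ₗ[Q] Q) (a : A) (t : S) :
    CoHom.toHom Q S (CoHom.adj ψ a) t = ψ (t • a) := rfl

/-- evaluation at one -/
noncomputable def CoHom.ev1 {A : Type u} [AddCommGroup A] [Module S A] [Module Q A] [IsScalarTower Q S A] (f : A →ₗ[S] CoHom Q S) :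
    A →ₗ[Q] Q where
  toFun a := CoHom.toHom Q S (f a) 1
  map_add' a b := by simp
  map_smul' s a := by
    rw [← algebraMap_smul S s a, map_smul, CoHom.smul_apply, mul_one, ← mul_one (algebraMap Q S s), ← Algebra.smul_def,
      map_smul, RingHom.id_apply]

theorem CoHom.ev1_apply {A : Type u} [AddCommGroup A] [Module S A] [Module Q A] [IsScalarTower Q S A] (f : A →ₗ[S] CoHom Q S) (a : A) (t : S) :
    CoHom.toHom Q S (f a) t = CoHom.ev1 f (t • a) := by
  change _ = CoHom.toHom Q S (f (t • a)) 1
  rw [map_smul, CoHom.smul_apply, mul_one]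

theorem CoHom.ev [IsNoetherianRing S] (hfree : ∀ j, EV Q S Q (j+1)) (i : ℕ) (A : Type u) [AddCommGroup A] [Module S A] [Module Q A]
      [IsScalarTower Q S A] [Module.Finite S A] (h : EV Q A Q (i+1)) : EV S A (CoHom Q S) (i+1) := by
  refine EV.change (R := Q) (W := Q) 0 (fun j => by rw [zero_add]; exact hfree j) ?_ i A (by rw [zero_add]; exact h)
  intro A _ _ _ _ _ h
  obtain ⟨n, g, hg, hx, hK⟩ := exists_syz (R := S) A
  refine EV.con3_of_extend Subtype.val_injective hx hg (EV.proj 0) fun φ => ?_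
  obtain ⟨ψ, hψ⟩ := EV.extend (f := (LinearMap.ker g).subtype.restrictScalars Q) (g := g.restrictScalars Q)
     Subtype.val_injective hx hg h (CoHom.ev1 φ)
  refine ⟨CoHom.adj ψ, ?_⟩
  ext a
  refine CoHom.ext' fun t => ?_
  rw [LinearMap.comp_apply, CoHom.adj_apply, CoHom.ev1_apply]
  exact LinearMap.congr_fun hψ (t • a)

end CoHom

theorem sdual_CoHom {Q S : Type u} [CommRing Q] [CommRing S] [Algebra Q S] [IsNoetherianRing Q] [IsNoetherianRing S]
    (hf : Module.Finite Q S) (h : Ref Q Q S) : Sdual S (CoHom Q S) := by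
  have h1 : Module.Finite Q (CoHom Q S) := inferInstanceAs (Module.Finite Q (S →ₗ[Q] Q))
  have h2 : Module.Finite S (CoHom Q S) := Module.Finite.of_restrictScalars_finite Q S _
  refine ⟨h2, fun i => CoHom.ev h.ev i (CoHom Q S) (h.ev' i), ?_, ?_⟩
  · intro a b hab
    apply h.bij.1
    ext f
    have := congrArg (fun φ => CoHom.toHom Q S (φ ((CoHom.toHom Q S).symm f)) 1) hab
    change CoHom.toHom Q S ((CoHom.toHom Q S).symm f) (a * 1) = CoHom.toHom Q S ((CoHom.toHom Q S).symm f) (b * 1) at this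
    simpa [evd_apply] using this
  · intro φ
    have ⟨ψ, hψ⟩ : ∃ ψ : CoHom Q S →ₗ[Q] Q, ψ = CoHom.ev1 φ := ⟨_, rfl⟩
    obtain ⟨s, hs⟩ := h.bij.2 ψ
    refine ⟨s, ?_⟩
    ext f
    refine CoHom.ext' fun t => ?_
    rw [CoHom.ev1_apply φ, ← hψ, ← hs]
    change CoHom.toHom Q S f (s * t) = CoHom.toHom Q S (t • f) s
    rw [CoHom.smul_apply, mul_comm]

end GGX


namespace GGX

open CategoryTheory CategoryTheory.Abelian RingTheory.Sequence IsLocalRing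
open scoped Pointwise

section
variable {Q S : Type u} [CommRing Q] [CommRing S] [Algebra Q S]

theorem coheight_le_surj (hs : Function.Surjective (algebraMap Q S)) (p : PrimeSpectrum Q)
    (hp : RingHom.ker (algebraMap Q S) ≤ p.asIdeal) {d : ℕ} (hd : ringKrullDim S ≤ d) : Order.coheight p ≤ d := by
  have h : ∀ q : Set.Ici p, (Ideal.map (algebraMap Q S) q.1.asIdeal).IsPrime := fun q =>
    Ideal.map_isPrime_of_surjective hs (hp.trans q.2)
  let F : Set.Ici p → PrimeSpectrum S := fun q => ⟨_, h q⟩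
  have hF : StrictMono F := by
    refine Monotone.strictMono_of_injective (fun a b hab => Ideal.map_mono hab) ?_
    intro a b hab
    have h1 := congrArg (fun q => Ideal.comap (algebraMap Q S) q.asIdeal) hab
    simp only [F] at h1
    rw [Ideal.comap_map_of_surjective' _ hs, Ideal.comap_map_of_surjective' _ hs, sup_of_le_left (hp.trans a.2),
      sup_of_le_left (hp.trans b.2)] at h1
    exact Subtype.ext (PrimeSpectrum.ext h1)
  have := (Order.krullDim_le_of_strictMono F hF).trans hd
  rw [← Order.coheight_eq_krullDim_Ici] at this
  exact_mod_cast this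

variable [IsLocalRing Q] [IsLocalRing S] [IsNoetherianRing Q] [IsNoetherianRing S]

theorem map_max (hs : Function.Surjective (algebraMap Q S)) (x : Q) : algebraMap Q S x ∈ maximalIdeal S ↔ x ∈ maximalIdeal Q := by
  have := hs.isLocalHom (f := algebraMap Q S)
  simp [mem_maximalIdeal]

theorem omega_of_gor (hs : Function.Surjective (algebraMap Q S)) {m : ℕ} (hid : ID Q Q m)
    (hno : ∀ x ∈ RingHom.ker (algebraMap Q S), ¬ IsSMulRegular Q x) {d : ℕ} (hd : ringKrullDim S ≤ d)
    (zs : List S) (hz : ∀ z ∈ zs, z ∈ maximalIdeal S) (hzr : IsWeaklyRegular S zs) (hzl : zs.length = d) :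
    ∃ ω : ModuleCat.{u} S, Sdual S ω ∧ ID S ω d ∧ Dp S ω d := by
  have hf : Module.Finite Q S := Module.Finite.of_surjective (Algebra.linearMap Q S) hs
  obtain ⟨ys, hy, hreg, hk⟩ := exists_max_reg (R := Q) (N := Q)
  have hD := Dp.of_reg ys hy hreg.toIsWeaklyRegular
  have hg : ys.length ≤ d := by
    by_contra hlt
    have hev : ∀ p : PrimeSpectrum Q, RingHom.ker (algebraMap Q S) ≤ p.asIdeal → EV Q (Q ⧸ p.asIdeal) Q 0 := fun p hp =>
      isch_coh hD d p (coheight_le_surj hs p hp hd) (by omega)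
    have h0 := EV.pf' _ hev
    rw [EV.zero_iff] at h0
    have := (IsSMulRegular.subsingleton_linearMap_iff).1 h0
    obtain ⟨x, hx, hx'⟩ := this
    rw [Ideal.annihilator_quotient] at hx
    exact hno x hx hx'
  have hidd : ID Q Q d := bass_bound' hid ys hreg.toIsWeaklyRegular hk hg
  obtain ⟨ws, rfl⟩ : ∃ ws : List Q, ws.map (algebraMap Q S) = zs := List.map_surjective_iff.2 hs zs
  have hw : ∀ w ∈ ws, w ∈ maximalIdeal Q := fun w hw => (map_max hs w).1 (hz _ (List.mem_map_of_mem hw))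
  rw [isWeaklyRegular_map_algebraMap_iff] at hzr
  rw [List.length_map] at hzl
  have hev : ∀ i, EV Q S Q (i+1) := EV.mcm ws hw hzr (hzl ▸ hidd)
  have href : Ref Q Q S := Ref.of_ID Sdual.self hidd hev
  have hge : d ≤ ys.length := by
    by_contra hlt
    have h1 : ID Q Q ys.length := bass_bound' hid ys hreg.toIsWeaklyRegular hk le_rfl
    have h2 : EV Q S Q 0 := EV.nak_list ws hw hzr (h1 _ _ (by omega))
    rw [EV.zero_iff] at h2
    have h3 : Subsingleton ((S →ₗ[Q] Q) →ₗ[Q] Q) := inferInstance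
    have h4 : Subsingleton S := href.bij.1.subsingleton
    exact not_subsingleton S h4
  have hDS := Dp.of_reg ws hw hzr
  obtain ⟨vs, hvl, hv, hvr⟩ : ∃ vs : List Q, vs.length = d ∧ (∀ x ∈ vs, x ∈ maximalIdeal Q) ∧ IsWeaklyRegular Q vs :=
    Dp.exists_seq (hD.mono hge)
  have h5 := (Red.homR (A := S) vs (Red.mkQ _ Q) hvr hev).2.1
  refine ⟨ModuleCat.of S (CoHom Q S), sdual_CoHom hf href, ?_, ?_⟩
  · refine ID_of_EV fun J => ?_
    exact CoHom.ev hev d (S ⧸ J) (hidd _ _ (by omega))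
  · have h6 : IsWeaklyRegular (CoHom Q S) (vs.map (algebraMap Q S)) := by
      rw [isWeaklyRegular_map_algebraMap_iff]; exact h5
    have := Dp.of_reg (vs.map (algebraMap Q S)) (by
      intro x hx
      obtain ⟨y, hy, rfl⟩ := List.mem_map.1 hx
      exact (map_max hs y).2 (hv y hy)) h6
    rwa [List.length_map, hvl] at this

end

end GGX


namespace GGX

open CategoryTheory CategoryTheory.Abelian RingTheory.Sequence IsLocalRing
open scoped Pointwise

theorem exists_max_in {G : Type u} [CommRing G] [IsLocalRing G] [IsNoetherianRing G] (I : Ideal G) (hI : I ≤ maximalIdeal G) :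
    ∃ ys : List G, (∀ y ∈ ys, y ∈ I) ∧ IsWeaklyRegular G ys ∧
      ∀ x ∈ I, ¬ IsSMulRegular (G ⧸ Ideal.ofList ys • (⊤ : Submodule G G)) x := by
  let P : ℕ → Prop := fun n => ∃ ys : List G, ys.length = n ∧ (∀ y ∈ ys, y ∈ I) ∧ IsWeaklyRegular G ys
  obtain ⟨b, hb⟩ : ∃ b : ℕ, ringKrullDim G ≤ b := by
    obtain ⟨b, hb⟩ := WithBot.ne_bot_iff_exists.1 (ringKrullDim_ne_bot (R := G))
    have h : ringKrullDim G < ⊤ := ringKrullDim_lt_top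
    rw [← hb] at h ⊢
    have : b ≠ ⊤ := by rintro rfl; exact lt_irrefl _ h
    obtain ⟨b, rfl⟩ := ENat.ne_top_iff_exists.1 this
    exact ⟨b, le_rfl⟩
  have hP : ∀ n, P n → n ≤ b := by
    rintro n ⟨ys, rfl, h1, h2⟩
    have := (reg_len_le (isReg (fun y hy => hI (h1 y hy)) h2)).trans
      ((Module.supportDim_le_ringKrullDim G G).trans hb)
    exact_mod_cast this
  have hP0 : P 0 := ⟨[], rfl, by simp, .nil G G⟩
  classical
  obtain ⟨ys, hl, h1, h2⟩ := Nat.findGreatest_spec (P := P) (n := b) (Nat.zero_le _) hP0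
  refine ⟨ys, h1, h2, fun x hx hr => ?_⟩
  have h3 : P (ys.length + 1) := ⟨ys ++ [x], by simp, by
    intro y hy
    rcases List.mem_append.1 hy with h | h
    · exact h1 y h
    · rw [List.mem_singleton.1 h]; exact hx, by
    rw [isWeaklyRegular_append_iff]
    exact ⟨h2, by rw [isWeaklyRegular_singleton_iff]; exact hr⟩⟩
  have := Nat.le_findGreatest (hP _ h3) h3
  omega

variable {R : Type u} [CommRing R] [IsLocalRing R] [IsNoetherianRing R]

theorem omega_of_gor' {G : Type u} [CommRing G] [IsLocalRing G] [IsNoetherianRing G] (φ : G →+* R)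
    (hs : Function.Surjective φ) {m : ℕ} (hid : ID G G m) {d : ℕ} (hd : ringKrullDim R ≤ d)
    (zs : List R) (hz : ∀ z ∈ zs, z ∈ maximalIdeal R) (hzr : IsWeaklyRegular R zs) (hzl : zs.length = d) :
    ∃ ω : ModuleCat.{u} R, Sdual R ω ∧ ID R ω d ∧ Dp R ω d := by
  have hk : RingHom.ker φ ≤ maximalIdeal G := le_maximalIdeal (RingHom.ker_ne_top φ)
  obtain ⟨ys, h1, h2, h3⟩ := exists_max_in (RingHom.ker φ) hk
  have hle : Ideal.ofList ys ≤ RingHom.ker φ := Ideal.span_le.2 h1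
  let ψ : (G ⧸ Ideal.ofList ys) →+* R := Ideal.Quotient.lift _ φ (fun a ha => hle ha)
  have hψ : ∀ a, ψ (Ideal.Quotient.mk _ a) = φ a := fun a => rfl
  have hψs : Function.Surjective ψ := fun r => by
    obtain ⟨a, rfl⟩ := hs r
    exact ⟨_, hψ a⟩
  have : Nontrivial (G ⧸ Ideal.ofList ys) := Ideal.Quotient.nontrivial_iff.2 (fun h => by
    rw [h, top_le_iff] at hle; exact RingHom.ker_ne_top φ hle)
  have : IsLocalRing (G ⧸ Ideal.ofList ys) := IsLocalRing.of_surjective' _ Ideal.Quotient.mk_surjective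
  have hid' : ID (G ⧸ Ideal.ofList ys) (G ⧸ Ideal.ofList ys) m :=
    ID_red h2 h2 (hid.mono (by omega)) (Red.quotRing (xs := ys))
  let _ : Algebra (G ⧸ Ideal.ofList ys) R := ψ.toAlgebra
  refine omega_of_gor (Q := G ⧸ Ideal.ofList ys) hψs hid' ?_ hd zs hz hzr hzl
  intro x hx hr
  obtain ⟨x, rfl⟩ := Ideal.Quotient.mk_surjective x
  refine h3 x hx ?_
  have e := (Red.equiv (S := G) Function.surjective_id (Red.mkQ (Ideal.ofList ys) G) (Red.quotRing (xs := ys))).some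
  rw [e.isSMulRegular_congr]
  intro a b hab
  apply hr
  change x • a = x • b at hab
  rw [← algebraMap_smul (G ⧸ Ideal.ofList ys) x a, ← algebraMap_smul (G ⧸ Ideal.ofList ys) x b] at hab
  exact hab

theorem exists_omega (hR : GG.HasDualizingComplex R) {d : ℕ} (hd : ringKrullDim R ≤ d)
    (zs : List R) (hz : ∀ z ∈ zs, z ∈ maximalIdeal R) (hzr : IsWeaklyRegular R zs) (hzl : zs.length = d) :
    ∃ ω : ModuleCat.{u} R, Sdual R ω ∧ ID R ω d ∧ Dp R ω d := by
  obtain ⟨Q, hN, _, hG, f, hf⟩ := hR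
  let P : Ideal Q := (maximalIdeal R).comap f
  have hP : P.IsPrime := Ideal.comap_isPrime f _
  obtain ⟨n, hn⟩ := hG ⟨P, hP⟩
  have hu : ∀ y : P.primeCompl, IsUnit (f y) := fun y => by
    by_contra h
    exact y.2 ((mem_maximalIdeal _).2 h)
  let φ : Localization.AtPrime P →+* R := IsLocalization.lift hu
  have hφ : Function.Surjective φ := fun r => by
    obtain ⟨q, rfl⟩ := hf r
    exact ⟨algebraMap _ _ q, IsLocalization.lift_eq hu q⟩
  have : IsNoetherianRing (Localization.AtPrime P) := IsLocalization.isNoetherianRing P.primeCompl _ hN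
  exact omega_of_gor' φ hφ (idLE_ID hn) hd zs hz hzr hzl

end GGX

namespace GGX
open CategoryTheory CategoryTheory.Abelian RingTheory.Sequence IsLocalRing
open scoped Pointwise
variable {R : Type u} [CommRing R]
variable {A B N N' W : Type u}
  [AddCommGroup A] [Module R A] [AddCommGroup B] [Module R B] [AddCommGroup N] [Module R N]
  [AddCommGroup N'] [Module R N'] [AddCommGroup W] [Module R W]

/-- Extensions from the syzygy imply vanishing, in a dimension shifting form. -/
theorem EV.shift_fam [IsNoetherianRing R] {ι : Type*} (G : ι → Type u) [∀ i, AddCommGroup (G i)]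
    [∀ i, Module R (G i)]
    (h0 : ∀ (A : Type u) [AddCommGroup A] [Module R A] [Module.Finite R A],
      (∀ j, EV R A (G j) 0) → EV R A B 0)
    (h1 : ∀ (P A : Type u) [AddCommGroup A] [Module R A] [AddCommGroup P] [Module R P]
      (f : A →ₗ[R] P) [Module.Finite R A],
      (∀ j, ∀ φ : A →ₗ[R] G j, ∃ ψ : P →ₗ[R] G j, ψ ∘ₗ f = φ) →
      ∀ φ : A →ₗ[R] B, ∃ ψ : P →ₗ[R] B, ψ ∘ₗ f = φ) (i : ℕ) :
    ∀ (A : Type u) [AddCommGroup A] [Module R A] [Module.Finite R A],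
      (∀ j, EV R A (G j) i) → EV R A B i := by
  induction i with
  | zero => exact h0
  | succ i ih =>
    intro A _ _ _ h
    obtain ⟨n, g, hg, hx, hfin⟩ := exists_syz (R := R) A
    rcases i with _ | i
    · refine EV.con3_of_extend (LinearMap.ker g).injective_subtype hx hg (EV.proj 0) ?_
      exact h1 _ _ _ fun j φ => EV.extend (LinearMap.ker g).injective_subtype hx hg (h j) φ
    · refine EV.con3 (LinearMap.ker g).injective_subtype hx hg ?_ (EV.proj _)
      refine ih _ fun j => ?_
      exact EV.con1 (LinearMap.ker g).injective_subtype hx hg (EV.proj _) (h j)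

theorem EV.finSupp [IsNoetherianRing R] (S : Set (PrimeSpectrum R)) [Module.Finite R A] {i : ℕ}
    (h : ∀ p ∈ S, EV R A (LocalizedModule p.asIdeal.primeCompl N) i) :
    EV R A (GG.finSupp R S N) i := by
  refine EV.shift_fam (fun p : S => LocalizedModule p.1.asIdeal.primeCompl N) ?_ ?_ i A
    (fun p => h p.1 p.2)
  · intro A _ _ _ h
    rw [EV.zero_iff]
    refine ⟨fun f g => ?_⟩
    ext a p
    have := EV.zero_iff.1 (h p)
    exact LinearMap.congr_fun (Subsingleton.elim
      ((LinearMap.proj p ∘ₗ (GG.finSupp R S N).subtype) ∘ₗ f)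
      ((LinearMap.proj p ∘ₗ (GG.finSupp R S N).subtype) ∘ₗ g)) a
  · intro P A _ _ _ _ f hfin h φ
    classical
    let c : ∀ p : S, A →ₗ[R] LocalizedModule p.1.asIdeal.primeCompl N := fun p =>
      (LinearMap.proj p ∘ₗ (GG.finSupp R S N).subtype) ∘ₗ φ
    have hc : {p : S | c p ≠ 0}.Finite := by
      obtain ⟨s, hs⟩ := hfin.fg_top
      refine (Set.Finite.biUnion s.finite_toSet fun a _ => (φ a).2).subset ?_
      intro p hp
      by_contra hcon
      simp only [Set.mem_iUnion, not_exists] at hcon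
      refine hp (LinearMap.ext_on hs fun a ha => ?_)
      have := hcon a ha
      simp only [Set.mem_ofPred_eq, not_not] at this
      simpa [c] using this
    choose ψ hψ using fun p => h p (c p)
    let ψ' : ∀ p : S, P →ₗ[R] LocalizedModule p.1.asIdeal.primeCompl N := fun p =>
      if c p = 0 then 0 else ψ p
    have hψ' : ∀ p, ψ' p ∘ₗ f = c p := by
      intro p
      by_cases hp : c p = 0
      · simp [ψ', hp]
      · simp [ψ', hp, hψ]
    refine ⟨LinearMap.codRestrict _ (LinearMap.pi ψ') fun x => ?_, ?_⟩
    · refine hc.subset fun p hp => ?_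
      intro h0
      exact hp (by simp [ψ', h0])
    · ext a p
      exact LinearMap.congr_fun (hψ' p) a

theorem loc_bij (S : Submonoid R) (f : N →ₗ[R] N') [IsLocalizedModule S f] (s : S) :
    Function.Bijective (fun b : N' => (s : R) • b) :=
  (Module.End.isUnit_iff _).mp (IsLocalizedModule.map_units f s)

theorem EV.loc [IsNoetherianRing R] (S : Submonoid R) (f : N →ₗ[R] N') [IsLocalizedModule S f]
    [Module.Finite R A] {i : ℕ} (h : EV R A N i) : EV R A N' i := by
  refine EV.shift_fam (fun _ : Unit => N) ?_ ?_ i A (fun _ => h)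
  · intro A _ _ _ h
    have := EV.zero_iff.1 (h ())
    rw [EV.zero_iff]
    refine subsingleton_of_forall_eq 0 fun g => ?_
    have := Module.finitePresentation_of_finite R A
    obtain ⟨k, s, hk⟩ := Module.FinitePresentation.exists_lift_of_isLocalizedModule S f g
    rw [Subsingleton.elim k 0, LinearMap.comp_zero] at hk
    ext a
    refine (loc_bij S f s).1 ?_
    simpa [Submonoid.smul_def] using (LinearMap.congr_fun hk a).symm
  · intro P A _ _ _ _ j hfin h φ
    have := Module.finitePresentation_of_finite R A
    obtain ⟨k, s, hk⟩ := Module.FinitePresentation.exists_lift_of_isLocalizedModule S f φ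
    obtain ⟨ψ, hψ⟩ := h () k
    let e := LinearEquiv.ofBijective (LinearMap.lsmul R N' (s : R)) (loc_bij S f s)
    refine ⟨e.symm.toLinearMap ∘ₗ f ∘ₗ ψ, ?_⟩
    ext a
    have h1 := LinearMap.congr_fun hk a
    have h2 := LinearMap.congr_fun hψ a
    simp only [LinearMap.comp_apply] at h1 h2
    simp only [LinearMap.comp_apply, h2, h1, LinearEquiv.coe_coe]
    rw [LinearEquiv.symm_apply_eq]
    rfl

theorem ID.loc [IsNoetherianRing R] (S : Submonoid R) (f : N →ₗ[R] N') [IsLocalizedModule S f]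
    {n : ℕ} (h : ID R N n) : ID R N' n :=
  ID_of_EV fun I => EV.loc S f (h (R ⧸ I) (n+1) (by omega))

/-- Linear maps between modules over a localization. -/
theorem loc_lin (S : Submonoid R) {A B : Type u} [AddCommGroup A] [Module R A] [AddCommGroup B]
    [Module R B] [Module (Localization S) A] [IsScalarTower R (Localization S) A]
    [Module (Localization S) B] [IsScalarTower R (Localization S) B] (f : A →ₗ[R] B) :
    ∃ g : A →ₗ[Localization S] B, ∀ a, g a = f a :=
  ⟨f.extendScalarsOfIsLocalization S (Localization S), fun _ => rfl⟩

theorem loc_inj (S : Submonoid R) {B : Type u} [AddCommGroup B] [Module R B]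
    [Module (Localization S) B] [IsScalarTower R (Localization S) B]
    (h : Module.Injective R B) : Module.Injective (Localization S) B := by
  refine ⟨fun X Y _ _ _ _ f hf g => ?_⟩
  let _ : Module R X := Module.compHom X (algebraMap R (Localization S))
  let _ : Module R Y := Module.compHom Y (algebraMap R (Localization S))
  have : IsScalarTower R (Localization S) X := IsScalarTower.of_algebraMap_smul fun _ _ => rfl
  have : IsScalarTower R (Localization S) Y := IsScalarTower.of_algebraMap_smul fun _ _ => rfl
  obtain ⟨k, hk⟩ := h.out (f.restrictScalars R) hf (g.restrictScalars R)
  obtain ⟨k', hk'⟩ := loc_lin S k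
  exact ⟨k', fun x => by rw [hk']; exact hk x⟩

theorem loc_unit (S : Submonoid R) {B : Type u} [AddCommGroup B] [Module R B]
    [Module (Localization S) B] [IsScalarTower R (Localization S) B] (s : S) :
    IsUnit (algebraMap R (Module.End R B) s) := by
  rw [Module.End.isUnit_iff]
  obtain ⟨v, hv⟩ := (IsLocalization.map_units (Localization S) s)
  have key : ∀ b : B, (algebraMap R (Module.End R B) s) b = (v : Localization S) • b := by
    intro b
    rw [hv, algebraMap_smul]; rfl
  constructor
  · intro a b hab
    rw [key, key] at hab
    have := congrArg (fun z => ((v⁻¹ : (Localization S)ˣ) : Localization S) • z) hab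
    simpa only [smul_smul, Units.inv_mul, one_smul] using this
  · intro b
    refine ⟨((v⁻¹ : (Localization S)ˣ) : Localization S) • b, ?_⟩
    rw [key, smul_smul, Units.mul_inv, one_smul]

theorem inj_loc (S : Submonoid R) {B : Type u} [AddCommGroup B] [Module R B]
    [Module (Localization S) B] [IsScalarTower R (Localization S) B]
    (h : Module.Injective (Localization S) B) : Module.Injective R B := by
  refine ⟨fun X Y _ _ _ _ f hf g => ?_⟩
  obtain ⟨F, hF'⟩ := loc_lin S (IsLocalizedModule.map S (LocalizedModule.mkLinearMap S X)
    (LocalizedModule.mkLinearMap S Y) f)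
  have hF : Function.Injective F := by
    have := IsLocalizedModule.map_injective S (LocalizedModule.mkLinearMap S X)
      (LocalizedModule.mkLinearMap S Y) f hf
    intro a b hab
    exact this (by rw [← hF', ← hF', hab])
  obtain ⟨G, hG⟩ := loc_lin S (IsLocalizedModule.lift S (LocalizedModule.mkLinearMap S X) g
    (loc_unit S))
  obtain ⟨k, hk⟩ := h.out F hF G
  refine ⟨k.restrictScalars R ∘ₗ LocalizedModule.mkLinearMap S Y, fun x => ?_⟩
  have h1 := hk (LocalizedModule.mkLinearMap S X x)
  rw [hF', hG, IsLocalizedModule.map_apply, IsLocalizedModule.lift_apply] at h1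
  exact h1

theorem ID_loc_iff (S : Submonoid R) (n : ℕ) : ∀ (B : Type u) [AddCommGroup B] [Module R B]
    [Module (Localization S) B] [IsScalarTower R (Localization S) B],
    ID R B n ↔ ID (Localization S) B n := by
  induction n with
  | zero =>
    intro B _ _ _ _
    exact ⟨fun h => ID.zero (loc_inj S h.inj), fun h => ID.zero (inj_loc S h.inj)⟩
  | succ n ih =>
    intro B _ _ _ _
    obtain ⟨I, f, hI, hf⟩ := exists_inj_embed (R := Localization S) B
    let _ : Module R I := Module.compHom I (algebraMap R (Localization S))
    have : IsScalarTower R (Localization S) I := IsScalarTower.of_algebraMap_smul fun _ _ => rfl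
    have hIR := inj_loc S hI
    have hx : Function.Exact f (LinearMap.range f).mkQ := LinearMap.exact_map_mkQ_range f
    have hs := Submodule.mkQ_surjective (LinearMap.range f)
    have hih := ih (I ⧸ LinearMap.range f)
    have hfR : Function.Injective (f.restrictScalars R) := hf
    have hxR : Function.Exact (f.restrictScalars R) ((LinearMap.range f).mkQ.restrictScalars R) := hx
    have hsR : Function.Surjective ((LinearMap.range f).mkQ.restrictScalars R) := hs
    constructor
    · intro h
      refine ID.succ hf hx hs ((ID.zero hI).mono (by omega)) (hih.1 ?_)
      exact ID.coker hfR hxR hsR ((ID.zero hIR).mono (by omega)) h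
    · intro h
      refine ID.succ hfR hxR hsR ((ID.zero hIR).mono (by omega)) (hih.2 ?_)
      exact ID.coker hf hx hs ((ID.zero hI).mono (by omega)) h

/-- The local Bass bound: `id ω_p ≤ ht p`. -/
theorem ID_at [IsNoetherianRing R] [Module.Finite R W] {d n : ℕ} (hW : ID R W d)
    (p : PrimeSpectrum R) (hp : p.asIdeal.height ≤ n) :
    ID R (LocalizedModule p.asIdeal.primeCompl W) n := by
  have h1 := ID.loc p.asIdeal.primeCompl (LocalizedModule.mkLinearMap p.asIdeal.primeCompl W) hW
  rw [ID_loc_iff p.asIdeal.primeCompl] at h1 ⊢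
  have hN : IsNoetherianRing (Localization p.asIdeal.primeCompl) :=
    IsLocalization.isNoetherianRing p.asIdeal.primeCompl _ inferInstance
  have hL : IsLocalRing (Localization p.asIdeal.primeCompl) :=
    inferInstanceAs (IsLocalRing (Localization.AtPrime p.asIdeal))
  have hF : Module.Finite (Localization p.asIdeal.primeCompl)
    (LocalizedModule p.asIdeal.primeCompl W) := inferInstance
  refine bass_bound h1 ?_
  rw [IsLocalization.AtPrime.ringKrullDim_eq_height p.asIdeal]
  exact_mod_cast hp

end GGX

namespace GGX
open CategoryTheory CategoryTheory.Abelian RingTheory.Sequence IsLocalRing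
open scoped Pointwise
variable {R : Type u} [CommRing R]
variable {K : Type u} [AddCommGroup K] [Module R K]

theorem theta_apply (T : Set (PrimeSpectrum R)) (x : K) (p : T) :
    GG.thetaFull R T K x p = LocalizedModule.mkLinearMap p.1.asIdeal.primeCompl K x := rfl

theorem mkl_zero {S : Submonoid R} {x : K} :
    LocalizedModule.mkLinearMap S K x = 0 ↔ ∃ s ∈ S, s • x = 0 := by
  rw [IsLocalizedModule.eq_zero_iff S]
  constructor
  · rintro ⟨s, hs⟩; exact ⟨s, s.2, hs⟩
  · rintro ⟨s, h, hs⟩; exact ⟨⟨s, h⟩, hs⟩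

theorem theta_inj [IsNoetherianRing R] {Z Z' : Set (PrimeSpectrum R)} (hK : Module.support R K ⊆ Z)
    (hE : ∀ q ∈ Z', EV R (R ⧸ q.asIdeal) K 0) :
    Function.Injective (GG.thetaFull R (Z \ Z') K) := by
  rw [injective_iff_map_eq_zero]
  intro x hx
  by_contra hx0
  have : Nontrivial (Submodule.span R {x}) := by
    refine ⟨⟨⟨x, Submodule.mem_span_singleton_self x⟩, 0, fun h => hx0 (congrArg Subtype.val h)⟩⟩
  obtain ⟨q, hq⟩ := associatedPrimes.nonempty R (Submodule.span R {x})
  obtain ⟨hqp, f, hf⟩ := (isAssociatedPrime_iff_exists_injective_linearMap _ _).1 hq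
  let Q : PrimeSpectrum R := ⟨q, hqp⟩
  let y : Submodule.span R {x} := f (Submodule.Quotient.mk 1)
  have hann : ∀ r : R, r • (y : K) = 0 → r ∈ q := by
    intro r hr
    have h1 : f (r • Submodule.Quotient.mk 1) = 0 := by
      rw [map_smul]; exact Subtype.ext hr
    have h2 := (injective_iff_map_eq_zero f).1 hf _ h1
    rw [← Submodule.Quotient.mk_smul, Submodule.Quotient.mk_eq_zero] at h2
    simpa using h2
  have hQ : Q ∈ Module.support R K := by
    rw [Module.mem_support_iff']
    exact ⟨y, fun r hr h => hr (hann r h)⟩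
  by_cases hQ' : Q ∈ Z'
  · have h0 := EV.zero_iff.1 (hE Q hQ')
    have h1 := Subsingleton.elim ((Submodule.span R {x}).subtype ∘ₗ f) 0
    have h2 : (y : K) = 0 := LinearMap.congr_fun h1 (Submodule.Quotient.mk 1)
    exact hqp.ne_top ((Ideal.eq_top_iff_one q).2 (hann 1 (by rw [h2, smul_zero])))
  · obtain ⟨r, hr⟩ := Submodule.mem_span_singleton.1 y.2
    have h3 : GG.thetaFull R (Z \ Z') K (y : K) = 0 := by rw [← hr, map_smul, hx, smul_zero]
    have h4 := congrFun h3 ⟨Q, hK hQ, hQ'⟩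
    rw [theta_apply] at h4
    obtain ⟨s, hs, hsy⟩ := mkl_zero.1 h4
    exact hs (hann s hsy)

theorem theta_fin [IsNoetherianRing R] {Z T : Set (PrimeSpectrum R)} (hK : Module.support R K ⊆ Z)
    (hT : ∀ p ∈ T, ∀ q ∈ Z, q ≤ p → q = p) (x : K) : GG.thetaFull R T K x ∈ GG.finSupp R T K := by
  have hfin := Ideal.finite_minimalPrimes_of_isNoetherianRing R
    (LinearMap.ker (LinearMap.toSpanSingleton R K x))
  refine Set.Finite.of_finite_image (f := fun p : T => p.1.asIdeal) (hfin.subset ?_) ?_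
  · rintro _ ⟨p, hp, rfl⟩
    have hp' : ∀ s : R, s • x = 0 → s ∈ p.1.asIdeal := by
      intro s hs
      by_contra hs'
      exact hp (mkl_zero.2 ⟨s, hs', hs⟩)
    refine ⟨⟨p.1.2, fun s hs => hp' s (by simpa using hs)⟩, ?_⟩
    rintro q ⟨hq, hqI⟩ hqp
    have : (⟨q, hq⟩ : PrimeSpectrum R) ∈ Module.support R K := by
      rw [Module.mem_support_iff']
      exact ⟨x, fun r hr h => hr (hqI (by simpa using h))⟩
    have h1 := hT p.1 p.2 _ (hK this) hqp
    exact (congrArg PrimeSpectrum.asIdeal h1).ge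
  · intro p _ q _ h
    exact Subtype.ext (PrimeSpectrum.ext h)

theorem loc_kill {Z : Set (PrimeSpectrum R)} (hK : Module.support R K ⊆ Z) {p q : PrimeSpectrum R}
    (hp : ∀ q ∈ Z, q ≤ p → q = p) (hpq : ¬ p ≤ q) (z : LocalizedModule p.asIdeal.primeCompl K) :
    ∃ s ∉ q.asIdeal, s • z = 0 := by
  obtain ⟨⟨k, t⟩, hk⟩ := IsLocalizedModule.surj p.asIdeal.primeCompl
    (LocalizedModule.mkLinearMap p.asIdeal.primeCompl K) z
  simp only [Submonoid.smul_def] at hk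
  by_contra! hcon
  let I : Ideal R := LinearMap.ker (LinearMap.toSpanSingleton R K k)
  let S' : Submonoid R := p.asIdeal.primeCompl ⊔ q.asIdeal.primeCompl
  have hdis : Disjoint (I : Set R) S' := by
    rw [Set.disjoint_left]
    intro r hr hr'
    obtain ⟨a, ha, b, hb, rfl⟩ := Submonoid.mem_sup.1 hr'
    refine hcon b hb ?_
    refine (loc_bij p.asIdeal.primeCompl (LocalizedModule.mkLinearMap p.asIdeal.primeCompl K) t).1 ?_
    simp only [smul_zero]
    rw [smul_comm, hk, ← map_smul, mkl_zero]
    refine ⟨a, ha, ?_⟩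
    rw [smul_smul]
    simpa [I] using hr
  obtain ⟨p0, hp0, hI, hd⟩ := Ideal.exists_le_prime_disjoint I S' hdis
  rw [Set.disjoint_left] at hd
  let P0 : PrimeSpectrum R := ⟨p0, hp0⟩
  have h1 : P0 ≤ p := fun r hr => by
    by_contra h
    exact hd hr ((le_sup_left : p.asIdeal.primeCompl ≤ S') h)
  have h2 : P0 ≤ q := fun r hr => by
    by_contra h
    exact hd hr ((le_sup_right : q.asIdeal.primeCompl ≤ S') h)
  have h3 : P0 ∈ Module.support R K := by
    rw [Module.mem_support_iff']
    exact ⟨k, fun r hr h => hr (hI (by simpa [I] using h))⟩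
  exact hpq (hp P0 (hK h3) h1 ▸ h2)

theorem fin_kill {Z T : Set (PrimeSpectrum R)} (hK : Module.support R K ⊆ Z)
    (hT : ∀ p ∈ T, ∀ q ∈ Z, q ≤ p → q = p) {q : PrimeSpectrum R} {w : GG.locProd R T K}
    (hw : w ∈ GG.finSupp R T K) (hq : ∀ p : T, w p ≠ 0 → ¬ p.1 ≤ q) :
    ∃ s ∉ q.asIdeal, s • w = 0 := by
  classical
  have h1 : ∀ p : T, ∃ s ∉ q.asIdeal, s • w p = 0 := by
    intro p
    by_cases h : w p = 0
    · exact ⟨1, fun h => q.2.ne_top ((Ideal.eq_top_iff_one _).2 h), by rw [h, smul_zero]⟩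
    · exact loc_kill hK (hT p.1 p.2) (hq p h) _
  choose s hs hsw using h1
  have hw' : {p : T | w p ≠ 0}.Finite := hw
  refine ⟨∏ p ∈ hw'.toFinset, s p, ?_, ?_⟩
  · exact Submonoid.prod_mem q.asIdeal.primeCompl fun p _ => hs p
  · funext p
    by_cases h : w p = 0
    · rw [Pi.smul_apply, h, smul_zero]; rfl
    · have : p ∈ hw'.toFinset := by simpa using h
      rw [Pi.smul_apply, ← Finset.prod_erase_mul _ _ this, mul_smul, hsw, smul_zero]; rfl

/-- The map into the direct sum. -/
noncomputable def thR (T : Set (PrimeSpectrum R)) (h : ∀ x : K, GG.thetaFull R T K x ∈ GG.finSupp R T K) :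
    K →ₗ[R] GG.finSupp R T K := LinearMap.codRestrict _ (GG.thetaFull R T K) h

theorem th_ses {T : Set (PrimeSpectrum R)} (h : ∀ x : K, GG.thetaFull R T K x ∈ GG.finSupp R T K)
    (hi : Function.Injective (GG.thetaFull R T K)) :
    SES (thR T h) (Submodule.mkQ (Submodule.comap (GG.finSupp R T K).subtype
      (LinearMap.range (GG.thetaFull R T K)))) := by
  refine ⟨fun a b hab => hi (congrArg Subtype.val hab), ?_, Submodule.mkQ_surjective _⟩
  intro y
  rw [Submodule.mkQ_apply, Submodule.Quotient.mk_eq_zero]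
  constructor
  · rintro ⟨x, hx⟩; exact ⟨x, Subtype.ext hx⟩
  · rintro ⟨x, hx⟩; exact ⟨x, congrArg Subtype.val hx⟩

theorem next_supp [IsNoetherianRing R] {Z Z' : Set (PrimeSpectrum R)} (hK : Module.support R K ⊆ Z)
    (hT : ∀ p ∈ Z \ Z', ∀ q ∈ Z, q ≤ p → q = p) (hZ : ∀ p ∈ Z, ∀ q, p ≤ q → q ∈ Z) :
    Module.support R (GG.nextKType R (Z \ Z') K) ⊆ Z' := by
  intro q hq
  by_contra hqZ
  rw [Module.mem_support_iff'] at hq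
  obtain ⟨z, hz⟩ := hq
  obtain ⟨w, rfl⟩ := Submodule.mkQ_surjective _ z
  suffices h : ∃ s ∉ q.asIdeal, s • (w : GG.locProd R (Z \ Z') K) ∈
      LinearMap.range (GG.thetaFull R (Z \ Z') K) by
    obtain ⟨s, hs, hsw⟩ := h
    refine hz s hs ?_
    rw [← map_smul, Submodule.mkQ_apply, Submodule.Quotient.mk_eq_zero]
    exact hsw
  by_cases hqZ1 : q ∈ Z
  · let Q : (Z \ Z' : Set _) := ⟨q, hqZ1, hqZ⟩
    obtain ⟨⟨k, t⟩, hk⟩ := IsLocalizedModule.surj q.asIdeal.primeCompl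
      (LocalizedModule.mkLinearMap q.asIdeal.primeCompl K) (w.1 Q)
    simp only [Submonoid.smul_def] at hk
    have hth := theta_fin (T := Z \ Z') hK hT k
    obtain ⟨s, hs, hsw⟩ := fin_kill (q := q) (w := (t : R) • w.1 - GG.thetaFull R _ K k) hK hT
      (Submodule.sub_mem _ (Submodule.smul_mem _ _ w.2) hth) (by
        intro p hp hpq
        have : p = Q := Subtype.ext (hT q ⟨hqZ1, hqZ⟩ p.1 p.2.1 hpq)
        refine hp ?_
        rw [this, Pi.sub_apply, Pi.smul_apply, theta_apply, hk, sub_self])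
    refine ⟨s * t, q.asIdeal.primeCompl.mul_mem hs t.2, s • k, ?_⟩
    rw [smul_sub, sub_eq_zero] at hsw
    rw [map_smul, mul_smul, hsw]
  · obtain ⟨s, hs, hsw⟩ := fin_kill (q := q) hK hT w.2 (by
      intro p hp hpq
      exact hqZ1 (hZ p.1 p.2.1 q hpq))
    exact ⟨s, hs, by rw [hsw]; exact Submodule.zero_mem _⟩

theorem EV.finSupp_kill [IsNoetherianRing R] {T : Set (PrimeSpectrum R)} {q : PrimeSpectrum R}
    (h : ∀ p ∈ T, ¬ q ≤ p) (i : ℕ) : EV R (R ⧸ q.asIdeal) (GG.finSupp R T K) i := by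
  refine EV.finSupp T fun p hp => ?_
  obtain ⟨x, hxq, hxp⟩ := Set.not_subset.1 (h p hp)
  refine EV.of_kill_bij x ?_ (loc_bij p.asIdeal.primeCompl
    (LocalizedModule.mkLinearMap p.asIdeal.primeCompl K) ⟨x, hxp⟩) i
  intro a
  obtain ⟨b, rfl⟩ := Submodule.mkQ_surjective _ a
  rw [← map_smul, Submodule.mkQ_apply, Submodule.Quotient.mk_eq_zero]
  exact q.asIdeal.mul_mem_right b hxq

end GGX

namespace GGX
open CategoryTheory CategoryTheory.Abelian RingTheory.Sequence IsLocalRing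
open scoped Pointwise
variable {R : Type u} [CommRing R]
variable {K : Type u} [AddCommGroup K] [Module R K]

/-- Filtrations given by a codimension function. -/
structure Fil (d : ℕ) (c : PrimeSpectrum R → ℕ) (U : Set (PrimeSpectrum R))
    (F : ℕ → Set (PrimeSpectrum R)) : Prop where
  anti : StrictAnti c
  up : ∀ p ∈ U, ∀ q, p ≤ q → q ∈ U
  mem : ∀ n p, p ∈ F n ↔ p ∈ U ∧ c p + n ≤ d

section
variable {d : ℕ} {c : PrimeSpectrum R → ℕ} {U : Set (PrimeSpectrum R)} {F : ℕ → Set (PrimeSpectrum R)}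

theorem Fil.le (h : Fil d c U F) {p q : PrimeSpectrum R} (hpq : p ≤ q) : c q ≤ c p := h.anti.antitone hpq

theorem Fil.bd (h : Fil d c U F) {n : ℕ} {p : PrimeSpectrum R} (hp : p ∈ F n \ F (n+1)) :
    p ∈ U ∧ c p + n = d := by
  have h1 := (h.mem n p).1 hp.1
  have h2 := fun hh => hp.2 ((h.mem (n+1) p).2 hh)
  refine ⟨h1.1, ?_⟩
  by_contra hne
  exact h2 ⟨h1.1, by omega⟩

theorem Fil.min (h : Fil d c U F) (n : ℕ) : ∀ p ∈ F n \ F (n+1), ∀ q ∈ F n, q ≤ p → q = p := by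
  intro p hp q hq hqp
  by_contra hne
  have h1 := h.anti (lt_of_le_of_ne hqp hne)
  have h2 := (h.bd hp).2
  have h3 := ((h.mem n q).1 hq).2
  omega

theorem Fil.upF (h : Fil d c U F) (n : ℕ) : ∀ p ∈ F n, ∀ q, p ≤ q → q ∈ F n := by
  intro p hp q hpq
  have h1 := (h.mem n p).1 hp
  have h2 := h.le hpq
  exact (h.mem n q).2 ⟨h.up p h1.1 q hpq, by omega⟩

theorem Fil.not_le (h : Fil d c U F) {n : ℕ} {q : PrimeSpectrum R} (hq : c q + n < d) :
    ∀ p ∈ F n \ F (n+1), ¬ q ≤ p := by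
  intro p hp hqp
  have h1 := (h.bd hp).2
  have h2 := h.le hqp
  omega

/-- The starting data for a Cousin complex. -/
structure Cst (d : ℕ) (c : PrimeSpectrum R → ℕ) (U : Set (PrimeSpectrum R)) (N : ModuleCat.{u} R) : Prop where
  supp : Module.support R N ⊆ U
  le : ∀ p ∈ U, c p ≤ d
  ev : ∀ (q : PrimeSpectrum R) (i : ℕ), c q + i < d → EV R (R ⧸ q.asIdeal) N i

variable {N : ModuleCat.{u} R}

theorem Cst.main [IsNoetherianRing R] (h : Cst d c U N) (hF : Fil d c U F) (n : ℕ) :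
    Module.support R (GG.cousinK R F N n) ⊆ F n ∧
    ∀ (q : PrimeSpectrum R) (i : ℕ), c q + (i + n) < d → EV R (R ⧸ q.asIdeal) (GG.cousinK R F N n) i := by
  induction n with
  | zero =>
    refine ⟨fun p hp => (hF.mem 0 p).2 ⟨h.supp hp, h.le p (h.supp hp)⟩, fun q i hi => h.ev q i hi⟩
  | succ n ih =>
    refine ⟨next_supp ih.1 (hF.min n) (hF.upF n), fun q i hi => ?_⟩
    have hs := th_ses (theta_fin ih.1 (hF.min n)) (theta_inj ih.1 (fun q hq => ih.2 q 0 (by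
      have := ((hF.mem _ q).1 hq).2
      omega)))
    exact EV.cov3 hs.inj hs.ex hs.surj (EV.finSupp_kill (hF.not_le (by omega)) i)
      (ih.2 q (i+1) (by omega))

theorem Cst.fin [IsNoetherianRing R] (h : Cst d c U N) (hF : Fil d c U F) (n : ℕ) (x : GG.cousinK R F N n) :
    GG.cousinTheta R F N n x ∈ GG.finSupp R (F n \ F (n+1)) (GG.cousinK R F N n) :=
  theta_fin (h.main hF n).1 (hF.min n) x

theorem Cst.inj [IsNoetherianRing R] (h : Cst d c U N) (hF : Fil d c U F) (n : ℕ) :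
    Function.Injective (GG.cousinTheta R F N n) :=
  theta_inj (h.main hF n).1 (fun q hq => (h.main hF n).2 q 0 (by
      have := ((hF.mem _ q).1 hq).2
      omega))

/-- The map to the Cousin term. -/
noncomputable def Cst.th [IsNoetherianRing R] (h : Cst d c U N) (hF : Fil d c U F) (n : ℕ) :
    GG.cousinK R F N n →ₗ[R] GG.cousinC R F N n := thR _ (h.fin hF n)

/-- The projection to the next kernel. -/
noncomputable def cpr (F : ℕ → Set (PrimeSpectrum R)) (N : ModuleCat.{u} R) (n : ℕ) :
    GG.cousinC R F N n →ₗ[R] GG.cousinK R F N (n+1) :=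
  Submodule.mkQ (Submodule.comap (GG.finSupp R (F n \ F (n + 1)) (GG.cousinK R F N n)).subtype
      (LinearMap.range (GG.thetaFull R (F n \ F (n + 1)) (GG.cousinK R F N n))))

theorem Cst.ses [IsNoetherianRing R] (h : Cst d c U N) (hF : Fil d c U F) (n : ℕ) : SES (h.th hF n) (cpr F N n) :=
  th_ses (h.fin hF n) (h.inj hF n)

theorem cpr_zero {n : ℕ} (z : GG.cousinC R F N n) : cpr F N n z = 0 ↔
    (z : GG.locProd R (F n \ F (n+1)) (GG.cousinK R F N n)) ∈ LinearMap.range (GG.cousinTheta R F N n) :=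
  Submodule.Quotient.mk_eq_zero _

theorem cpr_surj (n : ℕ) : Function.Surjective (cpr F N n) := Submodule.mkQ_surjective _

theorem cousinD_apply {n : ℕ} (z : GG.cousinC R F N n) :
    GG.cousinD R F N n z = GG.cousinTheta R F N (n+1) (cpr F N n z) := rfl

theorem ker_cousinD (n : ℕ) (hi : Function.Injective (GG.cousinTheta R F N (n+1))) :
    LinearMap.ker (GG.cousinD R F N n) =
    Submodule.comap (GG.finSupp R (F n \ F (n + 1)) (GG.cousinK R F N n)).subtype
      (LinearMap.range (GG.cousinTheta R F N n)) := by
  ext z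
  rw [LinearMap.mem_ker, cousinD_apply, Submodule.mem_comap, Submodule.subtype_apply, ← cpr_zero]
  exact ⟨fun h => hi (by rw [h, map_zero]), fun h => by rw [h, map_zero]⟩

theorem theta_inj_of_ker (n : ℕ) (h : LinearMap.ker (GG.cousinD R F N n) =
    Submodule.comap (GG.finSupp R (F n \ F (n + 1)) (GG.cousinK R F N n)).subtype
      (LinearMap.range (GG.cousinTheta R F N n))) :
    Function.Injective (GG.cousinTheta R F N (n+1)) := by
  rw [injective_iff_map_eq_zero]
  intro x hx
  obtain ⟨z, rfl⟩ := cpr_surj n x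
  rw [cpr_zero, ← Submodule.subtype_apply, ← Submodule.mem_comap, ← h, LinearMap.mem_ker, cousinD_apply, hx]

theorem Cst.resolves [IsNoetherianRing R] (h : Cst d c U N) (hF : Fil d c U F) {P : ModuleCat.{u} R → Prop}
    (hP : ∀ n, P (ModuleCat.of R (GG.cousinC R F N n))) : GG.CousinResolves R F N P := by
  refine ⟨?_, h.inj hF 0, fun n => ker_cousinD n (h.inj hF (n+1)), hP⟩
  rintro n _ ⟨x, rfl⟩
  exact h.fin hF n x

end
end GGX

namespace GGX
open CategoryTheory CategoryTheory.Abelian RingTheory.Sequence IsLocalRing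
open scoped Pointwise
variable {R : Type u} [CommRing R]
variable {A B C : Type u} [AddCommGroup A] [Module R A] [AddCommGroup B] [Module R B]
  [AddCommGroup C] [Module R C]

theorem SES.locm {f : A →ₗ[R] B} {g : B →ₗ[R] C} (h : SES f g) (S : Submonoid R) :
    SES (IsLocalizedModule.map S (LocalizedModule.mkLinearMap S A) (LocalizedModule.mkLinearMap S B) f)
      (IsLocalizedModule.map S (LocalizedModule.mkLinearMap S B) (LocalizedModule.mkLinearMap S C) g) :=
  ⟨IsLocalizedModule.map_injective S _ _ f h.inj, IsLocalizedModule.map_exact S _ _ _ f g h.ex,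
    IsLocalizedModule.map_surjective S _ _ g h.surj⟩

variable {d : ℕ} {c : PrimeSpectrum R → ℕ} {F : ℕ → Set (PrimeSpectrum R)}
variable {W : ModuleCat.{u} R} [IsNoetherianRing R]

theorem omega_term (hF : Fil d c Set.univ F)
    (hht : ∀ p : PrimeSpectrum R, p.asIdeal.height + c p ≤ d) {n : ℕ}
    (hK : ∀ (p : PrimeSpectrum R) (m : ℕ), p.asIdeal.height ≤ (n + m : ℕ) →
      ID R (LocalizedModule p.asIdeal.primeCompl (GG.cousinK R F W n)) m) :
    Module.Injective R (GG.cousinC R F W n) := by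
  refine inj_of_EV fun I => EV.finSupp _ fun p hp => ?_
  refine hK p 0 ?_ _ 1 (by omega)
  have h1 := (hF.bd hp).2
  have h2 := hht p
  rw [← h1, Nat.cast_add, add_comm (c p : ℕ∞)] at h2
  simpa using (ENat.add_le_add_iff_right (ENat.coe_ne_top (c p))).1 h2

theorem omega_K (h : Cst d c Set.univ W) (hF : Fil d c Set.univ F)
    (hht : ∀ p : PrimeSpectrum R, p.asIdeal.height + c p ≤ d) (hfin : Module.Finite R W)
    (hid : ID R W d) (n : ℕ) :
    ∀ (p : PrimeSpectrum R) (m : ℕ), p.asIdeal.height ≤ (n + m : ℕ) →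
      ID R (LocalizedModule p.asIdeal.primeCompl (GG.cousinK R F W n)) m := by
  induction n with
  | zero =>
    intro p m hp
    exact ID_at hid p (by simpa using hp)
  | succ n ih =>
    intro p m hp
    have hs := (h.ses hF n).locm p.asIdeal.primeCompl
    refine ID.coker hs.inj hs.ex hs.surj ?_ (ih p (m+1) ?_)
    · refine ID.mono ?_ (Nat.zero_le m)
      exact ID.loc p.asIdeal.primeCompl (LocalizedModule.mkLinearMap p.asIdeal.primeCompl _)
        (ID.zero (omega_term hF hht ih))
    · refine hp.trans ?_
      norm_cast
      omega

theorem omega_C (h : Cst d c Set.univ W) (hF : Fil d c Set.univ F)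
    (hht : ∀ p : PrimeSpectrum R, p.asIdeal.height + c p ≤ d) (hfin : Module.Finite R W)
    (hid : ID R W d) (n : ℕ) : Module.Injective R (GG.cousinC R F W n) :=
  omega_term hF hht (omega_K h hF hht hfin hid n)

end GGX

namespace GGX
open CategoryTheory CategoryTheory.Abelian RingTheory.Sequence IsLocalRing
open scoped Pointwise
variable {R : Type u} [CommRing R]
variable {L K K' A B C A' B' C' : Type u} [AddCommGroup L] [Module R L] [AddCommGroup K] [Module R K]
  [AddCommGroup K'] [Module R K'] [AddCommGroup A] [Module R A] [AddCommGroup B] [Module R B]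
  [AddCommGroup C] [Module R C] [AddCommGroup A'] [Module R A'] [AddCommGroup B'] [Module R B']
  [AddCommGroup C'] [Module R C']

/-- Post-composition. -/
def postc (L : Type u) [AddCommGroup L] [Module R L] (f : A →ₗ[R] B) : (L →ₗ[R] A) →ₗ[R] (L →ₗ[R] B) :=
  LinearMap.compRight R f

@[simp] theorem postc_apply (f : A →ₗ[R] B) (φ : L →ₗ[R] A) : postc L f φ = f ∘ₗ φ := rfl

theorem hom_loc [IsNoetherianRing R] [Module.Finite R L] (S : Submonoid R) (f : A →ₗ[R] B)
    [IsLocalizedModule S f] : IsLocalizedModule S (postc L f) := by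
  refine ⟨fun s => ?_, fun y => ?_, fun {x₁ x₂} h => ?_⟩
  · rw [Module.End.isUnit_iff]
    let e := LinearEquiv.ofBijective (LinearMap.lsmul R B (s : R)) (loc_bij S f s)
    constructor
    · intro a b hab
      ext l
      exact (loc_bij S f s).1 (LinearMap.congr_fun hab l)
    · intro b
      refine ⟨e.symm.toLinearMap ∘ₗ b, ?_⟩
      ext l
      exact e.apply_symm_apply (b l)
  · have := Module.finitePresentation_of_finite R L
    obtain ⟨h, s, hs⟩ := Module.FinitePresentation.exists_lift_of_isLocalizedModule S f y
    exact ⟨(h, s), hs.symm⟩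
  · exact Module.Finite.exists_smul_of_comp_eq_of_isLocalizedModule S f x₁ x₂ h

/-- The comparison of direct sums of localizations. -/
theorem hom_finSupp [IsNoetherianRing R] [Module.Finite R L] (κ : K' ≃ₗ[R] (L →ₗ[R] K))
    {T T' : Set (PrimeSpectrum R)} (hTT : T' ⊆ T) (hL : ∀ p ∈ T, p ∉ T' → ∃ s ∉ p.asIdeal, ∀ l : L, s • l = 0)
    (h : ∀ x : K, GG.thetaFull R T K x ∈ GG.finSupp R T K)
    (h' : ∀ x : K', GG.thetaFull R T' K' x ∈ GG.finSupp R T' K') :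
    ∃ β : (L →ₗ[R] GG.finSupp R T K) ≃ₗ[R] GG.finSupp R T' K',
      ∀ k, β (thR T h ∘ₗ κ k) = thR T' h' k := by
  classical
  let g : ∀ p : T', K' →ₗ[R] (L →ₗ[R] LocalizedModule p.1.asIdeal.primeCompl K) := fun p =>
    postc L (LocalizedModule.mkLinearMap p.1.asIdeal.primeCompl K) ∘ₗ κ.toLinearMap
  have hg : ∀ p : T', IsLocalizedModule p.1.asIdeal.primeCompl (g p) := fun p => by
    have := hom_loc (L := L) p.1.asIdeal.primeCompl (LocalizedModule.mkLinearMap p.1.asIdeal.primeCompl K)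
    exact IsLocalizedModule.of_linearEquiv_right _ _ κ
  let μ : ∀ p : T', LocalizedModule p.1.asIdeal.primeCompl K' ≃ₗ[R]
      (L →ₗ[R] LocalizedModule p.1.asIdeal.primeCompl K) := fun p =>
    have := hg p
    IsLocalizedModule.linearEquiv p.1.asIdeal.primeCompl
      (LocalizedModule.mkLinearMap p.1.asIdeal.primeCompl K') (g p)
  have hμ : ∀ (p : T') k, (μ p).symm (g p k) = LocalizedModule.mkLinearMap p.1.asIdeal.primeCompl K' k := by
    intro p k
    have := hg p
    exact IsLocalizedModule.linearEquiv_symm_apply p.1.asIdeal.primeCompl _ _ k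
  let pr : ∀ p : T, GG.finSupp R T K →ₗ[R] LocalizedModule p.1.asIdeal.primeCompl K := fun p =>
    LinearMap.proj p ∘ₗ (GG.finSupp R T K).subtype
  let ι : T' → T := fun p => ⟨p.1, hTT p.2⟩
  have hι : Function.Injective ι := fun p q hpq => Subtype.ext (congrArg (fun z : T => z.1) hpq)
  have hfin : ∀ φ : L →ₗ[R] GG.finSupp R T K, {p : T | pr p ∘ₗ φ ≠ 0}.Finite := by
    intro φ
    obtain ⟨s, hs⟩ := (inferInstance : Module.Finite R L).fg_top
    refine (Set.Finite.biUnion s.finite_toSet fun a _ => (φ a).2).subset ?_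
    intro p hp
    by_contra hcon
    simp only [Set.mem_iUnion, not_exists] at hcon
    refine hp (LinearMap.ext_on hs fun a ha => ?_)
    have := hcon a ha
    simp only [Set.mem_ofPred_eq, not_not] at this
    simpa [pr] using this
  let β₀ : (L →ₗ[R] GG.finSupp R T K) →ₗ[R] GG.locProd R T' K' :=
    LinearMap.pi fun p => (μ p).symm.toLinearMap ∘ₗ postc L (pr (ι p))
  let β₁ : (L →ₗ[R] GG.finSupp R T K) →ₗ[R] GG.finSupp R T' K' := LinearMap.codRestrict _ β₀ (by
    intro φ
    refine ((hfin φ).preimage hι.injOn).subset ?_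
    intro p hp h0
    refine hp ?_
    change (μ p).symm (pr (ι p) ∘ₗ φ) = 0
    rw [h0, map_zero])
  have hinj : Function.Injective β₁ := by
    rw [injective_iff_map_eq_zero]
    intro φ hφ
    ext l p
    change pr p (φ l) = 0
    by_cases hp : p.1 ∈ T'
    · have h1 := congrFun (congrArg Subtype.val hφ) ⟨p.1, hp⟩
      have h2 : (μ ⟨p.1, hp⟩).symm (pr p ∘ₗ φ) = 0 := h1
      rw [LinearEquiv.map_eq_zero_iff] at h2
      exact LinearMap.congr_fun h2 l
    · obtain ⟨s, hs, hsl⟩ := hL p.1 p.2 hp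
      refine (loc_bij p.1.asIdeal.primeCompl (LocalizedModule.mkLinearMap p.1.asIdeal.primeCompl K) ⟨s, hs⟩).1 ?_
      simp only [smul_zero]
      rw [← map_smul, ← map_smul, hsl, map_zero, map_zero]
  have hsurj : Function.Surjective β₁ := by
    intro w
    have hw : {p : T' | w.1 p ≠ 0}.Finite := w.2
    let φ₀ : L →ₗ[R] GG.locProd R T K := LinearMap.pi fun p =>
      if hp : p.1 ∈ T' then μ ⟨p.1, hp⟩ (w.1 ⟨p.1, hp⟩) else 0
    have hφ : ∀ l, φ₀ l ∈ GG.finSupp R T K := by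
      intro l
      refine (hw.image ι).subset ?_
      intro p hp
      by_cases hpT : p.1 ∈ T'
      · refine ⟨⟨p.1, hpT⟩, ?_, rfl⟩
        intro h0
        refine hp ?_
        simp only [φ₀, LinearMap.pi_apply]
        rw [dif_pos hpT, h0, map_zero, LinearMap.zero_apply]
      · refine absurd ?_ hp
        simp only [φ₀, LinearMap.pi_apply]
        rw [dif_neg hpT, LinearMap.zero_apply]
    refine ⟨LinearMap.codRestrict _ φ₀ hφ, ?_⟩
    apply Subtype.ext
    funext p
    change (μ p).symm (pr (ι p) ∘ₗ LinearMap.codRestrict _ φ₀ hφ) = w.1 p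
    rw [LinearEquiv.symm_apply_eq]
    ext l
    change φ₀ l (ι p) = _
    simp only [φ₀, LinearMap.pi_apply]
    rw [dif_pos p.2]
  refine ⟨LinearEquiv.ofBijective β₁ ⟨hinj, hsurj⟩, fun k => ?_⟩
  apply Subtype.ext
  funext p
  exact hμ p k

/-- Isomorphism of cokernels. -/
theorem SES.coker_equiv {f : A →ₗ[R] B} {g : B →ₗ[R] C} {f' : A' →ₗ[R] B'} {g' : B' →ₗ[R] C'}
    (h : SES f g) (h' : SES f' g') (α : A ≃ₗ[R] A') (β : B ≃ₗ[R] B') (hc : ∀ a, β (f a) = f' (α a)) :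
    Nonempty (C ≃ₗ[R] C') := by
  have hk : Submodule.map β.toLinearMap (LinearMap.ker g) = LinearMap.ker g' := by
    ext y
    simp only [Submodule.mem_map, LinearMap.mem_ker]
    constructor
    · rintro ⟨x, hx, rfl⟩
      obtain ⟨a, rfl⟩ := (h.ex x).1 hx
      exact (h'.ex _).2 ⟨α a, (hc a).symm⟩
    · intro hy
      obtain ⟨a, rfl⟩ := (h'.ex y).1 hy
      refine ⟨f (α.symm a), (h.ex _).2 ⟨_, rfl⟩, ?_⟩
      have := hc (α.symm a)
      simpa using this
  exact ⟨(LinearMap.quotKerEquivOfSurjective g h.surj).symm ≪≫ₗ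
    Submodule.Quotient.equiv _ _ β hk ≪≫ₗ LinearMap.quotKerEquivOfSurjective g' h'.surj⟩

theorem SES.homL {f : A →ₗ[R] B} {g : B →ₗ[R] C} (h : SES f g) (hE : EV R L A 1) :
    SES (postc L f) (postc L g) := by
  refine ⟨?_, ?_, ?_⟩
  · intro a b hab
    ext l
    exact h.inj (LinearMap.congr_fun hab l)
  · intro y
    constructor
    · intro hy
      have h1 : ∀ l, ∃ a, f a = y l := fun l => (h.ex (y l)).1 (LinearMap.congr_fun hy l)
      let e := LinearEquiv.ofInjective f h.inj
      refine ⟨e.symm.toLinearMap ∘ₗ LinearMap.codRestrict _ y h1, ?_⟩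
      ext l
      have := congrArg Subtype.val (e.apply_symm_apply (LinearMap.codRestrict (LinearMap.range f) y h1 l))
      exact this
    · rintro ⟨x, rfl⟩
      ext l
      exact (h.ex _).2 ⟨x l, rfl⟩
  · intro φ
    exact EV.lift h.inj h.ex h.surj hE φ

variable {d : ℕ} {c : PrimeSpectrum R → ℕ} {F F' : ℕ → Set (PrimeSpectrum R)}
variable {W M : ModuleCat.{u} R} [IsNoetherianRing R]

theorem cousin_EV (h : Cst d c Set.univ W) (hF : Fil d c Set.univ F)
    (hC : ∀ n, Module.Injective R (GG.cousinC R F W n)) (hL : ∀ i, EV R L W (i+1)) (n : ℕ) :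
    ∀ i, EV R L (GG.cousinK R F W n) (i+1) := by
  induction n with
  | zero => exact hL
  | succ n ih =>
    intro i
    have hs := h.ses hF n
    exact EV.cov3 hs.inj hs.ex hs.surj (EV.inj (hC n) i) (ih (i+1))

theorem cousin_key (h : Cst d c Set.univ W) (hF : Fil d c Set.univ F)
    (h' : Cst d c (Module.support R M) M) (hF' : Fil d c (Module.support R M) F')
    (hW : Module.Finite R W) (hM : Module.Finite R M) (n : ℕ)
    (κ : GG.cousinK R F' M n ≃ₗ[R] ((M →ₗ[R] W) →ₗ[R] GG.cousinK R F W n)) :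
    ∃ β : ((M →ₗ[R] W) →ₗ[R] GG.cousinC R F W n) ≃ₗ[R] GG.cousinC R F' M n,
      ∀ k, β (h.th hF n ∘ₗ κ k) = h'.th hF' n k := by
  have hL : Module.Finite R (M →ₗ[R] W) := inferInstance
  refine hom_finSupp κ ?_ ?_ (h.fin hF n) (h'.fin hF' n)
  · intro p hp
    have h1 := (hF'.bd hp).2
    refine ⟨(hF.mem _ p).2 ⟨trivial, by omega⟩, fun h2 => ?_⟩
    have := ((hF.mem _ p).1 h2).2
    omega
  · intro p hp hp'
    have h1 := (hF.bd hp).2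
    have hps : p ∉ Module.support R M := by
      intro hps
      refine hp' ⟨(hF'.mem _ p).2 ⟨hps, by omega⟩, fun h2 => ?_⟩
      have := ((hF'.mem _ p).1 h2).2
      omega
    rw [Module.mem_support_iff_of_finite] at hps
    obtain ⟨s, hs, hsp⟩ := Set.not_subset.1 hps
    refine ⟨s, hsp, fun l => ?_⟩
    ext m
    rw [LinearMap.smul_apply, ← map_smul, Module.mem_annihilator.1 hs m, map_zero, LinearMap.zero_apply]

theorem cousin_compare (h : Cst d c Set.univ W) (hF : Fil d c Set.univ F)
    (h' : Cst d c (Module.support R M) M) (hF' : Fil d c (Module.support R M) F')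
    (hC : ∀ n, Module.Injective R (GG.cousinC R F W n)) (hW : Module.Finite R W) (hM : Ref R W M) (n : ℕ) :
    Nonempty (GG.cousinK R F' M n ≃ₗ[R] ((M →ₗ[R] W) →ₗ[R] GG.cousinK R F W n)) := by
  have hfin := hM.fin
  induction n with
  | zero => exact ⟨LinearEquiv.ofBijective _ hM.bij⟩
  | succ n ih =>
    obtain ⟨κ⟩ := ih
    obtain ⟨β, hβ⟩ := cousin_key h hF h' hF' hW hfin n κ
    refine SES.coker_equiv (h'.ses hF' n)
      ((h.ses hF n).homL (cousin_EV h hF hC hM.ev' n 0)) κ β.symm fun k => ?_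
    rw [LinearEquiv.symm_apply_eq]
    exact (hβ k).symm

theorem cousin_GI (h : Cst d c Set.univ W) (hF : Fil d c Set.univ F)
    (h' : Cst d c (Module.support R M) M) (hF' : Fil d c (Module.support R M) F')
    (hC : ∀ n, Module.Injective R (GG.cousinC R F W n)) (hW : Module.Finite R W) (hM : Ref R W M)
    (hT : TR R (M →ₗ[R] W)) (n : ℕ) : GG.IsGorensteinInjective R (GG.cousinC R F' M n) := by
  have hfin := hM.fin
  obtain ⟨κ⟩ := cousin_compare h hF h' hF' hC hW hM n
  obtain ⟨β, -⟩ := cousin_key h hF h' hF' hW hfin n κ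
  exact GI_of_equiv β (GI_hom hT (hC n))

end GGX

namespace GGX
open CategoryTheory CategoryTheory.Abelian RingTheory.Sequence IsLocalRing
open scoped Pointwise
variable {R : Type u} [CommRing R]

theorem supp_of_le {N : Type u} [AddCommGroup N] [Module R N] [Module.Finite R N]
    {p q : PrimeSpectrum R} (hp : p ∈ Module.support R N) (h : p ≤ q) : q ∈ Module.support R N := by
  rw [Module.mem_support_iff_of_finite] at hp ⊢
  exact hp.trans h

theorem ht_quot [IsNoetherianRing R] {N : Type u} [AddCommGroup N] [Module R N] [Module.Finite R N]
    {x : R} (hx : IsSMulRegular N x) {q : PrimeSpectrum R} (hq : q ∈ Module.support R (QuotSMulTop x N))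
    (hq' : q ∈ Module.support R N) {n : ℕ}
    (h : (n : ℕ∞) ≤ Order.height (⟨q, hq⟩ : Module.support R (QuotSMulTop x N))) :
    ((n + 1 : ℕ) : ℕ∞) ≤ Order.height (⟨q, hq'⟩ : Module.support R N) := by
  have hsub : Module.support R (QuotSMulTop x N) = Module.support R N ∩ PrimeSpectrum.zeroLocus {x} :=
    Module.support_quotSMulTop x
  obtain ⟨s, hs, hl⟩ := Order.exists_series_of_le_height _ h
  have hmem : ∀ a : Module.support R (QuotSMulTop x N), a.1 ∈ Module.support R N ∧ x ∈ a.1.asIdeal := by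
    intro a
    have := hsub.le a.2
    exact ⟨this.1, by simpa using this.2⟩
  let f : Module.support R (QuotSMulTop x N) → Module.support R N := fun a => ⟨a.1, (hmem a).1⟩
  have hf : StrictMono f := fun a b hab => hab
  obtain ⟨h1, h2⟩ := hmem s.head
  rw [Module.mem_support_iff_of_finite] at h1
  obtain ⟨p0, hp0, hle⟩ := Ideal.exists_minimalPrimes_le h1
  have hx0 : x ∉ p0 := hx.notMem_of_mem_minimalPrimes hp0
  let P0 : PrimeSpectrum R := ⟨p0, hp0.1.1⟩
  have hP0 : P0 ∈ Module.support R N := by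
    rw [Module.mem_support_iff_of_finite]; exact hp0.1.2
  have hlt : (⟨P0, hP0⟩ : Module.support R N) < (s.map f hf).head := by
    rw [LTSeries.head_map]
    refine lt_of_le_of_ne hle ?_
    intro he
    apply hx0
    have : P0 = s.head.1 := congrArg Subtype.val he
    have h3 : P0.asIdeal = s.head.1.asIdeal := by rw [this]
    change x ∈ P0.asIdeal
    rw [h3]; exact h2
  have := Order.length_le_height (p := RelSeries.cons (s.map f hf) ⟨P0, hP0⟩ hlt)
    (x := (⟨q, hq'⟩ : Module.support R N)) (by
      rw [RelSeries.last_cons, LTSeries.last_map, hs])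
  simpa [hl] using this

theorem ht_ge [IsNoetherianRing R] (t : ℕ) : ∀ {N : Type u} [AddCommGroup N] [Module R N] [Module.Finite R N]
    {p : PrimeSpectrum R} (hp : p ∈ Module.support R N)
    (_ : ∀ i < t, EV R (R ⧸ p.asIdeal) N i), (t : ℕ∞) ≤ Order.height (⟨p, hp⟩ : Module.support R N) := by
  induction t with
  | zero => intros; simp
  | succ t ih =>
    intro N _ _ _ p hp h
    have h0 := h 0 (by omega)
    rw [EV.zero_iff, IsSMulRegular.subsingleton_linearMap_iff, Ideal.annihilator_quotient] at h0
    obtain ⟨x, hx, hr⟩ := h0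
    have hq : p ∈ Module.support R (QuotSMulTop x N) := by
      rw [Module.support_quotSMulTop]
      exact ⟨hp, by simpa using hx⟩
    refine ht_quot hr hq hp (ih hq fun i hi => ?_)
    exact EV.cov3 (qs hr).inj (qs hr).ex (qs hr).surj (h i (by omega)) (h (i+1) (by omega))

section
set_option linter.unusedSectionVars false
variable [IsLocalRing R] [IsNoetherianRing R] {d : ℕ}

noncomputable def coh (p : PrimeSpectrum R) : ℕ := (Order.coheight p).toNat

theorem coh_eq (hd : ringKrullDim R = d) (p : PrimeSpectrum R) : (coh p : ℕ∞) = Order.coheight p := by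
  apply ENat.natCast_toNat
  have h : ((Order.coheight p : ℕ∞) : WithBot ℕ∞) ≤ ringKrullDim R := Order.coheight_le_krullDim p
  rw [hd] at h
  intro ht
  rw [ht] at h
  have h2 : (⊤ : ℕ∞) ≤ (d : ℕ∞) := by exact_mod_cast h
  exact ENat.natCast_ne_top d (top_le_iff.mp h2)

theorem ht_coh (hd : ringKrullDim R = d) (p : PrimeSpectrum R) :
    Order.height p + coh p ≤ (d : ℕ∞) := by
  rw [coh_eq hd]
  have h : ((⨆ a : PrimeSpectrum R, Order.height a + Order.coheight a : ℕ∞) : WithBot ℕ∞) = (d : ℕ∞) := by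
    rw [← Order.krullDim_eq_iSup_height_add_coheight_of_nonempty]; exact hd
  have h' : (⨆ a : PrimeSpectrum R, Order.height a + Order.coheight a : ℕ∞) = (d : ℕ∞) := by exact_mod_cast h
  rw [← h']
  exact le_iSup (fun a : PrimeSpectrum R => Order.height a + Order.coheight a) p

theorem coh_anti (hd : ringKrullDim R = d) : StrictAnti (coh : PrimeSpectrum R → ℕ) := by
  intro p q h
  have := Order.coheight_add_one_le h
  rw [← coh_eq hd, ← coh_eq hd] at this
  have h2 : coh q + 1 ≤ coh p := by exact_mod_cast this
  omega

theorem coh_le (hd : ringKrullDim R = d) (p : PrimeSpectrum R) : coh p ≤ d := by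
  have : ((coh p : ℕ) : ℕ∞) ≤ d := le_trans le_add_self (ht_coh hd p)
  exact_mod_cast this

theorem Cst.of_Dp (hd : ringKrullDim R = d) {N : ModuleCat.{u} R} (hN : Module.Finite R N) (h : Dp R N d)
    {U : Set (PrimeSpectrum R)} (hU : Module.support R N ⊆ U) : Cst d coh U N where
  supp := hU
  le p _ := coh_le hd p
  ev q i hi := isch_coh h (coh q) q (coh_eq hd q).ge (by omega)

theorem htM_coh (hd : ringKrullDim R = d) {N : Type u} [AddCommGroup N] [Module R N] [Module.Finite R N]
    (h : Dp R N d) {p : PrimeSpectrum R} (hp : p ∈ Module.support R N) :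
    GG.htM R N p = ((d - coh p : ℕ) : ℕ∞) := by
  have he : GG.htM R N p = Order.height (⟨p, hp⟩ : Module.support R N) := by
    unfold GG.htM; simp [hp]
  rw [he]
  apply le_antisymm
  · have h1 : Order.height (⟨p, hp⟩ : Module.support R N) ≤ Order.height p :=
      Order.height_le_height_apply_of_strictMono (Subtype.val) (fun _ _ h => h) _
    have h2 := (add_le_add_left h1 (coh p : ℕ∞)).trans (ht_coh hd p)
    have h3 : Order.height (⟨p, hp⟩ : Module.support R N) ≠ ⊤ := by
      intro ht; rw [ht] at h2; simp at h2
    obtain ⟨k, hk⟩ := ENat.ne_top_iff_exists.mp h3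
    rw [← hk] at h2 ⊢
    have : k + coh p ≤ d := by exact_mod_cast h2
    exact_mod_cast (by omega : k ≤ d - coh p)
  · refine ht_ge _ hp fun i hi => isch_coh h (coh p) p (coh_eq hd p).ge (by omega)

theorem Fil.univ (hd : ringKrullDim R = d) :
    Fil d (coh : PrimeSpectrum R → ℕ) Set.univ (fun n => {p | coh p + n ≤ d}) where
  anti := coh_anti hd
  up := fun _ _ _ _ => trivial
  mem := by intro n p; simp

theorem Fil.ht (hd : ringKrullDim R = d) {N : Type u} [AddCommGroup N] [Module R N] [Module.Finite R N]
    (h : Dp R N d) : Fil d coh (Module.support R N) (GG.heightFiltration R N) where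
  anti := coh_anti hd
  up := fun p hp q hq => supp_of_le hp hq
  mem := by
    intro n p
    have hc := coh_le hd p
    constructor
    · rintro ⟨hp, hn⟩
      rw [htM_coh hd h hp] at hn
      have : n ≤ d - coh p := by exact_mod_cast hn
      exact ⟨hp, by omega⟩
    · rintro ⟨hp, hn⟩
      refine ⟨hp, ?_⟩
      rw [htM_coh hd h hp]
      exact_mod_cast (by omega : n ≤ d - coh p)

/-- Good modules have a Gorenstein injective Cousin resolution. -/
theorem good_one (hd : ringKrullDim R = d) {M W : ModuleCat.{u} R} (hW : Sdual R W) (hid : ID R W d)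
    (hDW : Dp R W d) (hMf : Module.Finite R M) (hDM : Dp R M d) (hM : Ref R W M) (hT : TR R (M →ₗ[R] W)) :
    GG.CousinResolves R (GG.heightFiltration R M) M (fun N => GG.IsGorensteinInjective R N) := by
  have hWf : Module.Finite R W := hW.fin
  have h1 : Cst d coh Set.univ W := Cst.of_Dp hd hWf hDW (Set.subset_univ _)
  have h2 : Cst d coh (Module.support R M) M := Cst.of_Dp hd hMf hDM subset_rfl
  have hF := Fil.univ (R := R) hd
  have hF' := Fil.ht hd hDM
  refine h2.resolves hF' fun n => ?_
  refine cousin_GI h1 hF h2 hF' (fun n => ?_) hWf hM hT n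
  refine omega_C h1 hF (fun p => ?_) hWf hid n
  rw [PrimeSpectrum.height_eq_orderHeight]
  exact ht_coh hd p
end
end GGX

namespace GGX
open CategoryTheory CategoryTheory.Abelian RingTheory.Sequence IsLocalRing
open scoped Pointwise
variable {R : Type u} [CommRing R]

theorem GI_punit : GG.IsGorensteinInjective R PUnit.{u+1} := by
  refine ⟨fun _ => ModuleCat.of R PUnit.{u+1}, fun _ => 0, fun _ => ?_, fun _ => ?_, fun I _ n φ _ => ?_, ?_⟩
  · exact ⟨fun _ _ _ _ _ _ f hf g => ⟨0, fun x => Subsingleton.elim _ _⟩⟩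
  · ext x
    constructor
    · intro _; exact Subsingleton.elim (α := PUnit.{u+1}) _ _
    · intro _; exact ⟨0, Subsingleton.elim (α := PUnit.{u+1}) _ _⟩
  · exact ⟨0, LinearMap.ext fun x => Subsingleton.elim (α := PUnit.{u+1}) _ _⟩
  · refine ⟨LinearEquiv.ofBijective (0 : PUnit.{u+1} →ₗ[R] _) ⟨fun _ _ _ => rfl, fun x => ⟨0, ?_⟩⟩⟩
    apply Subtype.ext
    exact Subsingleton.elim (α := PUnit.{u+1}) _ _

/-- splice short exact sequences. -/
theorem gidLE_of_ses (K C : ℕ → ModuleCat.{u} R) (f : ∀ n, K n →ₗ[R] C n) (g : ∀ n, C n →ₗ[R] K (n+1))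
    (h : ∀ n, SES (f n) (g n)) (hC : ∀ n, GG.IsGorensteinInjective R (C n)) {e : ℕ}
    (he : ∀ n, e < n → ∀ x : C n, x = 0) : GG.gidLE R (K 0) e := by
  have hk : ∀ n, LinearMap.ker (f (n+1) ∘ₗ g n) = LinearMap.ker (g n) := by
    intro n
    rw [LinearMap.ker_comp, LinearMap.ker_eq_bot.2 (h (n+1)).inj]; rfl
  refine ⟨C, fun n => f (n+1) ∘ₗ g n, f 0, hC, (h 0).inj, ?_, fun n => ?_, he⟩
  · rw [hk, ← LinearMap.exact_iff.1 (h 0).ex]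
  · rw [hk, LinearMap.range_comp, LinearMap.range_eq_top.2 (h n).surj, Submodule.map_top,
      ← LinearMap.exact_iff.1 (h (n+1)).ex]

theorem gidLE_of_GI {N : Type u} [AddCommGroup N] [Module R N] (h : GG.IsGorensteinInjective R N) :
    GG.gidLE R N 0 := by
  refine ⟨fun n => Nat.casesOn n (ModuleCat.of R N) (fun _ => ModuleCat.of R PUnit.{u+1}), fun _ => 0,
    LinearMap.id, ?_, fun _ _ h => h, ?_, fun i => ?_, ?_⟩
  · rintro (_ | n)
    · exact h
    · exact GI_punit
  · rw [LinearMap.range_id, LinearMap.ker_zero]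
  · ext x
    constructor
    · intro _; rfl
    · intro _; exact ⟨0, Subsingleton.elim (α := PUnit.{u+1}) _ _⟩
  · rintro (_ | n) hn x
    · omega
    · exact Subsingleton.elim (α := PUnit.{u+1}) _ _

section loc
variable [IsLocalRing R] [IsNoetherianRing R] {d : ℕ} {N : Type u} [AddCommGroup N] [Module R N]

theorem mdepth_iff [Module.Finite R N] [Nontrivial N] {t : ℕ} : (t : ℕ∞) ≤ GG.mdepth R N ↔ Dp R N t := by
  constructor
  · intro h
    rcases t with _ | t
    · intro i hi; omega
    · have h1 : (t : ℕ∞) < GG.mdepth R N := lt_of_lt_of_le (by exact_mod_cast Nat.lt_succ_self t) h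
      obtain ⟨_, ⟨rs, rfl, h2, h3⟩, h4⟩ := lt_sSup_iff.1 h1
      have h5 : t < rs.length := by exact_mod_cast h4
      exact (Dp.of_reg rs h2 h3.toIsWeaklyRegular).mono h5
  · intro h
    obtain ⟨xs, h1, h2, h3⟩ := h.exists_seq
    exact le_sSup ⟨xs, by rw [h1], h2, isReg h2 h3⟩

theorem mdepth_le [Module.Finite R N] : (GG.mdepth R N : WithBot ℕ∞) ≤ Module.supportDim R N ∨ Module.supportDim R N = ⊥ := by
  rcases h : Module.supportDim R N with _ | e
  · exact Or.inr rfl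
  · left
    change ((GG.mdepth R N : ℕ∞) : WithBot ℕ∞) ≤ ((e : ℕ∞) : WithBot ℕ∞)
    rw [WithBot.coe_le_coe]
    refine sSup_le ?_
    rintro _ ⟨rs, rfl, h2, h3⟩
    have h4 := reg_len_le h3
    rw [h] at h4
    exact WithBot.coe_le_coe.1 h4

theorem sop_of_reg (hd : ringKrullDim R = d) {xs : List R} (h : RingTheory.Sequence.IsRegular R xs)
    (hl : xs.length = d) : GG.IsSOP R xs := by
  refine ⟨by rw [hd, hl], reg_mem h, ?_⟩
  have h1 := ringKrullDim_add_length_eq_ringKrullDim_of_isRegular xs h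
  rw [hd, hl] at h1
  have h0 : ringKrullDim (R ⧸ Ideal.ofList xs) ≤ 0 := by
    rcases h2 : ringKrullDim (R ⧸ Ideal.ofList xs) with _ | e
    · exact bot_le
    · rw [h2] at h1
      have h3 : e + d = (d : ℕ∞) := by
        have : ((e + d : ℕ∞) : WithBot ℕ∞) = ((d : ℕ∞) : WithBot ℕ∞) := h1
        exact_mod_cast this
      have h4 : e = 0 := by
        have ht : e ≠ ⊤ := by
          rintro rfl
          simp at h3
        obtain ⟨k, rfl⟩ := ENat.ne_top_iff_exists.mp ht
        have : k + d = d := by exact_mod_cast h3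
        have : k = 0 := by omega
        subst this; rfl
      subst h4; rfl
  have h5 : Ring.KrullDimLE 0 (R ⧸ Ideal.ofList xs) := by
    rw [Ring.krullDimLE_iff]; exact h0
  change maximalIdeal R ≤ (Ideal.ofList xs).radical
  rw [Ideal.radical_eq_sInf]
  refine le_sInf ?_
  rintro J ⟨hJ, hJp⟩
  have h6 : (J.map (Ideal.Quotient.mk (Ideal.ofList xs))).IsPrime :=
    Ideal.map_isPrime_of_surjective Ideal.Quotient.mk_surjective (by rw [Ideal.mk_ker]; exact hJ)
  have h7 : (J.map (Ideal.Quotient.mk (Ideal.ofList xs))).IsMaximal := h6.isMaximal'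
  have h8 : J.IsMaximal := by
    have := Ideal.comap_isMaximal_of_surjective (Ideal.Quotient.mk (Ideal.ofList xs)) Ideal.Quotient.mk_surjective (K := J.map (Ideal.Quotient.mk (Ideal.ofList xs)))
    rwa [Ideal.comap_map_of_surjective _ Ideal.Quotient.mk_surjective, ← RingHom.ker_eq_comap_bot, Ideal.mk_ker, sup_eq_left.2 hJ] at this
  exact (IsLocalRing.eq_maximalIdeal h8).ge

theorem reg_of_sop [Module.Finite R N] (hd : ringKrullDim R = d) (h : Dp R N d) {xs : List R} (hx : GG.IsSOP R xs) :
    IsWeaklyRegular N xs := by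
  obtain ⟨h1, h2, h3⟩ := hx
  rw [hd] at h1
  have h1' : xs.length = d := by exact_mod_cast h1
  refine bal ⊥ bot_le xs h2 ?_ (h1' ▸ h)
  rw [bot_sup_eq]; exact h3

end loc
end GGX

namespace GGX
open CategoryTheory CategoryTheory.Abelian RingTheory.Sequence IsLocalRing
open scoped Pointwise
variable {R : Type u} [CommRing R] [IsLocalRing R] [IsNoetherianRing R] {d : ℕ}

/-- the data of a canonical module -/
structure Om (d : ℕ) (W : ModuleCat.{u} R) : Prop where
  dim : ringKrullDim R = d
  ring : Dp R R d
  sd : Sdual R W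
  id : ID R W d
  dp : Dp R W d

structure Good (d : ℕ) (W M : ModuleCat.{u} R) : Prop where
  dp : Dp R M d
  ref : Ref R W M
  tr : TR R (M →ₗ[R] W)

/-- joint regular sequences -/
def Jt (M : ModuleCat.{u} R) (xs : List R) : Prop :=
  RingTheory.Sequence.IsRegular M xs ∧ RingTheory.Sequence.IsRegular R xs

def JtMax (M : ModuleCat.{u} R) (xs : List R) : Prop :=
  RingTheory.Sequence.IsRegular M xs ∧ RingTheory.Sequence.IsRegular R xs ∧
          ∀ r : R, ¬ (RingTheory.Sequence.IsRegular M (xs ++ [r]) ∧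
            RingTheory.Sequence.IsRegular R (xs ++ [r]))

variable {M W : ModuleCat.{u} R}

theorem exists_sop (hW : Om d W) : ∃ zs : List R, GG.IsSOP R zs ∧ zs.length = d ∧ RingTheory.Sequence.IsRegular R zs := by
  obtain ⟨zs, h1, h2, h3⟩ := hW.ring.exists_seq
  have h4 := isReg h2 h3
  exact ⟨zs, sop_of_reg hW.dim h4 h1, h1, h4⟩

theorem good_of_three (hW : Om d W) (hMf : Module.Finite R M) (hb : GG.IsBalancedBigCM R M) {n : ℕ}
    (hn : GG.gidLE R M n) : Good d W M := by
  obtain ⟨zs, h1, h2, h3⟩ := exists_sop hW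
  have h4 := (hb zs h1).toIsWeaklyRegular
  have hWf := hW.sd.fin
  have hE : ∀ i, EV R M W (i+1) := EV.mcm zs h1.2.1 h4 (h2 ▸ hW.id)
  have hr : Ref R W M := Ref.of_ID hW.sd hW.id hE
  exact ⟨h2 ▸ Dp.of_reg zs h1.2.1 h4, hr, TR_of_BC hW.sd hr (BC.gid hW.sd hW.id hn)⟩

theorem jt_len (hW : Om d W) {xs : List R} (h : RingTheory.Sequence.IsRegular R xs) : xs.length ≤ d := by
  have := reg_len_le h
  rw [Module.supportDim_self_eq_ringKrullDim, hW.dim] at this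
  exact_mod_cast this

theorem jt_app {A : Type u} [AddCommGroup A] [Module R A] [Module.Finite R A] [Nontrivial A] {xs : List R}
    (h : RingTheory.Sequence.IsRegular A xs) {x : R} (hx : x ∈ maximalIdeal R)
    (hr : IsSMulRegular (A ⧸ Ideal.ofList xs • (⊤ : Submodule R A)) x) :
    RingTheory.Sequence.IsRegular A (xs ++ [x]) := by
  refine isReg ?_ ?_
  · intro y hy
    rcases List.mem_append.1 hy with hy | hy
    · exact reg_mem h y hy
    · rw [List.mem_singleton.1 hy]; exact hx
  · rw [isWeaklyRegular_append_iff]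
    exact ⟨h.toIsWeaklyRegular, (isWeaklyRegular_singleton_iff _ _).2 hr⟩

theorem jt_max (hW : Om d W) (hMf : Module.Finite R M) (hM0 : Nontrivial M) (hD : Dp R M d) {xs : List R} (h : JtMax M xs) :
    xs.length = d := by
  obtain ⟨h1, h2, h3⟩ := h
  refine le_antisymm (jt_len hW h2) ?_
  by_contra hlt
  push Not at hlt
  have a1 : Dp R (M ⧸ Ideal.ofList xs • (⊤ : Submodule R M)) 1 :=
    Dp.quots xs h1.toIsWeaklyRegular (hD.mono (by omega))
  have a2 : Dp R (R ⧸ Ideal.ofList xs • (⊤ : Submodule R R)) 1 :=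
    Dp.quots xs h2.toIsWeaklyRegular (hW.ring.mono (by omega))
  have a3 : Dp R ((M ⧸ Ideal.ofList xs • (⊤ : Submodule R M)) × (R ⧸ Ideal.ofList xs • (⊤ : Submodule R R))) 1 :=
    fun i hi => EV.prod (a1 i hi) (a2 i hi)
  obtain ⟨x, hx, hr⟩ := a3.exists_reg
  refine h3 x ⟨jt_app h1 hx ?_, jt_app h2 hx ?_⟩
  · intro a b hab
    have := @hr (a, 0) (b, 0) (Prod.ext hab rfl)
    exact congrArg Prod.fst this
  · intro a b hab
    have := @hr (0, a) (0, b) (Prod.ext rfl hab)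
    exact congrArg Prod.snd this

theorem exists_jt_max (hW : Om d W) (hMf : Module.Finite R M) (hM0 : Nontrivial M) : ∃ xs : List R, JtMax M xs := by
  by_contra hcon
  push Not at hcon
  have key : ∀ n : ℕ, ∃ xs : List R, Jt M xs ∧ n ≤ xs.length := by
    intro n
    induction n with
    | zero => exact ⟨[], ⟨isReg (by simp) (IsWeaklyRegular.nil R M), isReg (by simp) (IsWeaklyRegular.nil R R)⟩, by simp⟩
    | succ n ih =>
      obtain ⟨xs, h, hl⟩ := ih
      have := hcon xs
      unfold JtMax at this
      push Not at this
      obtain ⟨r, hr⟩ := this h.1 h.2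
      exact ⟨xs ++ [r], hr, by simp; omega⟩
  obtain ⟨xs, h, hl⟩ := key (d+1)
  have := jt_len hW h.2
  omega

theorem four_of_good (hW : Om d W) (hMf : Module.Finite R M) (hM0 : Nontrivial M) (hg : Good d W M) (xs : List R)
    (hx : JtMax M xs) : GG.IsGorensteinInjective (R ⧸ Ideal.ofList xs) (M ⧸ (Ideal.ofList xs • (⊤ : Submodule R M))) := by
  have hl := jt_max hW hMf hM0 hg.dp hx
  have hs := sop_of_reg hW.dim hx.2.1 hl
  have hWf := hW.sd.fin
  have hWr : IsWeaklyRegular W xs := reg_of_sop hW.dim hW.dp hs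
  have hid : ID R W xs.length := hl ▸ hW.id
  have hρ := Red.mkQ (Ideal.ofList xs) W
  have hL := Red.mkQ (Ideal.ofList xs) (M →ₗ[R] W)
  have hLr : IsWeaklyRegular (M →ₗ[R] W) xs := (Red.homR xs hρ hWr hg.ref.ev).2.1
  obtain ⟨β, hβ, -⟩ := Red.hom (S := R ⧸ Ideal.ofList xs) xs sS iS hL hρ hWr hg.ref.ev'
  have h1 : GG.IsGorensteinInjective (R ⧸ Ideal.ofList xs)
    (((M →ₗ[R] W) ⧸ Ideal.ofList xs • (⊤ : Submodule R (M →ₗ[R] W))) →ₗ[R ⧸ Ideal.ofList xs]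
      (W ⧸ Ideal.ofList xs • (⊤ : Submodule R W))) :=
    GI_hom (TR.red hx.2.1.toIsWeaklyRegular hg.tr hLr hL) (inj_red hWr hid hρ)
  have hγ : Red (Ideal.ofList xs) (β ∘ₗ evd R W M) := by
    have he : Red (⊥ : Ideal R) (evd R W M) := ⟨hg.ref.bij.2, by
      rw [Submodule.bot_smul]; exact LinearMap.ker_eq_bot.2 hg.ref.bij.1⟩
    have := he.comp hβ
    rwa [bot_sup_eq] at this
  obtain ⟨e⟩ := Red.equiv (S := R ⧸ Ideal.ofList xs) sS hγ (Red.mkQ (Ideal.ofList xs) M)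
  exact GI_of_equiv e h1

theorem good_of_five (hW : Om d W) (hMf : Module.Finite R M) (hM0 : Nontrivial M) (xs : List R)
    (hx : JtMax M xs)
    (h : GG.IsGorensteinInjective (R ⧸ Ideal.ofList xs) (M ⧸ (Ideal.ofList xs • (⊤ : Submodule R M)))) :
    Good d W M := by
  obtain ⟨h1, h2, h3⟩ := hx
  have hWf := hW.sd.fin
  have hm := reg_mem h2
  have hnt : Nontrivial (M ⧸ (Ideal.ofList xs • (⊤ : Submodule R M))) := by
    rw [Submodule.Quotient.nontrivial_iff]
    exact fun he => h1.top_ne_smul he.symm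
  have hnS : Nontrivial (R ⧸ Ideal.ofList xs) := by
    have : Nontrivial (R ⧸ Ideal.ofList xs • (⊤ : Submodule R R)) := by
      rw [Submodule.Quotient.nontrivial_iff]
      exact fun he => h2.top_ne_smul he.symm
    rw [smul_eq_mul, Ideal.mul_top] at this
    exact this
  have hlS : IsLocalRing (R ⧸ Ideal.ofList xs) :=
    IsLocalRing.of_surjective' (Ideal.Quotient.mk _) Ideal.Quotient.mk_surjective
  have hM := Red.mkQ (Ideal.ofList xs) M
  have hMfin : Module.Finite (R ⧸ Ideal.ofList xs) (M ⧸ (Ideal.ofList xs • (⊤ : Submodule R M))) := Red.fin hM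
  have hgid := gidLE_of_GI h
  have hl : xs.length = d := by
    refine le_antisymm (jt_len hW h2) ?_
    by_contra hlt
    push Not at hlt
    have a2 : Dp R (R ⧸ Ideal.ofList xs • (⊤ : Submodule R R)) 1 :=
      Dp.quots xs h2.toIsWeaklyRegular (hW.ring.mono (by omega))
    obtain ⟨x, hxm, hr⟩ := a2.exists_reg
    obtain ⟨e⟩ := Red.equiv (S := R) (Function.surjective_id) (Red.mkQ (Ideal.ofList xs) R) (Red.quotRing (xs := xs))
    have hr' : IsSMulRegular (R ⧸ Ideal.ofList xs) x := (e.isSMulRegular_congr x).1 hr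
    have hr'' : IsSMulRegular (R ⧸ Ideal.ofList xs) (algebraMap R (R ⧸ Ideal.ofList xs) x) := by
      intro a b hab
      apply hr'
      simpa only [algebraMap_smul] using hab
    have := gid_ge (R := R ⧸ Ideal.ofList xs) [algebraMap R (R ⧸ Ideal.ofList xs) x] ?_
      ((isWeaklyRegular_singleton_iff _ _).2 hr'') hgid
    · simp at this
    · intro y hy
      rw [List.mem_singleton.1 hy, IsLocalRing.mem_maximalIdeal, mem_nonunits_iff]
      have hloc : IsLocalHom (algebraMap R (R ⧸ Ideal.ofList xs)) :=
        IsLocalHom.of_surjective _ Ideal.Quotient.mk_surjective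
      intro hu
      exact hxm (isUnit_of_map_unit _ _ hu)
  have hs := sop_of_reg hW.dim h2 hl
  have hWr : IsWeaklyRegular W xs := reg_of_sop hW.dim hW.dp hs
  have hid : ID R W xs.length := hl ▸ hW.id
  have hρ := Red.mkQ (Ideal.ofList xs) W
  have hsd : Sdual (R ⧸ Ideal.ofList xs) (W ⧸ Ideal.ofList xs • (⊤ : Submodule R W)) := sdual_red hW.sd hWr hid hρ
  have hinj : Module.Injective (R ⧸ Ideal.ofList xs) (W ⧸ Ideal.ofList xs • (⊤ : Submodule R W)) := inj_red hWr hid hρ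
  have hBC := BC.gid hsd (ID.zero hinj) hgid
  have hRef : Ref (R ⧸ Ideal.ofList xs) (W ⧸ Ideal.ofList xs • (⊤ : Submodule R W)) (M ⧸ (Ideal.ofList xs • (⊤ : Submodule R M))) :=
    Ref.of_ID hsd (ID.zero hinj) fun i => EV.inj hinj i
  have hTR := TR_of_BC hsd hRef hBC
  have hE : ∀ i, EV R M W (i+1) := EV.mcm xs hm h1.toIsWeaklyRegular hid
  obtain ⟨β, hβ, -⟩ := Red.hom (S := R ⧸ Ideal.ofList xs) xs sS iS hM hρ hWr hE
  have hLr : IsWeaklyRegular (M →ₗ[R] W) xs := (Red.homR xs hρ hWr hE).2.1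
  exact ⟨hl ▸ Dp.of_reg xs hm h1.toIsWeaklyRegular, Ref.of_ID hW.sd hW.id hE,
    TR.of_red hm h2.toIsWeaklyRegular hLr hβ hTR⟩

theorem three_of_two (hW : Om d W) (hMf : Module.Finite R M) (hM0 : Nontrivial M)
    (h1 : GG.mdepth R M = GG.gid R M) (h2 : GG.mdepth R M = GG.mdepth R R) :
    GG.IsBalancedBigCM R M ∧ ∃ n, GG.gidLE R M n := by
  have hD : Dp R M d := by
    rw [← mdepth_iff, h2, mdepth_iff]; exact hW.ring
  constructor
  · intro rs hrs
    exact isReg hrs.2.1 (reg_of_sop hW.dim hD hrs)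
  · by_contra hcon
    push Not at hcon
    have : GG.gid R M = ⊤ := by
      refine sInf_eq_top.2 ?_
      rintro c ⟨n, -, hn⟩
      exact absurd hn (hcon n)
    rw [← h1] at this
    have h3 := mdepth_iff (R := R) (N := M) (t := d+1)
    have h4 : Dp R M (d+1) := by rw [← h3, this]; exact le_top
    rcases mdepth_le (R := R) (N := M) with h5 | h5
    · have h6 := h5.trans (Module.supportDim_le_ringKrullDim R M)
      rw [this, hW.dim] at h6
      have : (⊤ : ℕ∞) ≤ (d : ℕ∞) := by exact_mod_cast h6
      exact ENat.natCast_ne_top d (top_le_iff.mp this)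
    · exact Module.supportDim_ne_bot_of_nontrivial R M h5

theorem two_of_one (hW : Om d W) (hMf : Module.Finite R M) (hM0 : Nontrivial M)
    (h : GG.CousinResolves R (GG.heightFiltration R M) M (fun N => GG.IsGorensteinInjective R N)) :
    (GG.mdepth R M : WithBot ℕ∞) = GG.mdim R M ∧ GG.mdepth R M = GG.gid R M ∧
        GG.mdepth R M = GG.mdepth R R := by
  obtain ⟨hth, hi0, hker, hGI⟩ := h
  have hle : Module.supportDim R M ≤ (d : ℕ∞) := by
    have := Module.supportDim_le_ringKrullDim R M
    rwa [hW.dim] at this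
  obtain ⟨e, he, hed⟩ : ∃ e : ℕ, Module.supportDim R M = (e : ℕ∞) ∧ e ≤ d := by
    rcases hs : Module.supportDim R M with _ | e
    · exact absurd hs (Module.supportDim_ne_bot_of_nontrivial R M)
    · rw [hs] at hle
      have h1 : e ≤ (d : ℕ∞) := WithBot.coe_le_coe.1 hle
      have ht : e ≠ ⊤ := fun h => ENat.natCast_ne_top d (top_le_iff.mp (h ▸ h1))
      obtain ⟨k, rfl⟩ := ENat.ne_top_iff_exists.mp ht
      exact ⟨k, rfl, by exact_mod_cast h1⟩
  have hinj : ∀ n, Function.Injective (GG.cousinTheta R (GG.heightFiltration R M) M n) := by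
    rintro (_ | n)
    · exact hi0
    · exact theta_inj_of_ker n (hker n)
  let K := GG.cousinK R (GG.heightFiltration R M) M
  let f : ∀ n, K n →ₗ[R] GG.cousinC R (GG.heightFiltration R M) M n := fun n =>
    thR _ (fun x => hth n ⟨x, rfl⟩)
  have hses : ∀ n, SES (f n) (cpr (GG.heightFiltration R M) M n) := fun n => th_ses _ (hinj n)
  -- the closed point
  have hcl : closedPoint R ∈ Module.support R M := by
    rw [Module.mem_support_iff_of_finite]
    refine IsLocalRing.le_maximalIdeal ?_
    rw [Ne, Module.annihilator_eq_top_iff, not_subsingleton_iff_nontrivial]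
    exact hM0
  have htm : (e : ℕ∞) ≤ GG.htM R M (closedPoint R) := by
    have h1 : ((e : ℕ) : WithBot ℕ∞) ≤ Order.krullDim (Module.support R M) := he.ge
    obtain ⟨l, hl⟩ := Order.le_krullDim_iff.1 h1
    have h2 := Order.length_le_height (p := l) (x := (⟨closedPoint R, hcl⟩ : Module.support R M))
      (IsLocalRing.le_maximalIdeal l.last.1.2.ne_top)
    rw [hl] at h2
    unfold GG.htM
    simpa [hcl] using h2
  have hkC : ∀ n, n < e → ∀ i, EV R (R ⧸ maximalIdeal R) (GG.cousinC R (GG.heightFiltration R M) M n) i := by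
    intro n hn i
    refine EV.finSupp_kill (q := closedPoint R) (fun p hp hle => ?_) i
    have : p = closedPoint R := le_antisymm (IsLocalRing.le_maximalIdeal p.2.ne_top) hle
    subst this
    exact hp.2 ⟨hcl, le_trans (by exact_mod_cast hn) htm⟩
  have hkK : ∀ i n, i + n < e → EV R (R ⧸ maximalIdeal R) (K n) i := by
    intro i
    induction i with
    | zero =>
      intro n hn
      have h1 := hkC n (by omega) 0
      rw [EV.zero_iff] at h1 ⊢
      refine ⟨fun a b => LinearMap.ext fun x => (hses n).inj ?_⟩
      exact LinearMap.congr_fun (h1.elim (f n ∘ₗ a) (f n ∘ₗ b)) x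
    | succ i ih =>
      intro n hn
      exact EV.cov1 (hses n).inj (hses n).ex (hses n).surj (ih (n+1) (by omega)) (hkC n (by omega) _)
  have hDe : Dp R M e := fun i hi => hkK i 0 (by omega)
  have hgid : GG.gidLE R M e := by
    refine gidLE_of_ses K (fun n => ModuleCat.of R (GG.cousinC R (GG.heightFiltration R M) M n)) f
      (fun n => cpr (GG.heightFiltration R M) M n) hses hGI ?_
    intro n hn x
    apply Subtype.ext
    funext p
    exfalso
    have hp := p.2.1
    have h1 : GG.htM R M p.1 ≤ e := by
      have : ((Order.height (⟨p.1, hp.1⟩ : Module.support R M) : ℕ∞) : WithBot ℕ∞) ≤ (e : ℕ∞) :=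
        (Order.height_le_krullDim _).trans he.le
      have := WithBot.coe_le_coe.1 this
      unfold GG.htM
      simpa [hp.1] using this
    have h2 : (n : ℕ∞) ≤ e := hp.2.trans h1
    have : n ≤ e := by exact_mod_cast h2
    omega
  obtain ⟨zs, hz1, hz2, hz3⟩ := exists_sop hW
  have hge : ∀ n, GG.gidLE R M n → d ≤ n := fun n hn => hz2 ▸ gid_ge zs hz1.2.1 hz3.toIsWeaklyRegular hn
  have hde : e = d := le_antisymm hed (hge e hgid)
  subst hde
  have d1 : GG.mdepth R M = e := by
    refine le_antisymm ?_ (mdepth_iff.2 hDe)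
    rcases mdepth_le (R := R) (N := M) with h5 | h5
    · rw [he] at h5; exact_mod_cast h5
    · rw [h5] at he; exact absurd he.symm (by simp)
  have d2 : GG.mdepth R R = e := by
    refine le_antisymm ?_ (mdepth_iff.2 hW.ring)
    rcases mdepth_le (R := R) (N := R) with h5 | h5
    · rw [Module.supportDim_self_eq_ringKrullDim, hW.dim] at h5; exact_mod_cast h5
    · rw [Module.supportDim_self_eq_ringKrullDim, hW.dim] at h5; exact absurd h5 (by simp)
  have d3 : GG.gid R M = e := by
    refine le_antisymm (sInf_le ⟨e, rfl, hgid⟩) (le_sInf ?_)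
    rintro _ ⟨n, rfl, hn⟩
    exact_mod_cast hge n hn
  refine ⟨?_, d1.trans d3.symm, d1.trans d2.symm⟩
  rw [d1]; exact he.symm

theorem exists_Om (hCM : GG.IsCMLocalRing R) (hR : GG.HasDualizingComplex R) :
    ∃ (d : ℕ) (W : ModuleCat.{u} R), Om d W := by
  obtain ⟨d, hd⟩ : ∃ d : ℕ, ringKrullDim R = d := by
    have h1 : ringKrullDim R < ⊤ := ringKrullDim_lt_top
    have h2 : ringKrullDim R ≠ ⊥ := ringKrullDim_ne_bot
    rcases hs : ringKrullDim R with _ | e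
    · exact absurd hs h2
    · rw [hs] at h1
      have ht : e ≠ ⊤ := by rintro rfl; exact lt_irrefl _ h1
      obtain ⟨k, rfl⟩ := ENat.ne_top_iff_exists.mp ht
      exact ⟨k, rfl⟩
  have hD : Dp R R d := by
    rw [← mdepth_iff]
    unfold GG.IsCMLocalRing at hCM
    rw [hd] at hCM
    have : GG.mdepth R R = (d : ℕ∞) := by exact_mod_cast hCM
    exact this.ge
  obtain ⟨zs, h1, h2, h3⟩ := hD.exists_seq
  obtain ⟨W, h4, h5, h6⟩ := exists_omega hR hd.le zs h2 h3 h1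
  exact ⟨d, W, hd, hD, h4, h5, h6⟩

end GGX

open GG in
/-- Characterizations of G–Gorenstein modules over a Cohen–Macaulay local ring with a
dualizing complex. -/
theorem stmt12 (R : Type u) [CommRing R] [IsLocalRing R] [IsNoetherianRing R]
    (hCM : IsCMLocalRing R) (hR : HasDualizingComplex R)
    (M : ModuleCat.{u} R) (hM0 : ∃ x : M, x ≠ 0) (hMf : Module.Finite R M) :
    (IsGGorenstein R M ↔
      ((mdepth R M : WithBot ℕ∞) = mdim R M ∧ mdepth R M = gid R M ∧
        mdepth R M = mdepth R R)) ∧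
    (IsGGorenstein R M ↔ (IsBalancedBigCM R M ∧ ∃ n, gidLE R M n)) ∧
    (IsGGorenstein R M ↔
      ∀ xs : List R,
        (RingTheory.Sequence.IsRegular M xs ∧ RingTheory.Sequence.IsRegular R xs ∧
          ∀ r : R, ¬ (RingTheory.Sequence.IsRegular M (xs ++ [r]) ∧
            RingTheory.Sequence.IsRegular R (xs ++ [r]))) →
        IsGorensteinInjective (R ⧸ Ideal.span {r | r ∈ xs})
          (M ⧸ (Ideal.span {r | r ∈ xs} • (⊤ : Submodule R M)))) ∧
    (IsGGorenstein R M ↔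
      ∃ xs : List R,
        (RingTheory.Sequence.IsRegular M xs ∧ RingTheory.Sequence.IsRegular R xs ∧
          ∀ r : R, ¬ (RingTheory.Sequence.IsRegular M (xs ++ [r]) ∧
            RingTheory.Sequence.IsRegular R (xs ++ [r]))) ∧
        IsGorensteinInjective (R ⧸ Ideal.span {r | r ∈ xs})
          (M ⧸ (Ideal.span {r | r ∈ xs} • (⊤ : Submodule R M)))) := by
  have hnt : Nontrivial M := by
    obtain ⟨x, hx⟩ := hM0
    exact ⟨x, 0, hx⟩
  obtain ⟨d, W, hW⟩ := GGX.exists_Om hCM hR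
  have h12 : IsGGorenstein R M → ((mdepth R M : WithBot ℕ∞) = mdim R M ∧ mdepth R M = gid R M ∧
        mdepth R M = mdepth R R) := fun h => GGX.two_of_one hW hMf hnt h.2.2
  have h3g : (IsBalancedBigCM R M ∧ ∃ n, gidLE R M n) → GGX.Good d W M := by
    rintro ⟨hb, n, hn⟩
    exact GGX.good_of_three hW hMf hb hn
  have hg1 : GGX.Good d W M → IsGGorenstein R M := fun h =>
    ⟨hM0, hMf, GGX.good_one hW.dim hW.sd hW.id hW.dp hMf h.dp h.ref h.tr⟩
  have h23 : ((mdepth R M : WithBot ℕ∞) = mdim R M ∧ mdepth R M = gid R M ∧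
        mdepth R M = mdepth R R) → (IsBalancedBigCM R M ∧ ∃ n, gidLE R M n) := fun h =>
    GGX.three_of_two hW hMf hnt h.2.1 h.2.2
  have h1g : IsGGorenstein R M → GGX.Good d W M := fun h => h3g (h23 (h12 h))
  refine ⟨⟨h12, fun h => hg1 (h3g (h23 h))⟩, ⟨fun h => h23 (h12 h), fun h => hg1 (h3g h)⟩,
    ⟨fun h xs hx => GGX.four_of_good hW hMf hnt (h1g h) xs hx, fun h => ?_⟩,
    ⟨fun h => ?_, fun ⟨xs, hx, h⟩ => hg1 (GGX.good_of_five hW hMf hnt xs hx h)⟩⟩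
  · obtain ⟨xs, hx⟩ := GGX.exists_jt_max (M := M) hW hMf hnt
    exact hg1 (GGX.good_of_five hW hMf hnt xs hx (h xs hx))
  · obtain ⟨xs, hx⟩ := GGX.exists_jt_max (M := M) hW hMf hnt
    exact ⟨xs, hx, GGX.four_of_good hW hMf hnt (h1g h) xs hx⟩
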